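/- In the finitely presented group A1: the element z is a central element of order 2; the subgroup H1 = <a, b, c, d, e, f, g, h, i, z> has index 2 in A1; and the quotient group H1/<z> is a simple group of order 2^17 * 3^9 * 5^2 * 7 * 11 * 13 (the order of Fi22). -/

import Mathlib

inductive GenA : Type
  | a | b | c | d | e | f | g | h | i | z | t

def sa : FreeGroup GenA := FreeGroup.of GenA.a
def sb : FreeGroup GenA := FreeGroup.of GenA.b
def sc : FreeGroup GenA := FreeGroup.of GenA.c
def sd : FreeGroup GenA := FreeGroup.of GenA.d
def se : FreeGroup GenA := FreeGroup.of GenA.e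
def sf : FreeGroup GenA := FreeGroup.of GenA.f
def sg : FreeGroup GenA := FreeGroup.of GenA.g
def sh : FreeGroup GenA := FreeGroup.of GenA.h
def si : FreeGroup GenA := FreeGroup.of GenA.i
def sz : FreeGroup GenA := FreeGroup.of GenA.z
def st : FreeGroup GenA := FreeGroup.of GenA.t

/-- The relators of the presentation of the 2-fold cover `2.Aut(Fi22)`. -/
def relsA : Set (FreeGroup GenA) :=
  { sa ^ 2, sb ^ 2, sc ^ 2, sd ^ 2, se ^ 2, sf ^ 2, sg ^ 2, sh ^ 2, si ^ 2,
    (sa * sb) ^ 3, (sb * sc) ^ 3 * sz⁻¹, (sc * sd) ^ 3, (sd * se) ^ 3,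
    (se * sf) ^ 3 * sz⁻¹, (sf * sg) ^ 3 * sz⁻¹,
    (sa * sc) ^ 2, (sa * sd) ^ 2, (sa * se) ^ 2, (sa * sf) ^ 2, (sa * sg) ^ 2,
    (sa * sh) ^ 2, (sa * si) ^ 2,
    (sb * sd) ^ 2, (sb * se) ^ 2, (sb * sf) ^ 2, (sb * sg) ^ 2, (sb * sh) ^ 2, (sb * si) ^ 2,
    (sc * se) ^ 2, (sc * sf) ^ 2, (sc * sg) ^ 2, (sc * sh) ^ 2, (sc * si) ^ 2,
    (sd * sf) ^ 2, (sd * sg) ^ 2, (se * sg) ^ 2, (se * sh) ^ 2, (se * si) ^ 2,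
    (sd * sh) ^ 3, (sh * si) ^ 3,
    (sd * si) ^ 2, (sf * sh) ^ 2, (sf * si) ^ 2, (sg * sh) ^ 2, (sg * si) ^ 2,
    (sd * sc * sb * sd * se * sf * sd * sh * si) ^ 10,
    (sa * sb * sc * sd * se * sf * sh) ^ 9,
    (sb * sc * sd * se * sf * sg * sh) ^ 9,
    sz ^ 2,
    sz * sa * sz⁻¹ * sa⁻¹, sz * sb * sz⁻¹ * sb⁻¹, sz * sc * sz⁻¹ * sc⁻¹,
    sz * sd * sz⁻¹ * sd⁻¹, sz * se * sz⁻¹ * se⁻¹, sz * sf * sz⁻¹ * sf⁻¹,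
    sz * sg * sz⁻¹ * sg⁻¹, sz * sh * sz⁻¹ * sh⁻¹, sz * si * sz⁻¹ * si⁻¹,
    st ^ 2, sz * st * sz⁻¹ * st⁻¹,
    st⁻¹ * sa * st * sg, st⁻¹ * sb * st * sf * sz⁻¹, st⁻¹ * sc * st * se * sz⁻¹,
    (sd * st) ^ 2 * sz⁻¹, (sh * st) ^ 2 * sz⁻¹, (si * st) ^ 2 * sz⁻¹ }

/-- The presented group `A1` (the 2-fold cover `2.Aut(Fi22)`). -/
abbrev A1 := PresentedGroup relsA

def ya : A1 := PresentedGroup.of GenA.a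
def yb : A1 := PresentedGroup.of GenA.b
def yc : A1 := PresentedGroup.of GenA.c
def yd : A1 := PresentedGroup.of GenA.d
def ye : A1 := PresentedGroup.of GenA.e
def yf : A1 := PresentedGroup.of GenA.f
def yg : A1 := PresentedGroup.of GenA.g
def yh : A1 := PresentedGroup.of GenA.h
def yi : A1 := PresentedGroup.of GenA.i
def yz : A1 := PresentedGroup.of GenA.z
def yt : A1 := PresentedGroup.of GenA.t

/-- The subgroup `H1 = ⟨a, b, c, d, e, f, g, h, i, z⟩` of `A1`. -/
def H1sub : Subgroup A1 := Subgroup.closure {ya, yb, yc, yd, ye, yf, yg, yh, yi, yz}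

/-! ### Kernel-friendly coset tables -/

namespace CosetTable

noncomputable section

/-- Evaluate a natural number before passing it on. -/
def force {α : Type} (n : ℕ) (k : ℕ → α) : α := Nat.rec (k 0) (fun m _ => k (Nat.succ m)) n

def ifz {α : Type} (c : Bool) (x y : α) : α := Bool.rec y x c

def adjc (s t : ℕ) : Bool :=
  Nat.beq (Nat.mod (Nat.shiftRight 606898459303314964613634 (Nat.add (Nat.mul 9 s) t)) 2) 1

def fld (r s : ℕ) : ℕ := Nat.mod (Nat.shiftRight r (Nat.mul 15 s)) 32768

def setFld (r s c : ℕ) : ℕ := Nat.lor r (Nat.shiftLeft c (Nat.mul 15 s))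

def pt (c : ℕ) : ℕ := Nat.div c 2

def stepCode (r c t : ℕ) : ℕ := Nat.xor (fld r t) (Nat.mod c 2)

structure Hint where
  pos : ℕ
  gen : ℕ
  sgn : ℕ
  word : List ℕ
  back : List ℕ

def stepK (T : ℕ → ℕ) (x c t : ℕ) (fail : Bool) (k : ℕ → Bool) : Bool :=
  ifz (Nat.ble x (pt c)) fail (force (stepCode (T (pt c)) c t) k)

def tryEdge (T : ℕ → ℕ) (x s t c : ℕ) (fail : Bool) (k : ℕ → Bool) : Bool :=
  stepK T x c s fail fun c₁ => stepK T x c₁ t fail fun c₂ =>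
    ifz (adjc s t) (stepK T x c₂ s fail fun c₃ => stepK T x c₃ t fail k) (k c₂)

def pushIf (b : Bool) (s : ℕ) (W : List ℕ) : List ℕ := Bool.rec W (s :: W) b

def tryAll (T : ℕ → ℕ) (x t c : ℕ) (U : List ℕ) :
    ℕ → List ℕ → (ℕ → List ℕ → List ℕ → Bool) → Bool :=
  List.rec (fun R W k => k R W [])
    (fun s _ ih R W k => tryEdge T x s t c (ih R W fun R' W' V => k R' W' (s :: V))
      fun r => force (setFld R s r) fun R' =>
        ifz (Nat.ble x (pt r)) (ih R' W k) (ih R' (s :: W) k)) U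

def closeRow (T : ℕ → ℕ) (x fuel : ℕ) :
    ℕ → List ℕ → List ℕ → (ℕ → List ℕ → Bool) → Bool :=
  Nat.rec (fun _ _ _ _ => false)
    (fun _ ih R W U k => List.rec (k R U)
      (fun t W' _ => force (fld R t) fun c => tryAll T x t c U R W' fun R' W'' U' =>
        ih R' W'' U' k) W) fuel

def memb (s : ℕ) (U : List ℕ) : Bool :=
  List.rec false (fun u _ ih => ifz (Nat.beq u s) true ih) U

def erase (s : ℕ) (U : List ℕ) : List ℕ :=
  List.rec [] (fun u _ ih => ifz (Nat.beq u s) ih (u :: ih)) U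

/-- One step of a verified walk, using the completed rows `< x`, the known part of row `x`,
and edges found from their other end. -/
def walkStep (T : ℕ → ℕ) (x R : ℕ) (U : List ℕ) (c t : ℕ) (B : List ℕ)
    (k : ℕ → List ℕ → Bool) : Bool :=
  ifz (Nat.ble x (pt c))
    (ifz (ifz (Nat.beq (pt c) x) (memb t U) true)
      (List.rec false (fun v B' _ =>
        ifz (Nat.beq v x)
          (ifz (memb t U) false
            (ifz (Nat.beq (pt (fld R t)) (pt c))
              (force (Nat.add (Nat.mul 2 v) (Nat.mod (Nat.xor (fld R t) c) 2))
                fun c' => k c' B') false))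
          (ifz (Nat.ble x v) false
            (ifz (Nat.beq (pt (fld (T v) t)) (pt c))
              (force (Nat.add (Nat.mul 2 v) (Nat.mod (Nat.xor (fld (T v) t) c) 2))
                fun c' => k c' B') false))) B)
      (force (stepCode R c t) fun c' => k c' B))
    (force (stepCode (T (pt c)) c t) fun c' => k c' B)

def walk (T : ℕ → ℕ) (x R : ℕ) (U : List ℕ) (w : List ℕ) :
    ℕ → List ℕ → (ℕ → Bool) → Bool :=
  List.rec (fun c _ k => k c)
    (fun t _ ih c B k => walkStep T x R U c t B fun c' B' => ih c' B' k) w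

def hintLoop (T : ℕ → ℕ) (x : ℕ) (H : List Hint) :
    ℕ → List ℕ → List ℕ → (ℕ → List ℕ → List Hint → Bool) → Bool :=
  List.rec (fun R W U k => closeRow T x 10 R W U fun R' U' => k R' U' [])
    (fun h H' ih R W U k => closeRow T x 10 R W U fun R' U' =>
      ifz (Nat.beq h.pos x)
        (ifz (memb h.gen U')
          (walk T x R' U' h.word (Nat.mul 2 x) h.back fun c => force (Nat.xor c h.sgn) fun r =>
            force (setFld R' h.gen r) fun R'' =>
              ih R'' (pushIf (Nat.ble (Nat.succ (pt r)) x) h.gen []) (erase h.gen U') k)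
          false)
        (k R' U' (h :: H'))) H

/-- State of the construction: number of points, queue of new points (front and back),
remaining hints. -/
def newPts (x : ℕ) (U : List ℕ) :
    ℕ → ℕ → List ℕ → (ℕ → ℕ → List ℕ → Bool) → Bool :=
  List.rec (fun R n Q k => k R n Q)
    (fun s _ ih R n Q k => ifz (Nat.ble 16384 n) false
      (force (setFld R s (Nat.mul 2 n)) fun R' => force (Nat.succ n) fun n' =>
        force (Nat.add (Nat.mul 16 x) s) fun q => ih R' n' (q :: Q) k)) U

def revOnto (L : List ℕ) : List ℕ → (List ℕ → Bool) → Bool :=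
  List.rec (fun M k => k M) (fun q _ ih M k => ih (q :: M) k) L

def popQ (F B : List ℕ) (k : ℕ → List ℕ → List ℕ → Bool) : Bool :=
  List.rec (revOnto B [] fun F' => List.rec false (fun q F'' _ => k q F'' []) F')
    (fun q F' _ => k q F' B) F

/-- Row `x` of the table. `L`: generators, `M`: those moving the base point. -/
def rowK (L M : List ℕ) (T : ℕ → ℕ) (x n : ℕ) (F B : List ℕ) (H : List Hint)
    (k : ℕ → ℕ → List ℕ → List ℕ → List Hint → Bool) : Bool :=
  ifz (Nat.ble n x) (k 0 n F B H)
    (ifz (Nat.beq x 0)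
      (newPts 0 M 0 n B fun R n' B' => k R n' F B' H)
      (popQ F B fun q F' B' => force (Nat.div q 16) fun p => force (Nat.mod q 16) fun t =>
        ifz (Nat.ble x p) false
          (ifz (Nat.beq (fld (T p) t) (Nat.mul 2 x))
            (ifz (memb t L)
            (force (setFld 0 t (Nat.mul 2 p)) fun R =>
              hintLoop T x H R [t] (erase t L) fun R' U H' =>
                newPts x U R' n B' fun R'' n' B'' => k R'' n' F' B'' H')
            false) false)))

def branch (m : ℕ) (l r : ℕ → ℕ) (i : ℕ) : ℕ := ifz (Nat.ble m i) (r i) (l i)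

def rows (L M : List ℕ) (d : ℕ) :
    ℕ → (ℕ → ℕ) → ℕ → List ℕ → List ℕ → List Hint →
      ((ℕ → ℕ) → ℕ → List ℕ → List ℕ → List Hint → Bool) → Bool :=
  Nat.rec (fun lo T n F B H k => rowK L M T lo n F B H fun R => k fun _ => R)
    (fun d ih lo T n F B H k => ih lo T n F B H fun l n F B H =>
      force (Nat.add lo (Nat.pow 2 d)) fun m => ih m (branch lo T l) n F B H fun r =>
        k (branch m l r)) d

def build (L M : List ℕ) (H : List Hint) (d : ℕ) (k : (ℕ → ℕ) → ℕ → Bool) : Bool :=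
  rows L M d 0 (fun _ => 0) 1 [] [] H fun T n _ _ _ => k T n

end

/-! ### Correctness of the construction -/

lemma force_eq {α : Type} (n : ℕ) (k : ℕ → α) : force n k = k n := by cases n <;> rfl

lemma ifz_eq {α : Type} (c : Bool) (x y : α) : ifz c x y = if c then x else y := by
  cases c <;> rfl

lemma ble_eq_decide (a b : ℕ) : Nat.ble a b = decide (a ≤ b) := by
  rw [Bool.eq_iff_iff]; simp

lemma beq_eq_decide (a b : ℕ) : Nat.beq a b = decide (a = b) := by
  rw [Bool.eq_iff_iff]; simp

lemma nat_xor (a b : ℕ) : Nat.xor a b = a ^^^ b := rfl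
lemma nat_lor (a b : ℕ) : Nat.lor a b = a ||| b := rfl
lemma nat_mod (a b : ℕ) : Nat.mod a b = a % b := rfl
lemma nat_div (a b : ℕ) : Nat.div a b = a / b := rfl
lemma nat_mul (a b : ℕ) : Nat.mul a b = a * b := rfl
lemma nat_add (a b : ℕ) : Nat.add a b = a + b := rfl
lemma nat_pow (a b : ℕ) : Nat.pow a b = a ^ b := rfl
lemma nat_shiftRight (a b : ℕ) : Nat.shiftRight a b = a >>> b := rfl
lemma nat_shiftLeft (a b : ℕ) : Nat.shiftLeft a b = a <<< b := rfl

lemma pt_xor (a b : ℕ) (hb : b < 2) : pt (Nat.xor a b) = pt a := by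
  rw [pt, pt, nat_xor, nat_div, nat_div, Nat.xor_div_two, Nat.div_eq_of_lt hb, Nat.xor_zero]

lemma pt_stepCode (r c t : ℕ) : pt (stepCode r c t) = pt (fld r t) :=
  pt_xor _ _ (Nat.mod_lt _ (by decide))

lemma pt_two_mul (n : ℕ) : pt (Nat.mul 2 n) = n := by
  rw [pt, nat_div, nat_mul]; omega

lemma testBit_fld (r s j : ℕ) :
    (fld r s).testBit j = (decide (j < 15) && r.testBit (15 * s + j)) := by
  rw [fld, nat_mod, nat_shiftRight, nat_mul, show (32768 : ℕ) = 2 ^ 15 from rfl,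
    Nat.testBit_mod_two_pow, Nat.testBit_shiftRight]

lemma fld_setFld_self {r s c : ℕ} (hc : c < 32768) (h : fld r s = 0) :
    fld (setFld r s c) s = c := by
  apply Nat.eq_of_testBit_eq
  intro j
  have h0 := testBit_fld r s j
  rw [h, Nat.zero_testBit] at h0
  rw [testBit_fld, setFld, nat_lor, nat_shiftLeft, nat_mul, Nat.testBit_or, Nat.testBit_shiftLeft]
  by_cases hj : j < 15
  · simp only [hj, decide_true, Bool.true_and] at h0 ⊢
    rw [← h0]
    simp
  · simp only [hj, decide_false, Bool.false_and]
    symm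
    exact Nat.testBit_lt_two_pow (lt_of_lt_of_le hc
      (Nat.pow_le_pow_right (n := 2) (by decide) (show 15 ≤ j by omega)))

lemma fld_setFld_ne {r s t c : ℕ} (hc : c < 32768) (h : t ≠ s) :
    fld (setFld r s c) t = fld r t := by
  apply Nat.eq_of_testBit_eq
  intro j
  rw [testBit_fld, testBit_fld, setFld, nat_lor, nat_shiftLeft, nat_mul, Nat.testBit_or,
    Nat.testBit_shiftLeft]
  by_cases hj : j < 15
  · have : (decide (15 * t + j ≥ 15 * s) && c.testBit (15 * t + j - 15 * s)) = false := by
      rcases lt_or_gt_of_ne h with h | h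
      · have : ¬ (15 * t + j ≥ 15 * s) := by omega
        simp [this]
      · rw [Nat.testBit_lt_two_pow (lt_of_lt_of_le hc
          (Nat.pow_le_pow_right (n := 2) (by decide) (show 15 ≤ 15 * t + j - 15 * s by omega)))]
        simp
    rw [this, Bool.or_false]
  · simp [hj]

lemma fld_zero (s : ℕ) : fld 0 s = 0 := by
  rw [fld, nat_mod, nat_shiftRight, Nat.zero_shiftRight]

/-- The maps `f s`, `s ∈ L`, satisfy the Coxeter relations given by `adjc`. -/
structure CoxAct {X : Type} (L : List ℕ) (f : ℕ → X → X) : Prop where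
  invol : ∀ s ∈ L, ∀ x, f s (f s x) = x
  comm : ∀ s ∈ L, ∀ t ∈ L, adjc s t = false → ∀ x, f s (f t x) = f t (f s x)
  braid : ∀ s ∈ L, ∀ t ∈ L, adjc s t = true → ∀ x, f s (f t (f s x)) = f t (f s (f t x))

def RowOk {X : Type} (f : ℕ → X → X) (φ : ℕ → X) (n x R s : ℕ) : Prop :=
  pt (fld R s) < n ∧ f s (φ x) = φ (pt (fld R s))

def TabOk {X : Type} (L : List ℕ) (f : ℕ → X → X) (φ : ℕ → X) (n : ℕ) (T : ℕ → ℕ) (x : ℕ) : Prop :=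
  ∀ y < x, y < n → ∀ s ∈ L, RowOk f φ n y (T y) s

section Soundness

variable {X : Type} {L : List ℕ} {f : ℕ → X → X} {φ : ℕ → X} {n x : ℕ} {T : ℕ → ℕ}

lemma stepK_sound (hT : TabOk L f φ n T x) (hx : x < n) {c t : ℕ} (ht : t ∈ L) {fail : Bool}
    {k : ℕ → Bool} (h : stepK T x c t fail k = true) :
    fail = true ∨ ∃ r, k r = true ∧ pt r < n ∧ φ (pt r) = f t (φ (pt c)) := by
  rw [stepK, ifz_eq, ble_eq_decide, force_eq] at h
  by_cases hc : x ≤ pt c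
  · left; simpa [hc] using h
  · right
    simp only [hc, decide_false, Bool.false_eq_true, if_false] at h
    obtain ⟨h1, h2⟩ := hT (pt c) (by omega) (by omega) t ht
    exact ⟨_, h, by rwa [pt_stepCode], by rw [pt_stepCode, h2]⟩

lemma tryEdge_sound (hf : CoxAct L f) (hT : TabOk L f φ n T x) (hx : x < n) {s t c : ℕ}
    (hs : s ∈ L) (ht : t ∈ L) {y : X} (hc : φ (pt c) = f t y) {fail : Bool} {k : ℕ → Bool}
    (h : tryEdge T x s t c fail k = true) :
    fail = true ∨ ∃ r, k r = true ∧ pt r < n ∧ φ (pt r) = f s y := by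
  rw [tryEdge] at h
  rcases stepK_sound hT hx hs h with h | ⟨c₁, h, -, e₁⟩
  · exact Or.inl h
  rcases stepK_sound hT hx ht h with h | ⟨c₂, h, l₂, e₂⟩
  · exact Or.inl h
  rw [ifz_eq] at h
  by_cases ha : adjc s t = true
  · rw [if_pos ha] at h
    rcases stepK_sound hT hx hs h with h | ⟨c₃, h, -, e₃⟩
    · exact Or.inl h
    rcases stepK_sound hT hx ht h with h | ⟨c₄, h, l₄, e₄⟩
    · exact Or.inl h
    refine Or.inr ⟨c₄, h, l₄, ?_⟩
    rw [e₄, e₃, e₂, e₁, hc, ← hf.braid s hs t ht ha, hf.invol s hs,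
      hf.invol t ht]
  · rw [if_neg ha] at h
    refine Or.inr ⟨c₂, h, l₂, ?_⟩
    rw [e₂, e₁, hc, hf.comm s hs t ht (by simpa using ha), hf.invol t ht]

lemma RowOk.congr {R R' s : ℕ} (h : RowOk f φ n x R s) (e : fld R' s = fld R s) :
    RowOk f φ n x R' s := by
  rwa [RowOk, e]

lemma tryAll_sound (hf : CoxAct L f) (hT : TabOk L f φ n T x) (hx : x < n) (hn : n ≤ 16384)
    {t c : ℕ} (ht : t ∈ L) (hc : φ (pt c) = f t (φ x)) (U : List ℕ) :
    ∀ (R : ℕ) (W : List ℕ) (k : ℕ → List ℕ → List ℕ → Bool), U.Nodup →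
      (∀ s ∈ U, s ∈ L ∧ fld R s = 0) → tryAll T x t c U R W k = true →
      ∃ R' W' V, k R' W' V = true ∧ V.Sublist U ∧ (∀ s ∈ V, fld R' s = 0) ∧
        (∀ s ∈ U, s ∉ V → RowOk f φ n x R' s) ∧ (∀ s ∉ U, fld R' s = fld R s) ∧
        ∀ s ∈ W', s ∈ W ∨ (s ∈ U ∧ s ∉ V) := by
  induction U with
  | nil =>
    intro R W k _ _ h
    exact ⟨R, W, [], h, List.Sublist.refl _, by simp, by simp, by simp, by simp⟩
  | cons s U ih =>
    intro R W k hU hz h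
    obtain ⟨hsU, hU⟩ := List.nodup_cons.1 hU
    have hz' : ∀ s ∈ U, s ∈ L ∧ fld R s = 0 := fun u hu => hz u (List.mem_cons_of_mem _ hu)
    obtain ⟨hsL, hs0⟩ := hz s List.mem_cons_self
    have h' : tryEdge T x s t c (tryAll T x t c U R W fun R' W' V => k R' W' (s :: V))
      (fun r => force (setFld R s r) fun R' =>
        ifz (Nat.ble x (pt r)) (tryAll T x t c U R' W k) (tryAll T x t c U R' (s :: W) k)) = true :=
            h
    rcases tryEdge_sound hf hT hx hsL ht hc h' with h | ⟨r, h, hr, e⟩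
    · obtain ⟨R', W', V, hk, hV, a, b, d, w⟩ := ih R W _ hU hz' h
      have hsV : s ∉ V := fun hs => hsU (hV.subset hs)
      refine ⟨R', W', s :: V, hk, hV.cons_cons s, ?_, ?_, ?_, ?_⟩
      · intro u hu
        rcases List.mem_cons.1 hu with rfl | hu
        · rw [d u hsU, hs0]
        · exact a u hu
      · intro u hu hv
        rw [List.mem_cons, not_or] at hv
        exact b u ((List.mem_cons.1 hu).resolve_left hv.1) hv.2
      · intro u hu
        exact d u fun hu' => hu (List.mem_cons_of_mem _ hu')
      · intro u hu
        rcases w u hu with hu | ⟨hu, hv⟩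
        · exact Or.inl hu
        · refine Or.inr ⟨List.mem_cons_of_mem _ hu, ?_⟩
          rw [List.mem_cons, not_or]
          exact ⟨fun e => hsU (e ▸ hu), hv⟩
    · have hr' : r < 32768 := by
        rw [pt, nat_div] at hr; omega
      have hz'' : ∀ u ∈ U, u ∈ L ∧ fld (setFld R s r) u = 0 := fun u hu =>
        ⟨(hz' u hu).1, by rw [fld_setFld_ne hr' (fun e : u = s => hsU (e ▸ hu)), (hz' u hu).2]⟩
      have key : ∃ W₁, (∀ u ∈ W₁, u ∈ W ∨ u = s) ∧
          tryAll T x t c U (setFld R s r) W₁ k = true := by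
        rw [force_eq, ifz_eq] at h
        split_ifs at h
        · exact ⟨W, fun u hu => Or.inl hu, h⟩
        · exact ⟨s :: W, fun u hu => (List.mem_cons.1 hu).symm, h⟩
      obtain ⟨W₁, hW₁, h⟩ := key
      obtain ⟨R', W', V, hk, hV, a, b, d, w⟩ := ih _ W₁ k hU hz'' h
      have hsV : s ∉ V := fun hs => hsU (hV.subset hs)
      have hsR : RowOk f φ n x R' s := by
        rw [RowOk, d s hsU, fld_setFld_self hr' hs0]
        exact ⟨hr, e.symm⟩
      refine ⟨R', W', V, hk, hV.cons s, a, ?_, ?_, ?_⟩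
      · intro u hu hv
        rcases List.mem_cons.1 hu with rfl | hu
        · exact hsR
        · exact b u hu hv
      · intro u hu
        rw [List.mem_cons, not_or] at hu
        rw [d u hu.2, fld_setFld_ne hr' hu.1]
      · intro u hu
        rcases w u hu with hu | ⟨hu, hv⟩
        · rcases hW₁ u hu with hu | rfl
          · exact Or.inl hu
          · exact Or.inr ⟨List.mem_cons_self, hsV⟩
        · exact Or.inr ⟨List.mem_cons_of_mem _ hu, hv⟩

/-- Row `x` is known except for the generators in `U`. -/
structure PartRow (L : List ℕ) (f : ℕ → X → X) (φ : ℕ → X) (n x R : ℕ) (U : List ℕ) : Prop where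
  nodup : U.Nodup
  unknown : ∀ s ∈ U, s ∈ L ∧ fld R s = 0
  known : ∀ s ∈ L, s ∉ U → RowOk f φ n x R s

lemma closeRow_sound (hf : CoxAct L f) (hT : TabOk L f φ n T x) (hx : x < n) (hn : n ≤ 16384)
    (fuel : ℕ) :
    ∀ (R : ℕ) (W U : List ℕ) (k : ℕ → List ℕ → Bool), PartRow L f φ n x R U →
      (∀ s ∈ W, s ∈ L ∧ s ∉ U) → closeRow T x fuel R W U k = true →
      ∃ R' U', k R' U' = true ∧ PartRow L f φ n x R' U' := by
  induction fuel with
  | zero => intro R W U k _ _ h; exact absurd h (by simp [closeRow])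
  | succ m ih =>
    intro R W U k hR hW h
    cases W with
    | nil => exact ⟨R, U, h, hR⟩
    | cons t W =>
      have h' : (force (fld R t) fun c => tryAll T x t c U R W fun R' W'' U' =>
        closeRow T x m R' W'' U' k) = true := h
      rw [force_eq] at h'
      obtain ⟨htL, htU⟩ := hW t List.mem_cons_self
      obtain ⟨R', W', V, hk, hV, a, b, d, w⟩ :=
        tryAll_sound hf hT hx hn htL (hR.known t htL htU).2.symm U R W _ hR.nodup hR.unknown h'
      refine ih R' W' V k ⟨hV.nodup hR.nodup, fun s hs => ⟨(hR.unknown s (hV.subset hs)).1, a s hs⟩,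
        fun s hs hv => ?_⟩ (fun s hs => ?_) hk
      · by_cases hu : s ∈ U
        · exact b s hu hv
        · exact (hR.known s hs hu).congr (d s hu)
      · rcases w s hs with hs | ⟨hs, hv⟩
        · obtain ⟨h1, h2⟩ := hW s (List.mem_cons_of_mem _ hs)
          exact ⟨h1, fun hv => h2 (hV.subset hv)⟩
        · exact ⟨(hR.unknown s hs).1, hv⟩

lemma memb_cons (s u : ℕ) (U : List ℕ) : memb s (u :: U) = ifz (Nat.beq u s) true (memb s U) := rfl

lemma memb_iff {s : ℕ} {U : List ℕ} : memb s U = true ↔ s ∈ U := by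
  induction U with
  | nil => simp [memb]
  | cons u U ih =>
    rw [memb_cons, ifz_eq, beq_eq_decide, List.mem_cons, ← ih]
    by_cases h : u = s
    · simp [h]
    · simp [h, Ne.symm h]

lemma erase_eq_filter (s : ℕ) (U : List ℕ) : erase s U = U.filter (fun u => u ≠ s) := by
  induction U with
  | nil => rfl
  | cons u U ih =>
    have : erase s (u :: U) = ifz (Nat.beq u s) (erase s U) (u :: erase s U) := rfl
    rw [this, ifz_eq, beq_eq_decide, ih, List.filter_cons]
    by_cases h : u = s <;> simp [h]

lemma walkStep_sound (hf : CoxAct L f) (hT : TabOk L f φ n T x) (hx : x < n) {R : ℕ} {U : List ℕ}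
    (hR : PartRow L f φ n x R U) {c t : ℕ} (ht : t ∈ L) {B : List ℕ} {k : ℕ → List ℕ → Bool}
    (h : walkStep T x R U c t B k = true) :
    ∃ c' B', k c' B' = true ∧ pt c' < n ∧ φ (pt c') = f t (φ (pt c)) := by
  simp only [walkStep, ifz_eq, ble_eq_decide, beq_eq_decide, force_eq] at h
  by_cases hc : x ≤ pt c
  · simp only [hc, decide_true, if_true] at h
    by_cases hc' : (if decide (pt c = x) = true then memb t U else true) = true
    · rw [if_pos hc'] at h
      have key : ∀ v S, v < n → RowOk f φ n v S t → pt (fld S t) = pt c →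
          pt (Nat.add (Nat.mul 2 v) (Nat.mod (Nat.xor (fld S t) c) 2)) < n ∧
          φ (pt (Nat.add (Nat.mul 2 v) (Nat.mod (Nat.xor (fld S t) c) 2))) = f t (φ (pt c)) := by
        intro v S hv hS e
        have : pt (Nat.add (Nat.mul 2 v) (Nat.mod (Nat.xor (fld S t) c) 2)) = v := by
          rw [pt, nat_div, nat_add, nat_mul, nat_mod]; omega
        rw [this]
        exact ⟨hv, by rw [← e, ← hS.2, hf.invol t ht]⟩
      cases B with
      | nil => exact absurd h (by simp)
      | cons v B =>
        simp only [decide_eq_true_eq] at h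
        by_cases hv : v = x
        · subst hv
          by_cases hm : memb t U = true
          · simp [hm] at h
          · rw [memb_iff] at hm
            simp only [if_true, memb_iff, hm, if_false] at h
            by_cases e : pt (fld R t) = pt c
            · rw [if_pos e] at h
              exact ⟨_, _, h, key v R hx (hR.known t ht hm) e⟩
            · simp [e] at h
        · simp only [hv, if_false] at h
          by_cases hv' : x ≤ v
          · simp [hv'] at h
          · simp only [hv', if_false] at h
            by_cases e : pt (fld (T v) t) = pt c
            · rw [if_pos e] at h
              exact ⟨_, _, h, key v (T v) (by omega) (hT v (by omega) (by omega) t ht) e⟩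
            · simp [e] at h
    · rw [if_neg hc'] at h
      by_cases e : pt c = x
      · simp only [e, decide_true, if_true, memb_iff] at hc'
        obtain ⟨h1, h2⟩ := hR.known t ht hc'
        exact ⟨_, _, h, by rwa [pt_stepCode], by rw [pt_stepCode, e, h2]⟩
      · simp [e] at hc'
  · simp only [hc, decide_false, Bool.false_eq_true, if_false] at h
    obtain ⟨h1, h2⟩ := hT (pt c) (by omega) (by omega) t ht
    exact ⟨_, _, h, by rwa [pt_stepCode], by rw [pt_stepCode, h2]⟩

/-- Apply the letters of a word, first letter first. -/
def appWord (f : ℕ → X → X) (w : List ℕ) (x : X) : X := w.foldl (fun y t => f t y) x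

lemma walk_sound (hf : CoxAct L f) (hT : TabOk L f φ n T x) (hx : x < n) {R : ℕ} {U : List ℕ}
    (hR : PartRow L f φ n x R U) (w : List ℕ) :
    ∀ (c : ℕ) (B : List ℕ) (k : ℕ → Bool), (∀ t ∈ w, t ∈ L) → pt c < n →
      walk T x R U w c B k = true →
      ∃ c', k c' = true ∧ pt c' < n ∧ φ (pt c') = appWord f w (φ (pt c)) := by
  induction w with
  | nil => intro c B k _ hc h; exact ⟨c, h, hc, rfl⟩
  | cons t w ih =>
    intro c B k hw hc h
    have h' : (walkStep T x R U c t B fun c' B' => walk T x R U w c' B' k) = true := h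
    obtain ⟨c', B', h, hc', e⟩ := walkStep_sound hf hT hx hR (hw t List.mem_cons_self) h'
    obtain ⟨c'', h, hc'', e'⟩ := ih c' B' k (fun u hu => hw u (List.mem_cons_of_mem _ hu)) hc' h
    exact ⟨c'', h, hc'', by rw [e', e]; rfl⟩

/-- The relation recorded by a hint holds for the maps `f`. -/
structure HintOk (L : List ℕ) (f : ℕ → X → X) (h : Hint) : Prop where
  sgn_lt : h.sgn < 2
  word_mem : ∀ t ∈ h.word, t ∈ L
  rel : ∀ x, f h.gen x = appWord f h.word x

lemma hintLoop_sound (hf : CoxAct L f) (hT : TabOk L f φ n T x) (hx : x < n) (hn : n ≤ 16384)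
    (H : List Hint) :
    ∀ (R : ℕ) (W U : List ℕ) (k : ℕ → List ℕ → List Hint → Bool), (∀ h ∈ H, HintOk L f h) →
      PartRow L f φ n x R U → (∀ s ∈ W, s ∈ L ∧ s ∉ U) → hintLoop T x H R W U k = true →
      ∃ R' U' H', k R' U' H' = true ∧ PartRow L f φ n x R' U' ∧ ∀ h ∈ H', HintOk L f h := by
  induction H with
  | nil =>
    intro R W U k hH hR hW h
    have h' : (closeRow T x 10 R W U fun R' U' => k R' U' []) = true := h
    obtain ⟨R', U', h, hR'⟩ := closeRow_sound hf hT hx hn 10 R W U _ hR hW h'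
    exact ⟨R', U', [], h, hR', by simp⟩
  | cons g H ih =>
    intro R W U k hH hR hW h
    have h' : (closeRow T x 10 R W U fun R' U' =>
      ifz (Nat.beq g.pos x)
        (ifz (memb g.gen U')
          (walk T x R' U' g.word (Nat.mul 2 x) g.back fun c => force (Nat.xor c g.sgn) fun r =>
            force (setFld R' g.gen r) fun R'' =>
              hintLoop T x H R'' (pushIf (Nat.ble (Nat.succ (pt r)) x) g.gen [])
                (erase g.gen U') k)
          false)
        (k R' U' (g :: H))) = true := h
    obtain ⟨R', U', h, hR'⟩ := closeRow_sound hf hT hx hn 10 R W U _ hR hW h'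
    rw [ifz_eq] at h
    split_ifs at h
    swap
    · exact ⟨R', U', g :: H, h, hR', hH⟩
    rw [ifz_eq] at h
    split_ifs at h with hg
    rw [memb_iff] at hg
    obtain ⟨hgL, hg0⟩ := hR'.unknown _ hg
    have hgo := hH g List.mem_cons_self
    obtain ⟨c, h, hc, e⟩ := walk_sound hf hT hx hR' g.word _ _ _ hgo.word_mem
      (by rwa [pt_two_mul]) h
    rw [force_eq, force_eq] at h
    have hpt : pt (Nat.xor c g.sgn) = pt c := pt_xor _ _ hgo.sgn_lt
    have hr : Nat.xor c g.sgn < 32768 := by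
      rw [← hpt, pt, nat_div] at hc; omega
    refine ih _ _ _ k (fun a ha => hH a (List.mem_cons_of_mem _ ha)) ⟨?_, ?_, ?_⟩ ?_ h
    · rw [erase_eq_filter]; exact hR'.nodup.filter _
    · intro s hs
      rw [erase_eq_filter, List.mem_filter] at hs
      obtain ⟨hs, hne⟩ := hs
      exact ⟨(hR'.unknown s hs).1,
        by rw [fld_setFld_ne hr (by simpa using hne), (hR'.unknown s hs).2]⟩
    · intro s hs hU
      rw [erase_eq_filter, List.mem_filter] at hU
      by_cases hsg : s = g.gen
      · subst hsg
        rw [RowOk, fld_setFld_self hr hg0, hpt]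
        exact ⟨hc, by rw [hgo.rel, e, pt_two_mul]⟩
      · exact (hR'.known s hs (fun hu => hU ⟨hu, by simpa using hsg⟩)).congr
          (fld_setFld_ne hr hsg)
    · intro s hs
      have : s = g.gen := by
        revert hs
        cases Nat.ble (Nat.succ (pt (Nat.xor c g.sgn))) x
        · exact fun hs => absurd hs (by simp [pushIf])
        · exact fun hs => by simpa [pushIf] using hs
      subst this
      exact ⟨hgL, by rw [erase_eq_filter, List.mem_filter]; simp⟩

lemma RowOk.mono {φ' : ℕ → X} {n' y R s : ℕ} (h : RowOk f φ n y R s) (hn : n ≤ n') (hy : y < n)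
    (hφ : ∀ z < n, φ' z = φ z) : RowOk f φ' n' y R s :=
  ⟨lt_of_lt_of_le h.1 hn, by rw [hφ y hy, hφ _ h.1, h.2]⟩

lemma TabOk.mono {φ' : ℕ → X} {n' : ℕ} (h : TabOk L f φ n T x) (hx : x < n) (hn : n ≤ n')
    (hφ : ∀ z < n, φ' z = φ z) : TabOk L f φ' n' T x :=
  fun y hy _ s hs => (h y hy (by omega) s hs).mono hn (by omega) hφ

lemma newPts_sound (U : List ℕ) :
    ∀ (φ : ℕ → X) (n R : ℕ) (Q : List ℕ) (k : ℕ → ℕ → List ℕ → Bool), x < n → n ≤ 16384 →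
      PartRow L f φ n x R U → newPts x U R n Q k = true →
      ∃ R' n' Q' φ', k R' n' Q' = true ∧ n ≤ n' ∧ n' ≤ 16384 ∧ (∀ z < n, φ' z = φ z) ∧
        ∀ s ∈ L, RowOk f φ' n' x R' s := by
  induction U with
  | nil =>
    intro φ n R Q k hx hn hR h
    exact ⟨R, n, Q, φ, h, le_rfl, hn, fun _ _ => rfl, fun s hs => hR.known s hs (by simp)⟩
  | cons s U ih =>
    intro φ n R Q k hx hn hR h
    have h' : ifz (Nat.ble 16384 n) false
      (force (setFld R s (Nat.mul 2 n)) fun R' => force (Nat.succ n) fun n' =>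
        force (Nat.add (Nat.mul 16 x) s) fun q => newPts x U R' n' (q :: Q) k) = true := h
    rw [ifz_eq, ble_eq_decide] at h'
    split_ifs at h' with hlt
    simp only [decide_eq_true_eq, not_le] at hlt
    rw [force_eq, force_eq, force_eq] at h'
    obtain ⟨hsU, hU⟩ := List.nodup_cons.1 hR.nodup
    obtain ⟨hsL, hs0⟩ := hR.unknown s List.mem_cons_self
    have hr : Nat.mul 2 n < 32768 := by rw [nat_mul]; omega
    have hφ : ∀ z < n, Function.update φ n (f s (φ x)) z = φ z := fun z hz =>
      Function.update_of_ne (by omega) _ _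
    have hP : PartRow L f (Function.update φ n (f s (φ x))) (n + 1) x
        (setFld R s (Nat.mul 2 n)) U := by
      refine ⟨hU, fun u hu => ?_, fun u hu hv => ?_⟩
      · obtain ⟨a, b⟩ := hR.unknown u (List.mem_cons_of_mem _ hu)
        exact ⟨a, by rw [fld_setFld_ne hr (fun e : u = s => hsU (e ▸ hu)), b]⟩
      · by_cases e : u = s
        · subst e
          rw [RowOk, fld_setFld_self hr hs0, pt_two_mul, hφ x hx, Function.update_self]
          exact ⟨by omega, rfl⟩
        · refine RowOk.congr ?_ (fld_setFld_ne hr e)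
          refine (hR.known u hu ?_).mono (by omega) hx hφ
          rw [List.mem_cons, not_or]
          exact ⟨e, hv⟩
    obtain ⟨R', n', Q', φ', h, h1, h2, h3, h4⟩ :=
      ih _ (n + 1) (setFld R s (Nat.mul 2 n)) _ k (by omega) (by omega) hP h'
    exact ⟨R', n', Q', φ', h, by omega, h2, fun z hz => by rw [h3 z (by omega), hφ z hz], h4⟩

lemma revOnto_eq (A : List ℕ) : ∀ (B : List ℕ) (k : List ℕ → Bool),
    revOnto A B k = k (A.reverse ++ B) := by
  induction A with
  | nil => intro B k; rfl
  | cons a A ih =>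
    intro B k
    have : revOnto (a :: A) B k = revOnto A (a :: B) k := rfl
    rw [this, ih]; simp

lemma popQ_sound {F B : List ℕ} {k : ℕ → List ℕ → List ℕ → Bool} (h : popQ F B k = true) :
    ∃ q F' B', k q F' B' = true := by
  cases F with
  | cons q F => exact ⟨q, F, B, h⟩
  | nil =>
    have h' : (revOnto B [] fun F' =>
      List.rec (motive := fun _ => Bool) false (fun q F'' _ => k q F'' []) F') = true := h
    rw [revOnto_eq] at h'
    cases e : B.reverse ++ [] with
    | nil => rw [e] at h'; exact absurd h' (by simp)
    | cons q F => rw [e] at h'; exact ⟨q, F, [], h'⟩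

/-- Everything known before row `x` is processed. -/
structure BuildInv (L : List ℕ) (f : ℕ → X → X) (x₀ : X) (φ : ℕ → X) (n : ℕ) (T : ℕ → ℕ) (x : ℕ)
    (H : List Hint) : Prop where
  base : φ 0 = x₀
  pos : 0 < n
  le : n ≤ 16384
  hints : ∀ h ∈ H, HintOk L f h
  tab : TabOk L f φ n T x

lemma rowK_sound (hf : CoxAct L f) {x₀ : X} {M : List ℕ} (hM : M.Nodup) (hML : ∀ s ∈ M, s ∈ L)
    (hL : L.Nodup) (hfix : ∀ s ∈ L, s ∉ M → f s x₀ = x₀) {F B : List ℕ} {H : List Hint}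
    {k : ℕ → ℕ → List ℕ → List ℕ → List Hint → Bool} (hI : BuildInv L f x₀ φ n T x H)
    (h : rowK L M T x n F B H k = true) :
    ∃ R n' F' B' H' φ', k R n' F' B' H' = true ∧
      ∀ T' : ℕ → ℕ, (∀ y < x, T' y = T y) → T' x = R → BuildInv L f x₀ φ' n' T' (x + 1) H' := by
  rw [rowK, ifz_eq, ble_eq_decide] at h
  by_cases hx : n ≤ x
  · rw [if_pos (by simpa using hx)] at h
    refine ⟨0, n, F, B, H, φ, h, fun T' hT' _ => ⟨hI.base, hI.pos, hI.le, hI.hints, ?_⟩⟩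
    intro y _ hyn s hs
    rw [hT' y (by omega)]
    exact hI.tab y (by omega) hyn s hs
  rw [if_neg (by simpa using hx), ifz_eq, beq_eq_decide] at h
  rw [not_le] at hx
  have extend : ∀ R n' φ', n ≤ n' → n' ≤ 16384 → (∀ z < n, φ' z = φ z) →
      (∀ s ∈ L, RowOk f φ' n' x R s) → ∀ H' : List Hint, (∀ h ∈ H', HintOk L f h) →
      ∀ T' : ℕ → ℕ, (∀ y < x, T' y = T y) → T' x = R →
      BuildInv L f x₀ φ' n' T' (x + 1) H' := by
    intro R n' φ' h1 h2 h3 h4 H' hH' T' hT' hTx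
    refine ⟨by rw [h3 0 hI.pos, hI.base], lt_of_lt_of_le hI.pos h1, h2, hH', ?_⟩
    intro y hy hyn s hs
    rcases Nat.lt_succ_iff_lt_or_eq.1 hy with hy | rfl
    · rw [hT' y hy]
      exact (hI.tab y hy (by omega) s hs).mono h1 (by omega) h3
    · rw [hTx]; exact h4 s hs
  by_cases hx0 : x = 0
  · subst hx0
    rw [if_pos (by simp)] at h
    obtain ⟨R', n', Q', φ', h, h1, h2, h3, h4⟩ :=
      newPts_sound (L := L) (f := f) M φ n 0 B _ hx hI.le
      ⟨hM, fun s hs => ⟨hML s hs, fld_zero s⟩, fun s hs hsM => by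
        rw [RowOk, fld_zero]
        exact ⟨hI.pos, by rw [hI.base, hfix s hs hsM]; exact hI.base.symm⟩⟩ h
    exact ⟨R', n', F, Q', H, φ', h, extend R' n' φ' h1 h2 h3 h4 H hI.hints⟩
  rw [if_neg (by simpa using hx0)] at h
  obtain ⟨q, F', B', h⟩ := popQ_sound h
  rw [force_eq, force_eq] at h
  set p := Nat.div q 16
  set t := Nat.mod q 16
  rw [ifz_eq, ble_eq_decide] at h
  split_ifs at h with hp
  simp only [decide_eq_true_eq, not_le] at hp
  rw [ifz_eq, beq_eq_decide] at h
  split_ifs at h with he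
  simp only [decide_eq_true_eq] at he
  rw [ifz_eq] at h
  split_ifs at h with ht
  rw [memb_iff] at ht
  rw [force_eq] at h
  have hr : Nat.mul 2 p < 32768 := by
    have := hI.le
    rw [nat_mul]; omega
  obtain ⟨-, e⟩ := hI.tab p hp (by omega) t ht
  rw [he, pt_two_mul] at e
  obtain ⟨R', U', H', h, hR', hH'⟩ :=
      hintLoop_sound hf hI.tab hx hI.le H _ [t] (erase t L) _ hI.hints
    ⟨by rw [erase_eq_filter]; exact hL.filter _, fun s hs => by
      rw [erase_eq_filter, List.mem_filter] at hs
      exact ⟨hs.1, by rw [fld_setFld_ne hr (by simpa using hs.2), fld_zero]⟩, fun s hs hU => by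
      rw [erase_eq_filter, List.mem_filter] at hU
      have : s = t := by
        by_contra hne
        exact hU ⟨hs, by simpa using hne⟩
      subst this
      rw [RowOk, fld_setFld_self hr (fld_zero _), pt_two_mul]
      exact ⟨by omega, by rw [← e, hf.invol _ hs]⟩⟩
    (by
      intro s hs
      rw [List.mem_singleton] at hs
      subst hs
      exact ⟨ht, by rw [erase_eq_filter, List.mem_filter]; simp⟩) h
  obtain ⟨R'', n', Q', φ', h, h1, h2, h3, h4⟩ := newPts_sound U' φ n R' B' _ hx hI.le hR' h
  exact ⟨R'', n', F', Q', H', φ', h, extend R'' n' φ' h1 h2 h3 h4 H' hH'⟩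

lemma branch_eq (m : ℕ) (l r : ℕ → ℕ) (i : ℕ) : branch m l r i = if m ≤ i then r i else l i := by
  rw [branch, ifz_eq, ble_eq_decide]; simp

lemma rows_sound (hf : CoxAct L f) {x₀ : X} {M : List ℕ} (hM : M.Nodup) (hML : ∀ s ∈ M, s ∈ L)
    (hL : L.Nodup) (hfix : ∀ s ∈ L, s ∉ M → f s x₀ = x₀) (d : ℕ) :
    ∀ (lo : ℕ) (T : ℕ → ℕ) (n : ℕ) (F B : List ℕ) (H : List Hint) (φ : ℕ → X)
      (k : (ℕ → ℕ) → ℕ → List ℕ → List ℕ → List Hint → Bool),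
      BuildInv L f x₀ φ n T lo H → rows L M d lo T n F B H k = true →
      ∃ S n' F' B' H' φ', k S n' F' B' H' = true ∧
        ∀ T' : ℕ → ℕ, (∀ y < lo, T' y = T y) → (∀ y, lo ≤ y → y < lo + 2 ^ d → T' y = S y) →
          BuildInv L f x₀ φ' n' T' (lo + 2 ^ d) H' := by
  induction d with
  | zero =>
    intro lo T n F B H φ k hI h
    have h' : (rowK L M T lo n F B H fun R => k fun _ => R) = true := h
    obtain ⟨R, n', F', B', H', φ', h, hB⟩ := rowK_sound hf hM hML hL hfix hI h'
    exact ⟨_, n', F', B', H', φ', h, fun T' h1 h2 => hB T' h1 (h2 lo le_rfl (by simp))⟩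
  | succ d ih =>
    intro lo T n F B H φ k hI h
    have h' : (rows L M d lo T n F B H fun l n F B H =>
      force (Nat.add lo (Nat.pow 2 d)) fun m => rows L M d m (branch lo T l) n F B H fun r =>
        k (branch m l r)) = true := h
    obtain ⟨l, n₁, F₁, B₁, H₁, φ₁, h, hB⟩ := ih lo T n F B H φ _ hI h'
    rw [force_eq, nat_add, nat_pow] at h
    have hI₁ := hB (branch lo T l) (fun y hy => by rw [branch_eq, if_neg (by omega)])
      (fun y hy _ => by rw [branch_eq, if_pos hy])
    obtain ⟨r, n₂, F₂, B₂, H₂, φ₂, h, hB₂⟩ := ih _ _ _ _ _ _ φ₁ _ hI₁ h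
    refine ⟨_, n₂, F₂, B₂, H₂, φ₂, h, fun T' h1 h2 => ?_⟩
    have e : lo + 2 ^ d + 2 ^ d = lo + 2 ^ (d + 1) := by rw [pow_succ]; ring
    rw [← e]
    refine hB₂ T' (fun y hy => ?_) (fun y hy hy' => ?_)
    · rw [branch_eq]
      split_ifs with hlo
      · rw [h2 y hlo (by omega), branch_eq, if_neg (by omega)]
      · exact h1 y (by omega)
    · rw [h2 y (le_trans (Nat.le_add_right _ _) hy) (by omega), branch_eq, if_pos hy]

/-- A successful construction with `n ≤ 2 ^ d` points gives a complete table of the orbit of the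
base point. -/
theorem build_sound (hf : CoxAct L f) {x₀ : X} {M : List ℕ} (hM : M.Nodup)
    (hML : ∀ s ∈ M, s ∈ L) (hL : L.Nodup) (hfix : ∀ s ∈ L, s ∉ M → f s x₀ = x₀) {H : List Hint}
    (hH : ∀ h ∈ H, HintOk L f h) {d : ℕ} {k : (ℕ → ℕ) → ℕ → Bool}
    (h : build L M H d k = true) :
    ∃ T n φ, k T n = true ∧ φ 0 = x₀ ∧ 0 < n ∧ TabOk L f φ n T (2 ^ d) := by
  obtain ⟨S, n', F', B', H', φ', h, hB⟩ := rows_sound hf hM hML hL hfix d 0 (fun _ => 0) 1 [] [] H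
    (fun _ => x₀) _ ⟨rfl, by simp, by simp, hH, fun y hy => absurd hy (by simp)⟩ h
  have := hB S (by simp) (fun _ _ _ => rfl)
  rw [zero_add] at this
  exact ⟨S, n', φ', h, this.base, this.pos, this.tab⟩

end Soundness

end CosetTable

/-! ### Words in Coxeter generators -/

namespace CosetTable

noncomputable section

/-- Rewrite the reversed word `w` so that it ends in `s`, and pass on the rest. -/
def bring (fuel : ℕ) : List ℕ → ℕ → Bool → (List ℕ → Bool) → Bool :=
  Nat.rec (fun _ _ fail _ => fail)
    (fun _ ih w s fail k => List.rec fail (fun t w₁ _ =>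
      ifz (Nat.beq t s) (k w₁) (ih w₁ s fail fun w₂ =>
        ifz (adjc s t) (ih w₂ t fail fun w₃ => k (t :: s :: w₃)) (k (t :: w₂)))) w) fuel

def reduces : List ℕ → List ℕ → Bool :=
  List.rec (fun acc => List.rec true (fun _ _ _ => false) acc)
    (fun s _ ih acc => ifz (Nat.ble 9 s) false (bring 200 acc s (ih (s :: acc)) ih))

end

/-- The generators `p 0, …, p 8` satisfy the Coxeter relations of the diagram. -/
structure IsCox {G : Type*} [Group G] (p : ℕ → G) : Prop where
  invol : ∀ s < 9, p s * p s = 1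
  comm : ∀ s < 9, ∀ t < 9, adjc s t = false → p s * p t = p t * p s
  braid : ∀ s < 9, ∀ t < 9, adjc s t = true → p s * p t * p s = p t * p s * p t

variable {G : Type*} [Group G] {p : ℕ → G}

/-- The element represented by a word. -/
def wd (p : ℕ → G) (w : List ℕ) : G := (w.map p).prod

lemma wd_append (v w : List ℕ) : wd p (v ++ w) = wd p v * wd p w := by simp [wd]

lemma wd_nil : wd p [] = 1 := rfl

lemma wd_cons (s : ℕ) (w : List ℕ) : wd p (s :: w) = p s * wd p w := by simp [wd]

lemma wd_reverse_cons (s : ℕ) (w : List ℕ) : wd p (s :: w).reverse = wd p w.reverse * p s := by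
  simp [wd]

lemma bring_sound (hp : IsCox p) (fuel : ℕ) : ∀ (w : List ℕ) (s : ℕ) (fail : Bool)
    (k : List ℕ → Bool), bring fuel w s fail k = true → (∀ t ∈ w, t < 9) → s < 9 →
    fail = true ∨ ∃ w', (∀ t ∈ w', t < 9) ∧
      wd p w.reverse = wd p w'.reverse * p s ∧ k w' = true := by
  induction fuel with
  | zero => intro w s fail k h _ _; exact Or.inl h
  | succ fuel ih =>
    intro w s fail k h hw hs
    cases w with
    | nil => exact Or.inl h
    | cons t w₁ =>
      replace h : ifz (Nat.beq t s) (k w₁) (bring fuel w₁ s fail fun w₂ =>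
        ifz (adjc s t) (bring fuel w₂ t fail fun w₃ => k (t :: s :: w₃)) (k (t :: w₂))) = true := h
      rw [ifz_eq, beq_eq_decide] at h
      have ht : t < 9 := hw t (by simp)
      have hw₁ : ∀ u ∈ w₁, u < 9 := fun u hu => hw u (by simp [hu])
      by_cases e : t = s
      · subst e
        simp only [decide_true, if_true] at h
        exact Or.inr ⟨w₁, hw₁, wd_reverse_cons _ _, h⟩
      · simp only [e, decide_false, Bool.false_eq_true, if_false] at h
        rcases ih _ _ _ _ h hw₁ hs with h | ⟨w₂, hw₂, e₂, h⟩
        · exact Or.inl h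
        · rw [ifz_eq] at h
          cases a : adjc s t with
          | false =>
            simp only [a, Bool.false_eq_true, if_false] at h
            refine Or.inr ⟨_, ?_, ?_, h⟩
            · intro u hu
              rcases List.mem_cons.1 hu with rfl | hu
              exacts [ht, hw₂ u hu]
            · rw [wd_reverse_cons, wd_reverse_cons, e₂, mul_assoc, mul_assoc, hp.comm s hs t ht a]
          | true =>
            simp only [a, if_true] at h
            rcases ih _ _ _ _ h hw₂ ht with h | ⟨w₃, hw₃, e₃, h⟩
            · exact Or.inl h
            · refine Or.inr ⟨_, ?_, ?_, h⟩
              · intro u hu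
                rcases List.mem_cons.1 hu with rfl | hu
                · exact ht
                rcases List.mem_cons.1 hu with rfl | hu
                exacts [hs, hw₃ u hu]
              · have := hp.braid s hs t ht a
                rw [wd_reverse_cons, wd_reverse_cons, wd_reverse_cons, e₂, e₃]
                simp only [mul_assoc] at this ⊢
                rw [this]

lemma reduces_sound (hp : IsCox p) (w : List ℕ) : ∀ acc : List ℕ, (∀ t ∈ acc, t < 9) →
    reduces w acc = true → wd p acc.reverse * wd p w = 1 := by
  induction w with
  | nil =>
    intro acc _ h
    cases acc with
    | nil => simp [wd]
    | cons => exact absurd h (by simp [reduces])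
  | cons s w ih =>
    intro acc ha h
    replace h : ifz (Nat.ble 9 s) false
      (bring 200 acc s (reduces w (s :: acc)) (reduces w)) = true := h
    rw [ifz_eq, ble_eq_decide] at h
    by_cases hs : 9 ≤ s
    · simp [hs] at h
    simp only [hs, decide_false, Bool.false_eq_true, if_false] at h
    rcases bring_sound hp _ _ _ _ _ h ha (by omega) with h | ⟨w', hw', e, h⟩
    · have := ih (s :: acc) (by
        intro u hu
        rcases List.mem_cons.1 hu with rfl | hu
        exacts [by omega, ha u hu]) h
      rwa [wd_reverse_cons, mul_assoc, ← wd_cons] at this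
    · have := ih w' hw' h
      have hi := hp.invol s (by omega)
      rw [wd_cons, e]
      rw [mul_assoc, ← mul_assoc (p s), hi, one_mul, this]

lemma wd_eq_one (hp : IsCox p) {w : List ℕ} (h : reduces w [] = true) : wd p w = 1 := by
  have := reduces_sound hp w [] (by simp) h
  rwa [List.reverse_nil, wd_nil, one_mul] at this

lemma wd_reverse (hp : IsCox p) {w : List ℕ} (h : ∀ s ∈ w, s < 9) :
    wd p w.reverse = (wd p w)⁻¹ := by
  induction w with
  | nil => simp [wd]
  | cons s w ih =>
    rw [List.reverse_cons, wd_append, ih fun t ht => h t (by simp [ht]), wd_cons, wd_cons, wd_nil,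
      mul_inv_rev, mul_one, ← eq_inv_of_mul_eq_one_left (hp.invol s (h s (by simp)))]

def r48 : List ℕ := [1, 2, 3, 4, 7, 3, 5, 4, 2, 3, 7, 1, 2, 8, 3, 4, 7, 3, 2, 5, 1, 4, 3, 2, 7, 3,
  8, 7, 4, 3, 5, 4, 2, 1, 3, 7, 2, 3, 4, 5, 8, 7, 3, 2, 4, 3, 7, 8]

def pw (u : List ℕ) : ℕ → List ℕ := Nat.rec [] fun _ ih => u ++ ih

end CosetTable

/-! ### Checking the table of degree 14080 -/

namespace CosetTable

noncomputable section

def band (a b : Bool) : Bool := ifz a b false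

def allBelow (f : ℕ → Bool) (n : ℕ) : Bool := Nat.rec true (fun x ih => band (f x) ih) n

def allOf {α : Type} (f : α → Bool) (l : List α) : Bool :=
  List.rec true (fun x _ ih => band (f x) ih) l

/-- The action of the generator `s` on codes of signed points. -/
def codeAct (T : ℕ → ℕ) (s c : ℕ) : ℕ := stepCode (T (pt c)) c s

def nbr (T : ℕ → ℕ) (s x : ℕ) : ℕ := pt (fld (T x) s)

/-- Compare the two ways around the relation between `s` and `t`, given the codes of the
neighbours `c`, `c'` and their rows. -/
def pairOk (T : ℕ → ℕ) (s c R t c' R' : ℕ) : Bool :=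
  force (stepCode R c t) fun a => force (stepCode R' c' s) fun b =>
    ifz (adjc s t) (Nat.beq (codeAct T s a) (codeAct T t b)) (Nat.beq a b)

/-- Check row `x`; `chk` compares a generator with those generators which were already seen
not to decrease `x`. -/
def rowOk (T : ℕ → ℕ) (x r : ℕ) : List ℕ → (ℕ → ℕ → ℕ → Bool) → Bool :=
  List.rec (fun _ => true) (fun s _ ih chk => force (fld r s) fun c => force (T (pt c)) fun R =>
    band (Nat.beq (stepCode R c s) (Nat.mul 2 x))
      (ifz (Nat.ble x (pt c))
        (band (chk s c R) (ih fun t c' R' => band (pairOk T s c R t c' R') (chk t c' R')))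
        (ih chk)))

def isMin (T : ℕ → ℕ) (L : List ℕ) (x : ℕ) : Bool :=
  force (T x) fun r => allOf (fun s => Nat.ble x (pt (fld r s))) L

def follow (T : ℕ → ℕ) (w : List ℕ) : ℕ → (ℕ → Bool) → Bool :=
  List.rec (fun c k => k c) (fun s _ ih c k => force (codeAct T s c) fun c' => ih c' k) w

/-- The word `w` acts as the sign `e` on all minimal points of orbits of `L`. -/
def relOk (T : ℕ → ℕ) (n : ℕ) (L w : List ℕ) (e : ℕ) : Bool :=
  allBelow (fun x => ifz (isMin T L x) (follow T w (Nat.mul 2 x) fun c =>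
    Nat.beq c (Nat.add (Nat.mul 2 x) e)) true) n

def bit (m y : ℕ) : Bool := Nat.beq (Nat.mod (Nat.shiftRight m y) 2) 1

def visit (r : ℕ) (L : List ℕ) :
    ℕ → ℕ → List ℕ → (ℕ → ℕ → List ℕ → Bool) → Bool :=
  List.rec (fun m c q k => k m c q) (fun s _ ih m c q k => force (pt (fld r s)) fun y =>
    ifz (bit m y) (ih m c q k)
      (force (Nat.lor m (Nat.shiftLeft 1 y)) fun m' => force (Nat.succ c) fun c' =>
        ih m' c' (y :: q) k)) L

/-- Collect in the bit mask `m` points of the orbit of a point, until the number `c` of points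
reaches `v`. The list `q` holds the points whose neighbours are still to be visited. -/
def search (T : ℕ → ℕ) (L : List ℕ) (v fuel : ℕ) : ℕ → ℕ → List ℕ → Bool :=
  Nat.rec (fun _ _ _ => false) (fun _ ih m c q => ifz (Nat.ble v c) true
    (List.rec false (fun x q' _ => force (T x) fun r => visit r L m c q' ih) q)) fuel

def orbitGe (T : ℕ → ℕ) (L : List ℕ) (v y : ℕ) : Bool :=
  force (Nat.shiftLeft 1 y) fun m => search T L v 5000 m 1 [y]

def minsIn (T : ℕ → ℕ) (n : ℕ) (L B : List ℕ) : Bool :=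
  allBelow (fun x => ifz (isMin T L x) (memb x B) true) n

def fixesAll (T : ℕ → ℕ) (L : List ℕ) (B : List ℕ) : Bool :=
  allOf (fun s => allOf (fun x => Nat.beq (nbr T s x) x) B) L

def trivOn (T : ℕ → ℕ) (w : List ℕ) (B : List ℕ) : Bool :=
  allOf (fun x => follow T w (Nat.mul 2 x) fun c => Nat.beq (pt c) x) B

def u₁ : List ℕ := [0, 1, 2, 3, 4, 5, 7]
def u₂ : List ℕ := [1, 2, 3, 4, 5, 6, 7]
def x₁₁ : List ℕ := [2, 0, 3, 1, 4, 2, 3, 6, 5, 2, 4, 7, 8, 3, 4, 2, 1, 7]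
def base : List ℕ := [0, 1, 2, 3, 4, 5, 7, 8]

def relsOk (T : ℕ → ℕ) (n : ℕ) : Bool :=
  band (allBelow (fun x => force (T x) fun r => rowOk T x r [0, 1, 2, 3, 4, 5, 6, 7, 8]
    fun _ _ _ => true) n)
    (band (relOk T n u₁ (pw u₁ 9).reverse 0)
      (band (relOk T n u₂ (pw u₂ 9).reverse 1) (relOk T n [2, 3, 4, 5, 7] r48.reverse 0)))

def stabOk (T : ℕ → ℕ) (n : ℕ) : Bool :=
  band (minsIn T n [0, 1, 2, 3, 4, 5, 6, 7, 8] [0])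
    (band (minsIn T n [0, 1, 2, 3, 4, 5, 7, 8] [0, 1, 36, 187, 569, 6667])
      (band (allOf (orbitGe T [0, 1, 2, 3, 4, 5, 7, 8] 1281) [36, 187, 569, 6667])
        (band (orbitGe T [0, 1, 2, 3, 4, 5, 7, 8] 3159 1)
          (band (orbitGe T [0, 1, 2, 3, 4, 7, 8] 288 2)
            (band (orbitGe T [0, 1, 2, 3, 7, 8] 35 3)
              (band (orbitGe T [0, 1, 2, 7, 8] 12 4)
                (band (orbitGe T [0, 1, 8] 3 5)
                  (band (orbitGe T [0, 8] 2 8) (orbitGe T [8] 2 7)))))))))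

def fixOk (T : ℕ → ℕ) : Bool :=
  band (fixesAll T [0, 1, 2, 3, 4, 5, 7, 8] [0])
    (band (fixesAll T [0, 1, 2, 3, 4, 7, 8] [1])
      (band (fixesAll T [0, 1, 2, 3, 7, 8] [2])
        (band (fixesAll T [0, 1, 2, 7, 8] [3])
          (band (fixesAll T [0, 1, 8] [4])
            (band (fixesAll T [0, 8] [5]) (fixesAll T [8] [8]))))))

def wordOk (T : ℕ → ℕ) : Bool :=
  band (trivOn T (pw x₁₁ 11) base)
    (band (ifz (trivOn T x₁₁ base) false true)
      (trivOn T (pw (x₁₁.reverse ++ 0 :: x₁₁ ++ [3]) 3).reverse base))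

def tableOk (T : ℕ → ℕ) (n : ℕ) : Bool :=
  band (Nat.beq n 14080) (band (fixOk T) (band (wordOk T) (band (stabOk T n) (relsOk T n))))

end

def e7 (u : List ℕ) : List ℕ := List.dropLast (u ++ u ++ u ++ u ++ u ++ u ++ u ++ u ++ u)
def hints14080 : List Hint :=
  [⟨90, 4, 1, e7 [5, 6, 7, 1, 2, 3, 4], []⟩, ⟨90, 6, 0, [4, 6, 4], [63]⟩, ⟨91, 6, 0, [6], [90]⟩,
    ⟨103, 4, 1, e7 [5, 6, 8, 7, 2, 3, 4], []⟩, ⟨103, 6, 0, [4, 6, 4], [73]⟩, ⟨104, 6, 0, [6],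
    [103]⟩, ⟨521, 2, 0, [7, 2, 7], [513]⟩, ⟨973, 2, 0, e7 [0, 3, 7, 5, 4, 1, 2], [759]⟩, ⟨973, 7, 0,
    [2, 7, 2], [931]⟩, ⟨975, 7, 0, [0, 7, 0], [931]⟩, ⟨977, 8, 0, [0, 8, 0], [938]⟩, ⟨983, 7, 0, [8,
    7, 8, 7, 8], [931]⟩, ⟨983, 1, 0, [7, 1, 7], [945]⟩, ⟨985, 8, 0, [2, 8, 2], [940]⟩, ⟨988, 8, 0,
    [0, 8, 0], [940]⟩, ⟨1072, 7, 0, [3, 7, 3, 7, 3], [931]⟩, ⟨1072, 1, 0, [3, 1, 3], [934]⟩, ⟨1077,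
    3, 0, [0, 3, 0], [926]⟩, ⟨1119, 1, 0, [2, 1, 2, 1, 2], [927]⟩, ⟨1119, 3, 0, [1, 3, 1], [923]⟩,
    ⟨1127, 4, 0, [0, 4, 0], [922]⟩, ⟨1138, 7, 0, [2, 7, 2], [1131]⟩, ⟨1178, 4, 0, [4], [1127]⟩,
    ⟨1183, 3, 0, [3], [1077]⟩, ⟨1557, 1, 0, [3, 1, 3], [1533]⟩, ⟨2265, 1, 0, [4, 1, 4], [2215]⟩,
    ⟨2563, 3, 0, e7 [4, 5, 7, 0, 1, 2, 3], []⟩, ⟨2566, 2, 0, [0, 2, 0], [2233]⟩, ⟨2566, 4, 0, [0, 4,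
    0], [2230]⟩, ⟨2570, 5, 0, [1, 5, 1], [2226]⟩, ⟨2727, 1, 0, [1], [2570]⟩, ⟨3202, 2, 0, [0, 2, 0],
    [2847]⟩, ⟨3202, 5, 0, [0, 5, 0], [3023]⟩, ⟨3760, 2, 0, [0, 2, 0], [3380]⟩, ⟨3858, 4, 0, [0, 4,
    0], [3393]⟩, ⟨3862, 5, 0, [1, 5, 1], [3587]⟩, ⟨3883, 2, 0, e7 [3, 5, 4, 7, 0, 1, 2], [3552,
    3734]⟩, ⟨3883, 7, 0, [2, 7, 2], [3168]⟩, ⟨3885, 3, 0, [4, 3, 4, 3, 4], [3249]⟩, ⟨3887, 7, 0,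
    [7], [3883]⟩, ⟨3890, 3, 0, [5, 3, 5], [3248]⟩, ⟨3891, 2, 0, [1, 2, 1, 2, 1], [3250]⟩, ⟨3891, 7,
    0, [2, 7, 2], [3272]⟩, ⟨3894, 1, 0, [3, 1, 3], [3252]⟩, ⟨4549, 3, 0, [5, 3, 5], [3996]⟩, ⟨4552,
    4, 0, [0, 4, 0], [4004]⟩, ⟨4696, 2, 0, [0, 2, 0], [4093]⟩, ⟨4696, 4, 0, [0, 4, 0], [4139]⟩,
    ⟨4729, 2, 0, [4, 2, 4], [3978]⟩, ⟨4729, 7, 0, [2, 7, 2], [3979]⟩, ⟨4732, 1, 0, [3, 1, 3],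
    [3981]⟩, ⟨5027, 1, 0, [0, 1, 0, 1, 0], [5020]⟩, ⟨5057, 0, 0, [7, 0, 7], [4985]⟩, ⟨5168, 5, 0,
    [4, 5, 4, 5, 4], [4599]⟩, ⟨5171, 7, 0, [5, 7, 5], [4731]⟩, ⟨5210, 4, 0, [2, 4, 2], [4600]⟩,
    ⟨5211, 3, 0, [4, 3, 4, 3, 4], [4558]⟩, ⟨5212, 7, 0, [3, 7, 3, 7, 3], [4559]⟩, ⟨5213, 8, 0, [7,
    8, 7, 8, 7], [4560]⟩, ⟨5214, 2, 0, [3, 2, 3, 2, 3], [4561]⟩, ⟨5380, 0, 0, [2, 0, 2], [5377]⟩,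
    ⟨5627, 2, 0, [7, 2, 7], [4712]⟩, ⟨5631, 7, 0, [0, 7, 0], [4712]⟩, ⟨5672, 4, 0, [2, 4, 2],
    [4802]⟩, ⟨5761, 3, 0, [5, 3, 5], [5654]⟩, ⟨5773, 3, 0, [0, 3, 0], [5654]⟩, ⟨5851, 3, 0, [5, 3,
    5], [5637]⟩, ⟨5866, 3, 0, [2, 3, 2, 3, 2], [5654]⟩, ⟨5878, 3, 0, [0, 3, 0], [5653]⟩, ⟨6127, 7,
    0, [3, 7, 3, 7, 3], [5268]⟩, ⟨6322, 4, 0, [2, 4, 2], [6042]⟩, ⟨6326, 5, 0, [1, 5, 1], [6045]⟩,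
    ⟨6340, 4, 0, [5, 4, 5, 4, 5], [6137]⟩, ⟨6341, 3, 0, [4, 3, 4, 3, 4], [6134]⟩, ⟨6491, 3, 0, [2,
    3, 2, 3, 2], [5977]⟩, ⟨6511, 7, 0, [2, 7, 2], [6186]⟩, ⟨6551, 7, 0, [2, 7, 2], [6150]⟩, ⟨6554,
    7, 0, [0, 7, 0], [6150]⟩, ⟨6582, 2, 0, [4, 2, 4], [6575]⟩, ⟨6646, 8, 0, [3, 8, 3], [5884]⟩,
    ⟨6649, 0, 0, [2, 0, 2], [5662]⟩, ⟨6653, 4, 0, [2, 4, 2], [5885]⟩, ⟨6657, 5, 0, [3, 5, 3],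
    [5882]⟩, ⟨6662, 6, 0, [3, 6, 3], [5972]⟩, ⟨6936, 5, 0, [1, 5, 1], [6803]⟩, ⟨6965, 1, 0, [2, 1,
    2, 1, 2], [6936]⟩, ⟨7156, 0, 0, [1, 0, 1, 0, 1], [6532]⟩, ⟨7219, 2, 0, [7, 2, 7], [7162]⟩,
    ⟨7223, 7, 0, [0, 7, 0], [7162]⟩, ⟨7246, 2, 0, [0, 2, 0], [7034]⟩, ⟨7271, 4, 0, [2, 4, 2],
    [7022]⟩, ⟨7286, 4, 0, [2, 4, 2], [7011]⟩, ⟨7372, 2, 0, [4, 2, 4], [7358]⟩, ⟨7539, 7, 0, [0, 7,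
    0], [6621]⟩, ⟨7627, 2, 1, e7 [5, 4, 3, 6, 7, 1, 2], [6753]⟩, ⟨7627, 4, 0, [2, 4, 2], [6656]⟩,
    ⟨7628, 4, 0, [4], [7627]⟩, ⟨7770, 3, 0, e7 [4, 5, 7, 0, 1, 2, 3], []⟩, ⟨7941, 2, 0, [1, 2, 1, 2,
    1], [7932]⟩, ⟨8182, 2, 0, [4, 2, 4], [7925]⟩, ⟨8225, 7, 0, [2, 7, 2], [7506]⟩, ⟨8473, 2, 0, [4,
    2, 4], [7693]⟩, ⟨8509, 4, 0, [0, 4, 0], [7672]⟩, ⟨8516, 2, 0, [3, 2, 3, 2, 3], [7640]⟩, ⟨8516,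
    7, 0, [2, 7, 2], [7638]⟩, ⟨8517, 7, 0, [7], [8516]⟩, ⟨9015, 1, 0, [5, 1, 5], [8736]⟩, ⟨10741, 4,
    0, [8, 4, 8], [10635]⟩, ⟨11119, 8, 0, [3, 8, 3], [11094]⟩]
def hints364 : List Hint :=
  [⟨54, 7, 0, e7 [3, 4, 5, 0, 1, 2, 7], []⟩, ⟨54, 2, 0, [7, 2, 7], [44]⟩, ⟨57, 4, 0, e7 [3, 7, 8, 0,
    1, 2, 4], []⟩, ⟨57, 2, 0, [4, 2, 4], [47]⟩, ⟨58, 2, 0, [2], [54]⟩, ⟨63, 2, 0, [2], [57]⟩, ⟨293,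
    7, 0, [4, 7, 4], [281]⟩]
def hints243 : List Hint :=
  [⟨104, 5, 0, [2, 3, 7, 4, 3, 8, 2, 1, 7, 3, 2, 4, 5, 3, 7, 8, 4, 3, 2, 7, 1, 3, 4, 2, 3, 7, 8, 5,
    4, 3, 2, 7, 3, 1, 4, 2, 5, 3, 4, 7, 8, 3, 7, 2, 3, 4, 1], []⟩, ⟨104, 1, 0, [5, 1, 5], [92]⟩,
    ⟨105, 4, 0, [2, 4, 2], [93]⟩, ⟨113, 1, 0, [1], [104]⟩, ⟨127, 5, 0, [2, 3, 7, 4, 3, 8, 2, 1, 7,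
    3, 2, 4, 5, 3, 7, 8, 4, 3, 2, 7, 1, 3, 4, 2, 3, 7, 8, 5, 4, 3, 2, 7, 3, 1, 4, 2, 5, 3, 4, 7, 8,
    3, 7, 2, 3, 4, 1], []⟩, ⟨127, 1, 0, [5, 1, 5], [120]⟩, ⟨170, 4, 0, [2, 4, 2], [162]⟩, ⟨230, 2,
    0, [4, 2, 4], [225]⟩]

theorem build_tableOk : build [0, 2, 3, 5, 7, 1, 4, 8, 6] [6] hints14080 14 tableOk = true := by
  decide +kernel

/-! ### Meaning of the checks -/

lemma band_iff {a b : Bool} : band a b = true ↔ a = true ∧ b = true := by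
  cases a <;> simp [band, ifz_eq]

lemma allBelow_iff {f : ℕ → Bool} {n : ℕ} : allBelow f n = true ↔ ∀ x < n, f x = true := by
  induction n with
  | zero => simp [allBelow]
  | succ n ih =>
    rw [show allBelow f (n + 1) = band (f n) (allBelow f n) from rfl, band_iff, ih]
    constructor
    · rintro ⟨h, h'⟩ x hx
      rcases Nat.lt_succ_iff_lt_or_eq.1 hx with hx | rfl
      exacts [h' x hx, h]
    · exact fun h => ⟨h n (by omega), fun x hx => h x (by omega)⟩

lemma allOf_iff {α : Type} {f : α → Bool} {l : List α} :
    allOf f l = true ↔ ∀ x ∈ l, f x = true := by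
  induction l with
  | nil => simp [allOf]
  | cons a l ih =>
    rw [show allOf f (a :: l) = band (f a) (allOf f l) from rfl, band_iff, ih]
    simp

lemma pt_codeAct (T : ℕ → ℕ) (s c : ℕ) : pt (codeAct T s c) = nbr T s (pt c) := pt_stepCode _ _ _

lemma xor_one_mod (c : ℕ) : (c ^^^ 1) % 2 = c % 2 ^^^ 1 := by
  have := Nat.xor_mod_two_pow (a := c) (b := 1) (n := 1)
  simpa using this

lemma codeAct_xor (T : ℕ → ℕ) (s c : ℕ) : codeAct T s (c ^^^ 1) = codeAct T s c ^^^ 1 := by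
  have : pt (c ^^^ 1) = pt c := pt_xor c 1 (by decide)
  rw [codeAct, codeAct, this, stepCode, stepCode, nat_xor, nat_xor, nat_mod, nat_mod, xor_one_mod,
    Nat.xor_assoc]

lemma codeAct_two_mul (T : ℕ → ℕ) (s x : ℕ) : codeAct T s (2 * x) = fld (T x) s := by
  have : pt (2 * x) = x := pt_two_mul x
  rw [codeAct, this, stepCode, nat_mod, Nat.mul_mod_right]
  exact Nat.xor_zero _

lemma code_cases (c : ℕ) : c = 2 * pt c ∨ c = (2 * pt c) ^^^ 1 := by
  have : pt c = c / 2 := rfl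
  have h : (2 * pt c) ^^^ 1 = 2 * pt c + 1 := by
    have h1 : (2 * pt c ^^^ 1) / 2 = pt c :=
      (pt_xor (2 * pt c) 1 (by decide)).trans (pt_two_mul (pt c))
    have h2 := xor_one_mod (2 * pt c)
    rw [Nat.mul_mod_right, Nat.zero_xor] at h2
    omega
  omega

lemma isMin_iff {T : ℕ → ℕ} {L : List ℕ} {x : ℕ} :
    isMin T L x = true ↔ ∀ s ∈ L, x ≤ nbr T s x := by
  rw [isMin, force_eq, allOf_iff]
  simp [nbr]

lemma follow_eq (T : ℕ → ℕ) (w : List ℕ) : ∀ (c : ℕ) (k : ℕ → Bool),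
    follow T w c k = k (w.foldl (fun c s => codeAct T s c) c) := by
  induction w with
  | nil => intro c k; rfl
  | cons s w ih =>
    intro c k
    show force (codeAct T s c) (fun c' => follow T w c' k) = _
    rw [force_eq, ih]
    rfl

/-- The two ways around the relation between `s` and `t`, starting at `c`, agree. -/
def Agree (T : ℕ → ℕ) (s t c : ℕ) : Prop :=
  if adjc s t then codeAct T s (codeAct T t (codeAct T s c)) =
    codeAct T t (codeAct T s (codeAct T t c))
  else codeAct T t (codeAct T s c) = codeAct T s (codeAct T t c)

lemma pairOk_iff {T : ℕ → ℕ} {s t x : ℕ} :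
    pairOk T s (fld (T x) s) (T (nbr T s x)) t (fld (T x) t) (T (nbr T t x)) = true ↔
      Agree T s t (2 * x) := by
  rw [pairOk, force_eq, force_eq, ifz_eq, beq_eq_decide, beq_eq_decide, Agree]
  have h (s t : ℕ) : stepCode (T (nbr T s x)) (fld (T x) s) t =
      codeAct T t (codeAct T s (2 * x)) := by
    rw [codeAct_two_mul]; rfl
  rw [h, h]
  split_ifs <;> simp

lemma rowOk_sound {T : ℕ → ℕ} {x : ℕ} (L : List ℕ) : ∀ chk : ℕ → ℕ → ℕ → Bool,
    rowOk T x (T x) L chk = true →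
    (∀ s ∈ L, codeAct T s (codeAct T s (2 * x)) = 2 * x) ∧
    (∀ s ∈ L, x ≤ nbr T s x → chk s (fld (T x) s) (T (nbr T s x)) = true) ∧
    L.Pairwise fun s t => x ≤ nbr T s x → x ≤ nbr T t x → Agree T s t (2 * x) := by
  induction L with
  | nil => intro chk _; simp
  | cons s L ih =>
    intro chk h
    replace h : (force (fld (T x) s) fun c => force (T (pt c)) fun R =>
      band (Nat.beq (stepCode R c s) (Nat.mul 2 x))
        (ifz (Nat.ble x (pt c))
          (band (chk s c R) (rowOk T x (T x) L fun t c' R' =>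
            band (pairOk T s c R t c' R') (chk t c' R')))
          (rowOk T x (T x) L chk))) = true := h
    rw [force_eq, force_eq, band_iff, beq_eq_decide, ifz_eq, ble_eq_decide] at h
    obtain ⟨h0, h⟩ := h
    have h0' : codeAct T s (codeAct T s (2 * x)) = 2 * x := by
      rw [codeAct_two_mul]; exact of_decide_eq_true h0
    by_cases hx : x ≤ nbr T s x
    · have : x ≤ pt (fld (T x) s) := hx
      simp only [this, decide_true, if_true, band_iff] at h
      obtain ⟨hc, h⟩ := h
      obtain ⟨h1, h2, h3⟩ := ih _ h
      simp only [band_iff] at h2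
      refine ⟨?_, ?_, ?_⟩
      · simpa using ⟨h0', h1⟩
      · intro t ht hxt
        rcases List.mem_cons.1 ht with rfl | ht
        exacts [hc, (h2 t ht hxt).2]
      · rw [List.pairwise_cons]
        exact ⟨fun t ht _ hxt => pairOk_iff.1 (h2 t ht hxt).1, h3⟩
    · have : ¬ x ≤ pt (fld (T x) s) := hx
      simp only [this, decide_false, Bool.false_eq_true, if_false] at h
      obtain ⟨h1, h2, h3⟩ := ih _ h
      refine ⟨?_, ?_, ?_⟩
      · simpa using ⟨h0', h1⟩
      · intro t ht hxt
        rcases List.mem_cons.1 ht with rfl | ht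
        exacts [absurd hxt hx, h2 t ht hxt]
      · rw [List.pairwise_cons]
        exact ⟨fun t ht hxs => absurd hxs hx, h3⟩

/-- `b` is reached from `a` by generators in `L`. -/
def Reach (T : ℕ → ℕ) (L : List ℕ) : ℕ → ℕ → Prop :=
  Relation.ReflTransGen fun a b => ∃ s ∈ L, b = nbr T s a

lemma bit_iff {m y : ℕ} : bit m y = m.testBit y := by
  rw [bit, beq_eq_decide, Nat.testBit_eq_decide_div_mod_eq, nat_mod, nat_shiftRight,
    Nat.shiftRight_eq_div_pow]

lemma testBit_one_sub (u y : ℕ) : (decide (u ≥ y) && Nat.testBit 1 (u - y)) = decide (u = y) := by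
  have : Nat.testBit 1 (u - y) = decide (0 = u - y) := Nat.testBit_two_pow (n := 0)
  rw [this, ← Bool.decide_and]
  exact decide_eq_decide.2 (by omega)

lemma visit_sound {T : ℕ → ℕ} {L₀ : List ℕ} {y₀ x : ℕ} (hx : Reach T L₀ y₀ x) (L : List ℕ) :
    ∀ (m c : ℕ) (q : List ℕ) (k : ℕ → ℕ → List ℕ → Bool) (F : Finset ℕ), (∀ s ∈ L, s ∈ L₀) →
      (∀ y, m.testBit y = true ↔ y ∈ F) → F.card = c → (∀ y ∈ F, Reach T L₀ y₀ y) →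
      (∀ y ∈ q, Reach T L₀ y₀ y) → visit (T x) L m c q k = true →
      ∃ (m' c' : ℕ) (q' : List ℕ) (F' : Finset ℕ), k m' c' q' = true ∧ (∀ y,
          m'.testBit y = true ↔ y ∈ F') ∧
        F'.card = c' ∧ (∀ y ∈ F', Reach T L₀ y₀ y) ∧ ∀ y ∈ q', Reach T L₀ y₀ y := by
  induction L with
  | nil => intro m c q k F _ h1 h2 h3 h4 h; exact ⟨m, c, q, F, h, h1, h2, h3, h4⟩
  | cons s L ih =>
    intro m c q k F hL h1 h2 h3 h4 h
    have hL' : ∀ s ∈ L, s ∈ L₀ := fun t ht => hL t (by simp [ht])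
    replace h : (force (pt (fld (T x) s)) fun y => ifz (bit m y) (visit (T x) L m c q k)
      (force (Nat.lor m (Nat.shiftLeft 1 y)) fun m' => force (Nat.succ c) fun c' =>
        visit (T x) L m' c' (y :: q) k)) = true := h
    rw [force_eq, ifz_eq, force_eq, force_eq, bit_iff] at h
    have hy : Reach T L₀ y₀ (pt (fld (T x) s)) := hx.tail ⟨s, hL s (by simp), rfl⟩
    generalize pt (fld (T x) s) = y at h hy
    by_cases hb : m.testBit y = true
    · rw [if_pos hb] at h
      exact ih _ _ _ _ F hL' h1 h2 h3 h4 h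
    · rw [if_neg hb] at h
      have hyF : y ∉ F := fun h => hb ((h1 y).2 h)
      refine ih _ _ _ _ (insert y F) hL' ?_ ?_ ?_ ?_ h
      · intro u
        rw [nat_lor, nat_shiftLeft, Nat.testBit_or, Bool.or_eq_true, h1, Finset.mem_insert,
          Nat.testBit_shiftLeft, testBit_one_sub, decide_eq_true_iff, or_comm]
      · rw [Finset.card_insert_of_notMem hyF, h2]
      · intro u hu
        rcases Finset.mem_insert.1 hu with rfl | hu
        exacts [hy, h3 u hu]
      · intro u hu
        rcases List.mem_cons.1 hu with rfl | hu
        exacts [hy, h4 u hu]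

lemma search_sound {T : ℕ → ℕ} {L : List ℕ} {v y₀ : ℕ} (fuel : ℕ) :
    ∀ (m c : ℕ) (q : List ℕ) (F : Finset ℕ), (∀ y, m.testBit y = true ↔ y ∈ F) → F.card = c →
      (∀ y ∈ F, Reach T L y₀ y) → (∀ y ∈ q, Reach T L y₀ y) → search T L v fuel m c q = true →
      ∃ F : Finset ℕ, v ≤ F.card ∧ ∀ y ∈ F, Reach T L y₀ y := by
  induction fuel with
  | zero => intro m c q F _ _ _ _ h; exact absurd h (by simp [search])
  | succ fuel ih =>
    intro m c q F h1 h2 h3 h4 h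
    replace h : ifz (Nat.ble v c) true (List.rec false (fun x q' _ => force (T x) fun r =>
      visit r L m c q' (search T L v fuel)) q) = true := h
    rw [ifz_eq, ble_eq_decide] at h
    by_cases hv : v ≤ c
    · exact ⟨F, h2 ▸ hv, h3⟩
    · simp only [hv, decide_false, Bool.false_eq_true, if_false] at h
      cases q with
      | nil => exact absurd h (by simp)
      | cons x q =>
        replace h : (force (T x) fun r => visit r L m c q (search T L v fuel)) = true := h
        rw [force_eq] at h
        obtain ⟨m', c', q', F', h, h1, h2, h3, h4⟩ := visit_sound (h4 x (by simp)) L _ _ _ _ F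
          (fun _ h => h) h1 h2 h3 (fun y hy => h4 y (by simp [hy])) h
        exact ih _ _ _ _ h1 h2 h3 h4 h

lemma orbitGe_sound {T : ℕ → ℕ} {L : List ℕ} {v y : ℕ} (h : orbitGe T L v y = true) :
    ∃ F : Finset ℕ, v ≤ F.card ∧ ∀ u ∈ F, Reach T L y u := by
  rw [orbitGe, force_eq] at h
  refine search_sound _ _ _ _ {y} ?_ rfl ?_ ?_ h
  · intro u
    rw [nat_shiftLeft, Nat.testBit_shiftLeft, testBit_one_sub, decide_eq_true_iff,
      Finset.mem_singleton]
  all_goals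
    intro u hu
    simp only [Finset.mem_singleton, List.mem_singleton] at hu
    exact hu ▸ Relation.ReflTransGen.refl

lemma memb_eq {s : ℕ} {L : List ℕ} : memb s L = true ↔ s ∈ L := memb_iff

open Equiv

/-! ### Permutations from a checked table -/

section Table

variable {T : ℕ → ℕ} {n : ℕ}

lemma descend {L : List ℕ} {Q : ℕ → Prop} (hz : ∀ c, Q c → Q (c ^^^ 1))
    (hs : ∀ s ∈ L, ∀ c, pt c < n → Q (codeAct T s c) → Q c)
    (hm : ∀ x < n, isMin T L x = true → Q (2 * x)) (c : ℕ) (hc : pt c < n) : Q c := by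
  induction h : pt c using Nat.strong_induction_on generalizing c with
  | _ x ih =>
    subst h
    by_cases h : isMin T L (pt c) = true
    · rcases code_cases c with e | e
      · rw [e]; exact hm _ hc h
      · rw [e]; exact hz _ (hm _ hc h)
    · rw [isMin_iff] at h
      push Not at h
      obtain ⟨s, hsL, h⟩ := h
      rw [← pt_codeAct] at h
      exact hs s hsL c hc (ih _ h _ (by omega) rfl)

lemma Agree.xor {s t c : ℕ} (h : Agree T s t c) : Agree T s t (c ^^^ 1) := by
  unfold Agree at h ⊢
  split_ifs at h ⊢ <;> simp only [codeAct_xor, h]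

lemma adjc_comm {s t : ℕ} (hs : s < 9) (ht : t < 9) : adjc s t = adjc t s := by
  have : ∀ s < 9, ∀ t < 9, adjc s t = adjc t s := by decide +kernel
  exact this s hs t ht

lemma Agree.symm {s t c : ℕ} (hs : s < 9) (ht : t < 9) (h : Agree T s t c) : Agree T t s c := by
  unfold Agree at h ⊢
  rw [adjc_comm ht hs]
  split_ifs at h ⊢ <;> exact h.symm

structure TableOk (T : ℕ → ℕ) (n : ℕ) : Prop where
  range : ∀ x < n, ∀ s < 9, nbr T s x < n
  rels : relsOk T n = true

namespace TableOk

variable (h : TableOk T n)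
include h

lemma row {x : ℕ} (hx : x < n) : rowOk T x (T x) [0, 1, 2, 3, 4, 5, 6, 7, 8]
    (fun _ _ _ => true) = true := by
  have := h.rels
  rw [relsOk, band_iff, allBelow_iff] at this
  have := this.1 x hx
  rwa [force_eq] at this

lemma codeAct_lt {s c : ℕ} (hs : s < 9) (hc : pt c < n) : pt (codeAct T s c) < n := by
  rw [pt_codeAct]; exact h.range _ hc _ hs

lemma invol {s c : ℕ} (hs : s < 9) (hc : pt c < n) : codeAct T s (codeAct T s c) = c := by
  have := (rowOk_sound _ _ (h.row hc)).1 s (by interval_cases s <;> simp)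
  rcases code_cases c with e | e <;> rw [e]
  · exact this
  · rw [codeAct_xor, codeAct_xor, this]

lemma agree_min {s t x : ℕ} (hs : s < 9) (ht : t < 9) (hst : s ≠ t) (hx : x < n)
    (hm : isMin T [s, t] x = true) : Agree T s t (2 * x) := by
  have key := (rowOk_sound _ _ (h.row hx)).2.2
  have : ∀ s' ∈ [0, 1, 2, 3, 4, 5, 6, 7, 8], ∀ t' ∈ [0, 1, 2, 3, 4, 5, 6, 7, 8], s' ≠ t' →
      x ≤ nbr T s' x → x ≤ nbr T t' x → (s' < 9 → t' < 9 → Agree T s' t' (2 * x)) := by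
    intro s' hs' t' ht' hne
    let R (s t : ℕ) : Prop := x ≤ nbr T s x → x ≤ nbr T t x → s < 9 → t < 9 → Agree T s t (2 * x)
    have : Std.Symm R := ⟨fun s t h h1 h2 hs ht => (h h2 h1 ht hs).symm ht hs⟩
    exact List.Pairwise.forall (R := R) (key.imp fun hab h1 h2 _ _ => hab h1 h2) hs' ht' hne
  rw [isMin_iff] at hm
  exact this s (by interval_cases s <;> simp) t (by interval_cases t <;> simp) hst
    (hm s (by simp)) (hm t (by simp)) hs ht

lemma agree {s t c : ℕ} (hs : s < 9) (ht : t < 9) (hst : s ≠ t) (hc : pt c < n) :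
    Agree T s t c := by
  refine descend (L := [s, t]) (Q := Agree T s t)
    (fun _ => Agree.xor) ?_ (fun x hx hm => h.agree_min hs ht hst hx hm) c hc
  have key {s t c : ℕ} (hs : s < 9) (ht : t < 9) (hc : pt c < n)
      (ha : Agree T s t (codeAct T s c)) : Agree T s t c := by
    unfold Agree at ha ⊢
    rw [h.invol hs hc] at ha
    have htc := h.codeAct_lt ht hc
    have hstc := h.codeAct_lt hs htc
    split_ifs at ha ⊢
    · rw [ha, h.invol ht (h.codeAct_lt hs (h.codeAct_lt ht (h.codeAct_lt hs hc)))]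
    · rw [ha, h.invol hs (h.codeAct_lt ht (h.codeAct_lt hs hc))]
  intro u hu c hc ha
  simp only [List.mem_cons, List.not_mem_nil, or_false] at hu
  rcases hu with rfl | rfl
  · exact key hs ht hc ha
  · exact (key ht hs hc (ha.symm hs ht)).symm ht hs

/-- The permutation of the signed points given by a generator. -/
def perm (s : ℕ) : Perm {c // pt c < n} :=
  if hs : s < 9 then
    { toFun := fun c => ⟨codeAct T s c, h.codeAct_lt hs c.2⟩
      invFun := fun c => ⟨codeAct T s c, h.codeAct_lt hs c.2⟩
      left_inv := fun c => Subtype.ext (h.invol hs c.2)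
      right_inv := fun c => Subtype.ext (h.invol hs c.2) }
  else 1

lemma perm_apply {s : ℕ} (hs : s < 9) (c : {c // pt c < n}) : (h.perm s c : ℕ) = codeAct T s c := by
  simp [perm, hs]

lemma isCox_perm : IsCox h.perm where
  invol s hs := by
    ext c
    simp only [Perm.mul_apply, h.perm_apply hs, h.invol hs c.2, Perm.one_apply]
  comm s hs t ht a := by
    by_cases e : s = t
    · rw [e]
    ext c
    have := h.agree hs ht e c.2
    simp only [Agree, a, Bool.false_eq_true, if_false] at this
    simp only [Perm.mul_apply, h.perm_apply hs, h.perm_apply ht, this]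
  braid s hs t ht a := by
    by_cases e : s = t
    · rw [e]
    ext c
    have := h.agree hs ht e c.2
    simp only [Agree, a, if_true] at this
    simp only [Perm.mul_apply, h.perm_apply hs, h.perm_apply ht, this]

lemma wd_perm_apply (w : List ℕ) : (∀ s ∈ w, s < 9) → ∀ c : {c // pt c < n},
    (wd h.perm w c : ℕ) = w.reverse.foldl (fun c s => codeAct T s c) c := by
  induction w with
  | nil => intro _ c; rfl
  | cons s w ih =>
    intro hw c
    have hs : s < 9 := hw s (by simp)
    rw [wd_cons, Perm.mul_apply, h.perm_apply hs, ih fun t ht => hw t (by simp [ht])]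
    simp

omit h in
/-- The permutation changing the sign of each signed point. -/
def flip : Perm {c // pt c < n} :=
  have hi (c : ℕ) : (c ^^^ 1) ^^^ 1 = c := by rw [Nat.xor_assoc, Nat.xor_self, Nat.xor_zero]
  have hp (c : {c // pt c < n}) : pt (c ^^^ 1) < n := by
    rw [show pt (c ^^^ 1) = pt c from pt_xor c 1 (by decide)]; exact c.2
  { toFun := fun c => ⟨c ^^^ 1, hp c⟩
    invFun := fun c => ⟨c ^^^ 1, hp c⟩
    left_inv := fun c => Subtype.ext (hi c)
    right_inv := fun c => Subtype.ext (hi c) }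

omit h in
lemma flip_apply (c : {c // pt c < n}) : (flip c : ℕ) = c ^^^ 1 := rfl

omit h in
lemma flip_mul_flip : flip * flip = (1 : Perm {c // pt c < n}) := by
  ext c
  simp [flip_apply, Perm.mul_apply]

lemma flip_perm {s : ℕ} (hs : s < 9) : flip * h.perm s = h.perm s * flip := by
  ext c
  simp only [Perm.mul_apply, flip_apply, h.perm_apply hs, codeAct_xor]

lemma wd_perm {w L : List ℕ} {e : ℕ} (hr : relOk T n L w.reverse e = true)
    (hw : ∀ s ∈ w, s < 9) (hL : ∀ s ∈ L, s < 9)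
    (hc : ∀ s ∈ L, reduces (w ++ s :: w.reverse ++ [s]) [] = true) :
    (e = 0 → wd h.perm w = 1) ∧ (e = 1 → wd h.perm w = flip) := by
  have hcomm (s : ℕ) (hs : s ∈ L) : wd h.perm w * h.perm s = h.perm s * wd h.perm w := by
    have := wd_eq_one h.isCox_perm (hc s hs)
    rw [wd_append, wd_append, wd_cons, wd_cons, wd_nil, mul_one, wd_reverse h.isCox_perm hw,
      mul_eq_one_iff_eq_inv, inv_eq_of_mul_eq_one_left (h.isCox_perm.invol s (hL s hs))] at this
    rwa [← mul_assoc, mul_inv_eq_iff_eq_mul] at this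
  have key (he : e < 2) (c : ℕ) (hc : pt c < n) :
      w.reverse.foldl (fun c s => codeAct T s c) c = c ^^^ e := by
    have hx (w : List ℕ) (c : ℕ) : w.foldl (fun c s => codeAct T s c) (c ^^^ 1) =
        w.foldl (fun c s => codeAct T s c) c ^^^ 1 := by
      induction w generalizing c with
      | nil => rfl
      | cons s w ih => rw [List.foldl_cons, List.foldl_cons, codeAct_xor, ih]
    refine descend (T := T) (L := L)
      (Q := fun c => w.reverse.foldl (fun c s => codeAct T s c) c = c ^^^ e) ?_ ?_ ?_ c hc
    · intro c hc
      simp only [hx, hc, Nat.xor_assoc, Nat.xor_comm e 1]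
    · intro s hs c hc hq
      have h1 := congrArg (fun f => ((f ⟨c, hc⟩ : {c // pt c < n}) : ℕ)) (hcomm s hs)
      simp only [Perm.mul_apply, h.wd_perm_apply w hw, h.perm_apply (hL s hs)] at h1
      rw [hq] at h1
      have h2 := congrArg (codeAct T s) h1
      have h3 := h.codeAct_lt (hL s hs) hc
      rw [← h.wd_perm_apply w hw ⟨c, hc⟩, h.invol (hL s hs) (wd h.perm w ⟨c, hc⟩).2] at h2
      rw [← h.wd_perm_apply w hw ⟨c, hc⟩, ← h2]
      interval_cases e
      · simp only [Nat.xor_zero, h.invol (hL s hs) hc]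
      · rw [codeAct_xor, h.invol (hL s hs) hc]
    · intro x hxn hm
      rw [relOk, allBelow_iff] at hr
      have := hr x hxn
      rw [ifz_eq, if_pos hm, follow_eq, beq_eq_decide, decide_eq_true_iff] at this
      rw [nat_mul, nat_add] at this
      rw [this]
      interval_cases e
      · exact (Nat.xor_zero _).symm
      · rcases code_cases (2 * x + 1) with h | h <;>
        · have : pt (2 * x + 1) = x := by rw [pt, nat_div]; omega
          rw [this] at h
          omega
  constructor <;> rintro rfl <;> ext c <;> rw [h.wd_perm_apply w hw, key (by omega) c c.2]
  · exact Nat.xor_zero _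
  · rfl

lemma wd_perm_u₁ : wd h.perm (pw u₁ 9) = 1 := by
  have := h.rels
  simp only [relsOk, band_iff] at this
  exact (h.wd_perm this.2.1 (by decide) (by decide) (by decide +kernel)).1 rfl

lemma wd_perm_u₂ : wd h.perm (pw u₂ 9) = flip := by
  have := h.rels
  simp only [relsOk, band_iff] at this
  exact (h.wd_perm this.2.2.1 (by decide) (by decide) (by decide +kernel)).2 rfl

lemma wd_perm_r48 : wd h.perm r48 = 1 := by
  have := h.rels
  simp only [relsOk, band_iff] at this
  exact (h.wd_perm this.2.2.2 (by decide) (by decide) (by decide +kernel)).1 rfl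

end TableOk

end Table

open Equiv

/-! ### Words and relations in groups -/

section Words

variable {G K : Type*} [Group G] [Group K]

lemma wd_map (f : G →* K) (p : ℕ → G) (w : List ℕ) : f (wd p w) = wd (fun s => f (p s)) w := by
  induction w with
  | nil => simp [wd]
  | cons s w ih => rw [wd_cons, wd_cons, map_mul, ih]

lemma wd_pw (p : ℕ → G) (u : List ℕ) (k : ℕ) : wd p (pw u k) = wd p u ^ k := by
  induction k with
  | zero => simp [pw, wd]
  | succ k ih =>
    rw [show pw u (k + 1) = u ++ pw u k from rfl, wd_append, ih, pow_succ']

lemma wd_comp (p : ℕ → G) (e : ℕ → ℕ) (w : List ℕ) : wd (fun s => p (e s)) w = wd p (w.map e) := by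
  simp [wd, Function.comp_def]

lemma wd_mul_pow {p : ℕ → G} {Z : G} (hZ : ∀ s < 9, Z * p s = p s * Z) (e : ℕ → ℕ) (w : List ℕ) :
    (∀ s ∈ w, s < 9) → wd (fun s => p s * Z ^ e s) w = wd p w * Z ^ (w.map e).sum := by
  induction w with
  | nil => intro _; simp [wd]
  | cons s w ih =>
    intro hw
    have hw' : ∀ t ∈ w, t < 9 := fun t ht => hw t (by simp [ht])
    have hc : Commute Z (wd p w) := by
      rw [wd]
      refine Commute.list_prod_right _ _ fun x hx => ?_
      obtain ⟨t, ht, rfl⟩ := List.mem_map.1 hx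
      exact hZ t (hw' t ht)
    rw [wd_cons, wd_cons, ih hw', List.map_cons, List.sum_cons, pow_add, mul_assoc, mul_assoc,
      ← mul_assoc (Z ^ _), (hc.pow_left (e s)).eq]
    simp only [mul_assoc]

lemma pow_eq_of_mod {Z : G} (h : Z * Z = 1) {m k : ℕ} (e : m % 2 = k % 2) : Z ^ m = Z ^ k := by
  have (m : ℕ) : Z ^ m = Z ^ (m % 2) := by
    conv_lhs => rw [← Nat.div_add_mod m 2, pow_add, pow_mul, pow_two, h, one_pow, one_mul]
  rw [this m, this k, e]

/-- Two words with `reduces (v ++ w.reverse) []` represent the same element. -/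
lemma wd_eq_wd {p : ℕ → G} (hp : IsCox p) {v w : List ℕ} (hw : ∀ s ∈ w, s < 9)
    (h : reduces (v ++ w.reverse) [] = true) : wd p v = wd p w := by
  have := wd_eq_one hp h
  rwa [wd_append, wd_reverse hp hw, mul_inv_eq_one] at this

lemma IsCox.map {p : ℕ → G} (hp : IsCox p) (f : G →* K) : IsCox fun s => f (p s) where
  invol s hs := by rw [← map_mul, hp.invol s hs, map_one]
  comm s hs t ht h := by rw [← map_mul, hp.comm s hs t ht h, map_mul]
  braid s hs t ht h := by simp only [← map_mul, hp.braid s hs t ht h]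

lemma IsCox.mul_central {p : ℕ → G} (hp : IsCox p) {Z : G} (hZ : ∀ s < 9, Z * p s = p s * Z)
    (hZZ : Z * Z = 1) : IsCox fun s => p s * Z := by
  have key (v w : List ℕ) (hv : ∀ s ∈ v, s < 9) (hw : ∀ s ∈ w, s < 9) (h : wd p v = wd p w)
      (hl : v.length % 2 = w.length % 2) :
      wd (fun s => p s * Z) v = wd (fun s => p s * Z) w := by
    have h1 := wd_mul_pow hZ (fun _ => 1) v hv
    have h2 := wd_mul_pow hZ (fun _ => 1) w hw
    simp only [pow_one, List.map_const', List.sum_replicate, smul_eq_mul, mul_one] at h1 h2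
    rw [h1, h2, h, pow_eq_of_mod hZZ hl]
  constructor
  · intro s hs
    have := key [s, s] [] (by simp [hs]) (by simp) (by simp [wd, hp.invol s hs]) (by simp)
    simpa [wd] using this
  · intro s hs t ht h
    have := key [s, t] [t, s] (by simp [hs, ht]) (by simp [hs, ht])
      (by simp [wd, hp.comm s hs t ht h]) rfl
    simpa [wd] using this
  · intro s hs t ht h
    have := key [s, t, s] [t, s, t] (by simp [hs, ht]) (by simp [hs, ht])
      (by simpa [wd, mul_assoc] using hp.braid s hs t ht h) rfl
    simpa [wd, mul_assoc] using this

lemma IsCox.prod {p : ℕ → G} {q : ℕ → K} (hp : IsCox p) (hq : IsCox q) :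
    IsCox fun s => (p s, q s) where
  invol s hs := Prod.ext (hp.invol s hs) (hq.invol s hs)
  comm s hs t ht h := Prod.ext (hp.comm s hs t ht h) (hq.comm s hs t ht h)
  braid s hs t ht h := Prod.ext (hp.braid s hs t ht h) (hq.braid s hs t ht h)

/-- The diagram automorphism. -/
def sig (s : ℕ) : ℕ := if s < 7 then 6 - s else s

lemma sig_lt {s : ℕ} (hs : s < 9) : sig s < 9 := by unfold sig; split_ifs <;> omega

lemma sig_sig {s : ℕ} : sig (sig s) = s := by unfold sig; split_ifs <;> omega

lemma IsCox.comp_sig {p : ℕ → G} (hp : IsCox p) : IsCox fun s => p (sig s) := by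
  have h : ∀ s < 9, ∀ t < 9, adjc (sig s) (sig t) = adjc s t := by decide +kernel
  exact
    { invol := fun s hs => hp.invol _ (sig_lt hs)
      comm := fun s hs t ht a => hp.comm _ (sig_lt hs) _ (sig_lt ht) (by rwa [h s hs t ht])
      braid := fun s hs t ht a => hp.braid _ (sig_lt hs) _ (sig_lt ht) (by rwa [h s hs t ht]) }

def spider : List ℕ := [3, 2, 1, 3, 4, 5, 3, 7, 8]

lemma wd_spider {p : ℕ → G} (hp : IsCox p) (h : wd p r48 = 1) : wd p spider ^ 10 = 1 := by
  rw [← wd_pw, wd_eq_wd hp (w := [1] ++ r48 ++ [1] ++ [7, 5, 4, 3, 2, 1] ++ r48 ++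
    [1, 2, 3, 4, 5, 7]) (by decide) (by decide +kernel)]
  simp only [wd_append, h, mul_one]
  rw [← wd_append, ← wd_append, ← wd_append]
  exact wd_eq_one hp (by decide +kernel)

lemma wd_r48 {p : ℕ → G} (hp : IsCox p) (h : wd p spider ^ 10 = 1) : wd p r48 = 1 := by
  rw [← wd_pw] at h
  rw [wd_eq_wd hp (w := pw spider 10 ++ [7, 8, 5, 2, 3, 1] ++ pw spider 10 ++ [1, 3, 2, 5, 8, 7])
    (by decide +kernel) (by decide +kernel)]
  simp only [wd_append, h, mul_one, one_mul]
  rw [← wd_append]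
  exact wd_eq_one hp (by decide +kernel)

lemma wd_sig_r48 {p : ℕ → G} (hp : IsCox p) (h : wd p r48 = 1) : wd p (r48.map sig) = 1 := by
  rw [wd_eq_wd hp (w := [8, 5, 4, 3, 2, 1] ++ r48.reverse ++ [1, 2, 3, 4, 5, 8])
    (by decide) (by decide +kernel)]
  rw [wd_append, wd_append, wd_reverse hp (by decide), h, inv_one, mul_one, ← wd_append]
  exact wd_eq_one hp (by decide +kernel)

end Words

/-- Elements satisfying the relations of the 2-fold cover, with generators adjusted by `Z`. -/
structure CoverData {K : Type*} [Group K] (P : ℕ → K) (Z τ : K) : Prop where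
  cox : IsCox P
  sq : Z * Z = 1
  comm : ∀ s < 9, Z * P s = P s * Z
  spider : wd P spider ^ 10 = 1
  one : wd P u₁ ^ 9 = 1
  two : wd P u₂ ^ 9 = Z
  tau_sq : τ * τ = 1
  tau_comm : Z * τ = τ * Z
  tau_conj : ∀ s < 9, τ * P s * τ = P (sig s) * Z

theorem CoverData.of_perm {Y : Type*} {p : ℕ → Perm Y} {Z : Perm Y} (hp : IsCox p)
    (hZZ : Z * Z = 1) (hZ : ∀ s < 9, Z * p s = p s * Z) (h1 : wd p (pw u₁ 9) = 1)
    (h2 : wd p (pw u₂ 9) = Z) (hR : wd p r48 = 1) :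
    CoverData (fun s => Perm.sumCongrHom Y Y (p s, p (sig s) * Z))
      (Perm.sumCongrHom Y Y (Z, Z)) (Equiv.sumComm Y Y) := by
  have hq : IsCox fun s => p (sig s) * Z :=
    hp.comp_sig.mul_central (fun s hs => hZ _ (sig_lt hs)) hZZ
  have wdq (w : List ℕ) (hw : ∀ s ∈ w, s < 9) :
      wd (fun s => p (sig s) * Z) w = wd p (w.map sig) * Z ^ w.length := by
    have := wd_mul_pow (p := fun s => p (sig s)) (fun s hs => hZ _ (sig_lt hs)) (fun _ => 1) w hw
    simpa [wd_comp] using this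
  have wdP (w : List ℕ) : wd (fun s => Perm.sumCongrHom Y Y (p s, p (sig s) * Z)) w =
      Perm.sumCongrHom Y Y (wd p w, wd (fun s => p (sig s) * Z) w) := by
    rw [← wd_map]
    congr 1
    induction w with
    | nil => rfl
    | cons s w ih => rw [wd_cons, ih]; rfl
  have hR' := wd_sig_r48 hp hR
  have hS : wd (fun s => p (sig s) * Z) r48 = 1 := by
    rw [wdq _ (by decide), hR', pow_eq_of_mod hZZ (k := 0) (by decide), pow_zero, one_mul]
  have one_eq : Perm.sumCongrHom Y Y (1, 1) = 1 := map_one _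
  refine ⟨(hp.prod hq).map _, ?_, ?_, ?_, ?_, ?_, ?_, ?_, ?_⟩
  · rw [← map_mul, Prod.mk_mul_mk, hZZ, one_eq]
  · intro s hs
    rw [← map_mul, ← map_mul, Prod.mk_mul_mk, Prod.mk_mul_mk, hZ s hs, ← mul_assoc,
      hZ _ (sig_lt hs)]
  · rw [← wd_pw, wdP, wd_pw, wd_pw, wd_spider hp hR, wd_spider hq hS, one_eq]
  · rw [← wd_pw, wdP, h1, wdq _ (by decide), wd_eq_wd hp (w := pw u₂ 9) (by decide)
      (by decide +kernel), h2, pow_eq_of_mod hZZ (k := 1) (by decide), pow_one, hZZ, one_eq]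
  · rw [← wd_pw, wdP, h2, wdq _ (by decide), wd_eq_wd hp (w := pw u₁ 9) (by decide)
      (by decide +kernel), h1, pow_eq_of_mod hZZ (k := 1) (by decide), pow_one, one_mul]
  · ext x; rcases x with x | x <;> rfl
  · ext x; rcases x with x | x <;> rfl
  · intro s hs
    have : p s = p s * Z * Z := by rw [mul_assoc, hZZ, mul_one]
    rw [← map_mul, Prod.mk_mul_mk, sig_sig, ← this]
    ext x; rcases x with x | x <;> rfl

/-! ### The presentation -/

/-- Exponents of the central element in the adjusted generators. -/
def adj (s : ℕ) : ℕ := ifz (memb s [2, 3, 4, 6, 7, 8]) 1 0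

section Adjust

variable {K : Type*} [Group K] {p : ℕ → K} {Z : K}

lemma wd_adj (hZZ : Z * Z = 1) (hZ : ∀ s < 9, Z * p s = p s * Z) (u : List ℕ) (k m : ℕ)
    (hu : ∀ s ∈ u, s < 9) (hm : ((u.map adj).sum * k) % 2 = m % 2) :
    wd (fun s => p s * Z ^ adj s) u ^ k = wd p u ^ k * Z ^ m := by
  have hc : Commute Z (wd p u) := by
    rw [wd]
    refine Commute.list_prod_right _ _ fun x hx => ?_
    obtain ⟨t, ht, rfl⟩ := List.mem_map.1 hx
    exact hZ t (hu t ht)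
  rw [wd_mul_pow hZ adj u hu, (hc.symm.pow_right _).mul_pow, ← pow_mul, pow_eq_of_mod hZZ hm]

lemma comm_adj (hZ : ∀ s < 9, Z * p s = p s * Z) :
    ∀ s < 9, Z * (p s * Z ^ adj s) = p s * Z ^ adj s * Z := by
  intro s hs
  rw [← mul_assoc, hZ s hs, mul_assoc, mul_assoc, ← pow_succ, ← pow_succ']

lemma IsCox.of_pow (h1 : ∀ s < 9, p s ^ 2 = 1)
    (h2 : ∀ t < 9, ∀ s < t, adjc s t = false → (p s * p t) ^ 2 = 1)
    (h3 : ∀ t < 9, ∀ s < t, adjc s t = true → (p s * p t) ^ 3 = 1) : IsCox p := by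
  have hi (s : ℕ) (hs : s < 9) : (p s)⁻¹ = p s := by
    rw [inv_eq_iff_mul_eq_one, ← pow_two, h1 s hs]
  have c (s t : ℕ) (hs : s < 9) (ht : t < 9) (h : (p s * p t) ^ 2 = 1) :
      p s * p t = p t * p s := by
    rw [pow_two, mul_eq_one_iff_eq_inv, mul_inv_rev, hi s hs, hi t ht] at h
    exact h
  have b (s t : ℕ) (hs : s < 9) (ht : t < 9) (h : (p s * p t) ^ 3 = 1) :
      p s * p t * p s = p t * p s * p t := by
    rw [pow_succ, pow_two, show p s * p t * (p s * p t) * (p s * p t) =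
      (p s * p t * p s) * (p t * p s * p t) by simp only [mul_assoc], mul_eq_one_iff_eq_inv,
      mul_inv_rev, mul_inv_rev, hi s hs, hi t ht] at h
    rw [h, mul_assoc]
  constructor
  · intro s hs
    rw [← pow_two, h1 s hs]
  · intro s hs t ht a
    rcases lt_trichotomy s t with h | rfl | h
    · exact c s t hs ht (h2 t ht s h a)
    · rfl
    · exact (c t s ht hs (h2 s hs t h (by rwa [adjc_comm ht hs]))).symm
  · intro s hs t ht a
    rcases lt_trichotomy s t with h | rfl | h
    · exact b s t hs ht (h3 t ht s h a)
    · rfl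
    · exact (b t s ht hs (h3 s hs t h (by rwa [adjc_comm ht hs]))).symm

end Adjust

/-- The generators of the free group. -/
def fgen : ℕ → FreeGroup GenA
  | 0 => sa | 1 => sb | 2 => sc | 3 => sd | 4 => se | 5 => sf | 6 => sg | 7 => sh | 8 => si
  | _ => 1

section Relators

variable {K : Type*} [Group K] {F : FreeGroup GenA →* K}

lemma fgen_sq_mem {s : ℕ} (hs : s < 9) : fgen s ^ 2 ∈ relsA := by
  interval_cases s <;>
    simp only [fgen, relsA, Set.mem_insert_iff, Set.mem_singleton_iff, true_or, or_true]

lemma fgen_comm_mem : ∀ t < 9, ∀ s < t, adjc s t = false → (fgen s * fgen t) ^ 2 ∈ relsA := by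
  intro t ht s hs h
  interval_cases t <;> interval_cases s <;>
    first
    | exact absurd h (by decide)
    | simp only [fgen, relsA, Set.mem_insert_iff, Set.mem_singleton_iff, true_or, or_true]

lemma fgen_braid_mem : ∀ t < 9, ∀ s < t, adjc s t = true →
    (fgen s * fgen t) ^ 3 * (sz⁻¹) ^ ((adj s + adj t) % 2) ∈ relsA := by
  intro t ht s hs h
  interval_cases t <;> interval_cases s <;>
    first
    | exact absurd h (by decide)
    | (simp only [show adj 0 = 0 from rfl, show adj 1 = 0 from rfl, show adj 2 = 1 from rfl,
        show adj 3 = 1 from rfl, show adj 4 = 1 from rfl, show adj 5 = 0 from rfl,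
        show adj 6 = 1 from rfl, show adj 7 = 1 from rfl, show adj 8 = 1 from rfl,
        Nat.reduceAdd, Nat.reduceMod, pow_one, pow_zero, mul_one]
       simp only [fgen, relsA, Set.mem_insert_iff, Set.mem_singleton_iff, true_or, or_true])

lemma fgen_z_mem {s : ℕ} (hs : s < 9) : sz * fgen s * sz⁻¹ * (fgen s)⁻¹ ∈ relsA := by
  interval_cases s <;>
    simp only [fgen, relsA, Set.mem_insert_iff, Set.mem_singleton_iff, true_or, or_true]

lemma coverData_of_relators (hF : ∀ r ∈ relsA, F r = 1) :
    CoverData (fun s => F (fgen s) * F sz ^ adj s) (F sz) (F st) := by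
  have mem {r : FreeGroup GenA} (h : r ∈ relsA) : F r = 1 := hF r h
  have hZZ : F sz * F sz = 1 := by
    rw [← map_mul, ← pow_two]
    exact mem (by simp only [relsA, Set.mem_insert_iff, true_or, or_true])
  have hττ : F st * F st = 1 := by
    rw [← map_mul, ← pow_two]
    exact mem (by simp only [relsA, Set.mem_insert_iff, true_or, or_true])
  have hτi : (F st)⁻¹ = F st := inv_eq_of_mul_eq_one_left hττ
  have hZi : (F sz)⁻¹ = F sz := inv_eq_of_mul_eq_one_left hZZ
  have hZ : ∀ s < 9, F sz * F (fgen s) = F (fgen s) * F sz := by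
    intro s hs
    have := mem (fgen_z_mem hs)
    rw [map_mul, map_mul, map_mul, map_inv, map_inv, mul_inv_eq_one, mul_inv_eq_iff_eq_mul] at this
    exact this
  have hτ : F sz * F st = F st * F sz := by
    have : F (sz * st * sz⁻¹ * st⁻¹) = 1 :=
      mem (by simp only [relsA, Set.mem_insert_iff, true_or, or_true])
    rw [map_mul, map_mul, map_mul, map_inv, map_inv, mul_inv_eq_one, mul_inv_eq_iff_eq_mul] at this
    exact this
  have W (u : List ℕ) (k m : ℕ) (hu : ∀ s ∈ u, s < 9)
      (hm : ((u.map adj).sum * k) % 2 = m % 2) :=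
    wd_adj (p := fun s => F (fgen s)) hZZ hZ u k m hu hm
  have hcox : IsCox fun s => F (fgen s) * F sz ^ adj s := by
    apply IsCox.of_pow
    · intro s hs
      have := W [s] 2 0 (by simpa using hs) (by simp)
      have h2 := mem (fgen_sq_mem hs)
      rw [map_pow] at h2
      simpa [wd, h2] using this
    · intro t ht s hs h
      have := W [s, t] 2 0 (by simp [ht, hs.trans ht]) (by simp)
      have h2 := mem (fgen_comm_mem t ht s hs h)
      rw [map_pow, map_mul] at h2
      simpa [wd, h2] using this
    · intro t ht s hs h
      have := W [s, t] 3 (adj s + adj t) (by simp [ht, hs.trans ht])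
        (by simp; omega)
      have h2 := mem (fgen_braid_mem t ht s hs h)
      rw [map_mul, map_pow, map_mul, map_pow, map_inv, hZi,
        pow_eq_of_mod hZZ (k := adj s + adj t) (by omega)] at h2
      rw [← h2]
      simpa [wd] using this
  refine ⟨hcox, hZZ, comm_adj hZ, ?_, ?_, ?_, hττ, hτ, ?_⟩
  · have h := mem (r := (sd * sc * sb * sd * se * sf * sd * sh * si) ^ 10)
      (by simp only [relsA, Set.mem_insert_iff, true_or, or_true])
    rw [W spider 10 0 (by decide) (by decide), pow_zero, mul_one]
    simpa [wd, spider, fgen, mul_assoc] using h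
  · have h := mem (r := (sa * sb * sc * sd * se * sf * sh) ^ 9)
      (by simp only [relsA, Set.mem_insert_iff, true_or, or_true])
    rw [W u₁ 9 0 (by decide) (by decide), pow_zero, mul_one]
    simpa [wd, u₁, fgen, mul_assoc] using h
  · have h := mem (r := (sb * sc * sd * se * sf * sg * sh) ^ 9)
      (by simp only [relsA, Set.mem_insert_iff, true_or, or_true])
    rw [W u₂ 9 1 (by decide) (by decide), pow_one]
    have : wd (fun s => F (fgen s)) u₂ ^ 9 = 1 := by simpa [wd, u₂, fgen, mul_assoc] using h
    rw [this, one_mul]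
  · have key {x y : K} {m : ℕ} (h : F st * x * F st * y * F sz ^ m = 1) (hy : y * y = 1)
        {i j : ℕ} (hj : (i + j + m) % 2 = 1) (hyZ : F sz * y = y * F sz) :
        F st * (x * F sz ^ i) * F st = y * F sz ^ j * F sz := by
      have hp (k : ℕ) : F sz ^ k * F st = F st * F sz ^ k := Commute.pow_left hτ k
      have hy' (k : ℕ) : F sz ^ k * y = y * F sz ^ k := Commute.pow_left hyZ k
      rw [mul_assoc (F st), mul_assoc x, hp, ← mul_assoc x, ← mul_assoc (F st),
        ← mul_assoc (F st)]
      have : F st * x * F st = F sz ^ m * y := by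
        rw [mul_assoc _ y, mul_eq_one_iff_eq_inv, mul_inv_rev] at h
        rw [h, inv_eq_of_mul_eq_one_left hy, inv_eq_of_mul_eq_one_left
          (show F sz ^ m * F sz ^ m = 1 by rw [← pow_add, pow_eq_of_mod hZZ (k := 0) (by omega),
            pow_zero])]
      rw [this, hy', mul_assoc, mul_assoc, ← pow_add, ← pow_succ,
        pow_eq_of_mod hZZ (k := j + 1) (by omega)]
    have sq (s : ℕ) (hs : s < 9) : F (fgen s) * F (fgen s) = 1 := by
      rw [← map_mul, ← pow_two]; exact mem (fgen_sq_mem hs)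
    have far {s m : ℕ} (hs : s < 9) (h : st⁻¹ * fgen s * st * fgen (sig s) * (sz⁻¹) ^ m ∈ relsA)
        (hm : (adj s + adj (sig s) + m) % 2 = 1) :
        F st * (F (fgen s) * F sz ^ adj s) * F st =
          F (fgen (sig s)) * F sz ^ adj (sig s) * F sz := by
      refine key (m := m) ?_ (sq _ (sig_lt hs)) hm (hZ _ (sig_lt hs))
      have := mem h
      simpa only [map_mul, map_pow, map_inv, hZi, hτi] using this
    have near {s : ℕ} (hs : s < 9) (h : (fgen s * st) ^ 2 * sz⁻¹ ∈ relsA) (e : sig s = s) :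
        F st * (F (fgen s) * F sz ^ adj s) * F st =
          F (fgen (sig s)) * F sz ^ adj (sig s) * F sz := by
      rw [e]
      refine key (m := 1) ?_ (sq _ hs) (by omega) (hZ _ hs)
      have := mem h
      rw [map_mul, map_pow, map_mul, map_inv, mul_inv_eq_one, pow_two] at this
      have h2 : F st * F (fgen s) * F st = F (fgen s) * F sz := by
        rw [← this, mul_assoc (F (fgen s)), ← mul_assoc (F (fgen s)), sq s hs, one_mul, mul_assoc]
      rw [h2, pow_one, mul_assoc _ (F sz), hZ s hs, ← mul_assoc, sq s hs, one_mul, hZZ]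
    have back {s : ℕ} (hs : s < 9) (h : F st * (F (fgen s) * F sz ^ adj s) * F st =
        F (fgen (sig s)) * F sz ^ adj (sig s) * F sz) :
        F st * (F (fgen (sig s)) * F sz ^ adj (sig s)) * F st =
          F (fgen s) * F sz ^ adj s * F sz := by
      have h2 : F (fgen (sig s)) * F sz ^ adj (sig s) =
          F st * (F (fgen s) * F sz ^ adj s) * F st * F sz := by
        rw [h, mul_assoc _ (F sz) (F sz), hZZ, mul_one]
      rw [h2]
      simp only [← mul_assoc]
      rw [hττ, one_mul, mul_assoc _ (F sz), hτ, ← mul_assoc, mul_assoc _ (F st) (F st), hττ,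
        mul_one]
    have t0 := far (s := 0) (m := 0) (by decide) (by
      show st⁻¹ * sa * st * sg * (sz⁻¹) ^ 0 ∈ relsA
      rw [pow_zero, mul_one]
      simp only [relsA, Set.mem_insert_iff, true_or, or_true]) (by decide)
    have t1 := far (s := 1) (m := 1) (by decide) (by
      show st⁻¹ * sb * st * sf * (sz⁻¹) ^ 1 ∈ relsA
      rw [pow_one]
      simp only [relsA, Set.mem_insert_iff, true_or, or_true]) (by decide)
    have t2 := far (s := 2) (m := 1) (by decide) (by
      show st⁻¹ * sc * st * se * (sz⁻¹) ^ 1 ∈ relsA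
      rw [pow_one]
      simp only [relsA, Set.mem_insert_iff, true_or, or_true]) (by decide)
    intro s hs
    interval_cases s
    · exact t0
    · exact t1
    · exact t2
    · exact near hs (by
        show (sd * st) ^ 2 * sz⁻¹ ∈ relsA
        simp only [relsA, Set.mem_insert_iff, Set.mem_singleton_iff, true_or, or_true]) rfl
    · exact back (s := 2) (by decide) t2
    · exact back (s := 1) (by decide) t1
    · exact back (s := 0) (by decide) t0
    · exact near hs (by
        show (sh * st) ^ 2 * sz⁻¹ ∈ relsA
        simp only [relsA, Set.mem_insert_iff, Set.mem_singleton_iff, true_or, or_true]) rfl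
    · exact near hs (by
        show (si * st) ^ 2 * sz⁻¹ ∈ relsA
        simp only [relsA, Set.mem_insert_iff, Set.mem_singleton_iff, or_true]) rfl

/-- The images of the generators in a group satisfying the relations. -/
def image (P : ℕ → K) (Z τ : K) : GenA → K
  | .a => P 0 * Z ^ adj 0 | .b => P 1 * Z ^ adj 1 | .c => P 2 * Z ^ adj 2
  | .d => P 3 * Z ^ adj 3 | .e => P 4 * Z ^ adj 4 | .f => P 5 * Z ^ adj 5
  | .g => P 6 * Z ^ adj 6 | .h => P 7 * Z ^ adj 7 | .i => P 8 * Z ^ adj 8 | .z => Z | .t => τ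

lemma CoverData.lift_eq_one {P : ℕ → K} {Z τ : K} (D : CoverData P Z τ) :
    ∀ r ∈ relsA, FreeGroup.lift (image P Z τ) r = 1 := by
  set F := FreeGroup.lift (image P Z τ)
  set X : ℕ → K := fun s => P s * Z ^ adj s with hX
  have hFa : F sa = X 0 := by simp [F, sa, image, X]
  have hFb : F sb = X 1 := by simp [F, sb, image, X]
  have hFc : F sc = X 2 := by simp [F, sc, image, X]
  have hFd : F sd = X 3 := by simp [F, sd, image, X]
  have hFe : F se = X 4 := by simp [F, se, image, X]
  have hFf : F sf = X 5 := by simp [F, sf, image, X]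
  have hFg : F sg = X 6 := by simp [F, sg, image, X]
  have hFh : F sh = X 7 := by simp [F, sh, image, X]
  have hFi : F si = X 8 := by simp [F, si, image, X]
  have hFz : F sz = Z := by simp [F, sz, image]
  have hFt : F st = τ := by simp [F, st, image]
  have hτi : τ⁻¹ = τ := inv_eq_of_mul_eq_one_left D.tau_sq
  have hZi : Z⁻¹ = Z := inv_eq_of_mul_eq_one_left D.sq
  have hXZ : ∀ s < 9, Z * X s = X s * Z := comm_adj D.comm
  have W (u : List ℕ) (k m : ℕ) (hu : ∀ s ∈ u, s < 9)
      (hm : ((u.map adj).sum * k) % 2 = m % 2) : wd X u ^ k = wd P u ^ k * Z ^ m :=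
    wd_adj D.sq D.comm u k m hu hm
  have R2 (u : List ℕ) (k : ℕ) (hu : ∀ s ∈ u, s < 9)
      (hm : ((u.map adj).sum * k) % 2 = 0) (hr : reduces (pw u k) [] = true) : wd X u ^ k = 1 := by
    rw [W u k 0 hu hm, ← wd_pw, wd_eq_one D.cox hr, pow_zero, one_mul]
  have R3 (u : List ℕ) (k : ℕ) (hu : ∀ s ∈ u, s < 9)
      (hm : ((u.map adj).sum * k) % 2 = 1) (hr : reduces (pw u k) [] = true) :
      wd X u ^ k * Z = 1 := by
    rw [W u k 1 hu hm, ← wd_pw, wd_eq_one D.cox hr, pow_one, one_mul, D.sq]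
  have hX2 (s : ℕ) (hs : s < 9) : X s * X s = 1 := by
    have := R2 [s] 2 (by simpa using hs) (by simp) (by interval_cases s <;> decide +kernel)
    simpa [wd, pow_two] using this
  have hZX (s : ℕ) (hs : s < 9) : Z * X s * Z * (X s)⁻¹ = 1 := by
    rw [hXZ s hs, mul_assoc (X s), D.sq, mul_one, mul_inv_cancel]
  have hτX (s m : ℕ) (hs : s < 9) (hm : (adj s + 1 + adj (sig s)) % 2 = m % 2) :
      τ * X s * τ = X (sig s) * Z ^ m := by
    have h1 : Z ^ adj s * τ = τ * Z ^ adj s := Commute.pow_left D.tau_comm _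
    rw [hX]
    simp only
    rw [mul_assoc, mul_assoc (P s), h1, ← mul_assoc (P s), ← mul_assoc τ, ← mul_assoc τ,
      D.tau_conj s hs, mul_assoc, mul_assoc, ← pow_add, ← pow_succ',
      pow_eq_of_mod D.sq (m := adj s + 1) (k := adj (sig s) + m) (by omega)]
  have far (s m : ℕ) (hs : s < 9) (hm : (adj s + 1 + adj (sig s)) % 2 = m % 2) :
      τ * X s * τ * X (sig s) * Z ^ m = 1 := by
    have h1 : Z ^ m * X (sig s) = X (sig s) * Z ^ m := Commute.pow_left (hXZ _ (sig_lt hs)) _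
    rw [hτX s m hs hm, mul_assoc _ (Z ^ m), h1, ← mul_assoc, hX2 _ (sig_lt hs), one_mul,
      ← pow_add, pow_eq_of_mod D.sq (k := 0) (by omega), pow_zero]
  have near (s : ℕ) (hs : s < 9) (h : sig s = s) : (X s * τ) ^ 2 * Z = 1 := by
    have := hτX s 1 hs (by rw [h]; omega)
    rw [h, pow_one] at this
    rw [pow_two, mul_assoc (X s), ← mul_assoc τ, this, ← mul_assoc, hX2 s hs, one_mul, D.sq]
  intro r hr
  simp only [relsA, Set.mem_insert_iff, Set.mem_singleton_iff] at hr
  have w1 : wd X u₁ ^ 9 = 1 := by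
    rw [W u₁ 9 0 (by decide) (by decide), D.one, pow_zero, one_mul]
  have w2 : wd X u₂ ^ 9 = 1 := by
    rw [W u₂ 9 1 (by decide) (by decide), D.two, pow_one, D.sq]
  have w3 : wd X CosetTable.spider ^ 10 = 1 := by
    rw [W CosetTable.spider 10 0 (by decide) (by decide), D.spider, pow_zero, one_mul]
  have e2 (s t : ℕ) : X s * X t = wd X [s, t] := by simp [wd]
  have e1 (s : ℕ) : X s = wd X [s] := by simp [wd]
  rcases hr with rfl | rfl | rfl | rfl | rfl | rfl | rfl | rfl | rfl | rfl | rfl | rfl | rfl | rfl |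
      rfl | rfl | rfl | rfl | rfl | rfl | rfl | rfl | rfl | rfl | rfl | rfl | rfl | rfl | rfl |
      rfl | rfl | rfl | rfl | rfl | rfl | rfl | rfl | rfl | rfl | rfl | rfl | rfl | rfl | rfl |
      rfl | rfl | rfl | rfl | rfl | rfl | rfl | rfl | rfl | rfl | rfl | rfl | rfl | rfl | rfl |
      rfl | rfl | rfl | rfl | rfl | rfl | rfl | rfl <;>
    simp only [map_mul, map_pow, map_inv, hFa, hFb, hFc, hFd, hFe, hFf, hFg, hFh, hFi, hFz, hFt,
      hτi, hZi]
  all_goals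
    first
    | (rw [e2]; first
        | exact R2 _ _ (by decide) (by decide) (by decide +kernel)
        | exact R3 _ _ (by decide) (by decide) (by decide +kernel))
    | (rw [e1]; exact R2 [_] 2 (by decide) (by decide) (by decide +kernel))
    | exact hZX _ (by decide)
    | exact near _ (by decide) (by decide)
    | (rw [pow_two]; first | exact D.sq | exact D.tau_sq)
    | (rw [D.tau_comm, mul_assoc τ, D.sq, mul_one, D.tau_sq])
    | simpa [sig] using far 0 0 (by decide) (by decide)
    | exact (congrArg _ (pow_one Z).symm).trans (far _ 1 (by decide) (by decide))
    | (simpa [wd, u₁, mul_assoc] using w1)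
    | (simpa [wd, u₂, mul_assoc] using w2)
    | (simpa [wd, CosetTable.spider, mul_assoc] using w3)

end Relators

open Equiv

/-! ### The table of degree 14080 -/

theorem exists_tableOk : ∃ T, TableOk T 14080 ∧ tableOk T 14080 = true := by
  have hf : CoxAct (X := Unit) [0, 2, 3, 5, 7, 1, 4, 8, 6] fun _ x => x := by
    constructor <;> intros <;> rfl
  have hH : ∀ h ∈ hints14080,
      HintOk (X := Unit) [0, 2, 3, 5, 7, 1, 4, 8, 6] (fun _ x => x) h := by
    have : ∀ h ∈ hints14080, h.sgn < 2 ∧ ∀ t ∈ h.word, t ∈ [0, 2, 3, 5, 7, 1, 4, 8, 6] := by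
      decide +kernel
    exact fun h hh => ⟨(this h hh).1, (this h hh).2, fun _ => rfl⟩
  obtain ⟨T, n, φ, h, -, -, hT⟩ := build_sound hf (x₀ := ()) (M := [6]) (by decide) (by decide)
    (by decide) (fun _ _ _ => rfl) hH build_tableOk
  have h' := h
  simp only [tableOk, band_iff] at h
  obtain ⟨hn, -, -, -, hr⟩ := h
  obtain rfl : n = 14080 := by rwa [beq_eq_decide, decide_eq_true_iff] at hn
  refine ⟨T, ⟨fun x hx s hs => (hT x (by omega) hx s ?_).1, hr⟩, h'⟩
  interval_cases s <;> decide

section Semiconj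

variable {X Y : Type*} {p : ℕ → Perm X} {q : ℕ → Perm Y} {π : X → Y}

lemma wd_semiconj (h : ∀ s < 9, ∀ x, q s (π x) = π (p s x)) (w : List ℕ) (hw : ∀ s ∈ w, s < 9)
    (x : X) : wd q w (π x) = π (wd p w x) := by
  induction w with
  | nil => rfl
  | cons s w ih =>
    rw [wd_cons, wd_cons, Perm.mul_apply, Perm.mul_apply, ih fun t ht => hw t (by simp [ht]),
      h s (hw s (by simp))]

lemma wd_eq_of_semiconj (h : ∀ s < 9, ∀ x, q s (π x) = π (p s x)) (hπ : π.Surjective)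
    {v w : List ℕ} (hv : ∀ s ∈ v, s < 9) (hw : ∀ s ∈ w, s < 9) (e : ∀ x,
        π (wd p v x) = π (wd p w x)) :
    wd q v = wd q w := by
  ext y
  obtain ⟨x, rfl⟩ := hπ y
  rw [wd_semiconj h v hv, wd_semiconj h w hw, e]

end Semiconj

namespace TableOk

variable {T : ℕ → ℕ} {n : ℕ} (h : TableOk T n)
include h

/-- The permutation of the points given by a generator. -/
def pperm (s : ℕ) : Perm {x // x < n} :=
  if hs : s < 9 then
    have hi (x : ℕ) (hx : x < n) : nbr T s (nbr T s x) = x := by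
      have e : pt (2 * x) = x := by rw [pt, nat_div]; omega
      have := congrArg pt (h.invol hs (c := 2 * x) (by rwa [e]))
      rwa [pt_codeAct, pt_codeAct, e] at this
    { toFun := fun x => ⟨nbr T s x, h.range _ x.2 _ hs⟩
      invFun := fun x => ⟨nbr T s x, h.range _ x.2 _ hs⟩
      left_inv := fun x => Subtype.ext (hi x x.2)
      right_inv := fun x => Subtype.ext (hi x x.2) }
  else 1

lemma pperm_apply {s : ℕ} (hs : s < 9) (x : {x // x < n}) : (h.pperm s x : ℕ) = nbr T s x := by
  simp [pperm, hs]

omit h in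
/-- The point underlying a signed point. -/
def proj (c : {c // pt c < n}) : {x // x < n} := ⟨pt c, c.2⟩

omit h in
lemma proj_surjective : (proj (n := n)).Surjective := fun x => by
  have e : pt (2 * x) = x := by rw [pt, nat_div]; omega
  exact ⟨⟨2 * x, by rw [e]; exact x.2⟩, Subtype.ext e⟩

omit h in
lemma proj_flip (c : {c // pt c < n}) : proj (flip c) = proj c :=
  Subtype.ext (pt_xor c 1 (by decide))

lemma pperm_proj (s : ℕ) (hs : s < 9) (c : {c // pt c < n}) :
    h.pperm s (proj c) = proj (h.perm s c) := by
  refine Subtype.ext ((h.pperm_apply hs _).trans ?_)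
  change nbr T s (pt c) = pt (h.perm s c)
  rw [h.perm_apply hs, pt_codeAct]

lemma wd_pperm_eq {v w : List ℕ} (hv : ∀ s ∈ v, s < 9) (hw : ∀ s ∈ w, s < 9)
    (e : wd h.perm v = wd h.perm w) : wd h.pperm v = wd h.pperm w :=
  wd_eq_of_semiconj h.pperm_proj proj_surjective hv hw fun x => by rw [e]

lemma isCox_pperm : IsCox h.pperm where
  invol s hs := by
    simpa [wd] using h.wd_pperm_eq (v := [s, s]) (w := []) (by simp [hs]) (by simp)
      (by simpa [wd] using h.isCox_perm.invol s hs)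
  comm s hs t ht a := by
    simpa [wd] using h.wd_pperm_eq (v := [s, t]) (w := [t, s]) (by simp [hs, ht])
      (by simp [hs, ht]) (by simpa [wd] using h.isCox_perm.comm s hs t ht a)
  braid s hs t ht a := by
    simpa [wd, mul_assoc] using h.wd_pperm_eq (v := [s, t, s]) (w := [t, s, t]) (by simp [hs, ht])
      (by simp [hs, ht]) (by simpa [wd, mul_assoc] using h.isCox_perm.braid s hs t ht a)

theorem coverData_perm : ∃ P τ, CoverData P (Perm.sumCongrHom _ _
    (flip (n := n), flip (n := n))) τ :=
  ⟨_, _, CoverData.of_perm h.isCox_perm flip_mul_flip (fun _ hs => h.flip_perm hs) h.wd_perm_u₁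
    h.wd_perm_u₂ h.wd_perm_r48⟩

theorem coverData_pperm :
    CoverData (fun s => Perm.sumCongrHom _ _ (h.pperm s, h.pperm (sig s) * 1))
      (Perm.sumCongrHom _ _ (1, 1)) (Equiv.sumComm {x // x < n} _) := by
  refine CoverData.of_perm h.isCox_pperm (mul_one 1) (fun _ hs => by simp)
    (h.wd_pperm_eq (by decide +kernel) (w := []) (by simp) h.wd_perm_u₁)
    (wd_eq_of_semiconj h.pperm_proj proj_surjective (by decide +kernel) (w := []) (by simp) ?_)
    (h.wd_pperm_eq (by decide) (w := []) (by simp) h.wd_perm_r48)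
  intro x
  rw [h.wd_perm_u₂, proj_flip]
  rfl

end TableOk

open Equiv

/-! ### The group `A1` -/

/-- The adjusted generators of `A1`. -/
def yp (s : ℕ) : A1 := PresentedGroup.mk relsA (fgen s) * yz ^ adj s

lemma coverData_A1 : CoverData yp yz yt :=
  coverData_of_relators (F := PresentedGroup.mk relsA) fun _ hr => PresentedGroup.one_of_mem hr

section Hom

variable {K : Type*} [Group K] {P : ℕ → K} {Z τ : K}

/-- The homomorphism from `A1` to a group satisfying its relations. -/
def CoverData.hom (D : CoverData P Z τ) : A1 →* K := PresentedGroup.toGroup D.lift_eq_one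

lemma CoverData.hom_yz (D : CoverData P Z τ) : D.hom yz = Z :=
  PresentedGroup.toGroup.of D.lift_eq_one

lemma CoverData.hom_yt (D : CoverData P Z τ) : D.hom yt = τ :=
  PresentedGroup.toGroup.of D.lift_eq_one

lemma CoverData.hom_yp (D : CoverData P Z τ) {s : ℕ} (hs : s < 9) : D.hom (yp s) = P s := by
  have h : D.hom (PresentedGroup.mk relsA (fgen s)) = P s * Z ^ adj s := by
    interval_cases s <;> exact PresentedGroup.toGroup.of D.lift_eq_one
  rw [yp, map_mul, map_pow, h, D.hom_yz, mul_assoc, ← pow_add,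
    pow_eq_of_mod D.sq (k := 0) (by omega),
    pow_zero, mul_one]

end Hom

lemma mem_of_generators {S : Subgroup A1} (hS : ∀ s < 9, yp s ∈ S) (hz : yz ∈ S) (ht : yt ∈ S)
    (g : A1) : g ∈ S := by
  have h (s : ℕ) (hs : s < 9) : PresentedGroup.mk relsA (fgen s) ∈ S := by
    have := S.mul_mem (hS s hs) (S.inv_mem (S.pow_mem hz (adj s)))
    rwa [yp, mul_inv_cancel_right] at this
  have : Subgroup.closure (Set.range (PresentedGroup.of (rels := relsA))) ≤ S := by
    rw [Subgroup.closure_le]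
    rintro _ ⟨x, rfl⟩
    cases x
    exacts [h 0 (by decide), h 1 (by decide), h 2 (by decide), h 3 (by decide), h 4 (by decide),
      h 5 (by decide), h 6 (by decide), h 7 (by decide), h 8 (by decide), hz, ht]
  rw [PresentedGroup.closure_range_of] at this
  exact this (Subgroup.mem_top g)

lemma yz_mem_H1sub : yz ∈ H1sub := Subgroup.subset_closure (by simp)

lemma yp_mem_H1sub {s : ℕ} (hs : s < 9) : yp s ∈ H1sub := by
  refine H1sub.mul_mem (Subgroup.subset_closure ?_) (H1sub.pow_mem yz_mem_H1sub _)
  interval_cases s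
  exacts [Or.inl rfl, Or.inr (Or.inl rfl), Or.inr (Or.inr (Or.inl rfl)),
    Or.inr (Or.inr (Or.inr (Or.inl rfl))), Or.inr (Or.inr (Or.inr (Or.inr (Or.inl rfl)))),
    Or.inr (Or.inr (Or.inr (Or.inr (Or.inr (Or.inl rfl))))),
    Or.inr (Or.inr (Or.inr (Or.inr (Or.inr (Or.inr (Or.inl rfl)))))),
    Or.inr (Or.inr (Or.inr (Or.inr (Or.inr (Or.inr (Or.inr (Or.inl rfl))))))),
    Or.inr (Or.inr (Or.inr (Or.inr (Or.inr (Or.inr (Or.inr (Or.inr (Or.inl rfl))))))))]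

lemma H1sub_le {S : Subgroup A1} (hS : ∀ s < 9, yp s ∈ S) (hz : yz ∈ S) : H1sub ≤ S := by
  have h (s : ℕ) (hs : s < 9) : PresentedGroup.mk relsA (fgen s) ∈ S := by
    have := S.mul_mem (hS s hs) (S.inv_mem (S.pow_mem hz (adj s)))
    rwa [yp, mul_inv_cancel_right] at this
  rw [H1sub, Subgroup.closure_le]
  rintro x (rfl | rfl | rfl | rfl | rfl | rfl | rfl | rfl | rfl | rfl)
  exacts [h 0 (by decide), h 1 (by decide), h 2 (by decide), h 3 (by decide), h 4 (by decide),
    h 5 (by decide), h 6 (by decide), h 7 (by decide), h 8 (by decide), hz]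

lemma yz_comm (g : A1) : g * yz = yz * g := by
  have : g ∈ Subgroup.centralizer {yz} := by
    refine mem_of_generators (fun s hs => ?_) ?_ ?_ g <;> rw [Subgroup.mem_centralizer_singleton_iff]
    · exact coverData_A1.comm s hs |>.symm
    · exact coverData_A1.tau_comm.symm
  rwa [Subgroup.mem_centralizer_singleton_iff] at this

lemma yz_mem_center : yz ∈ Subgroup.center A1 := Subgroup.mem_center_iff.2 yz_comm

lemma orderOf_yz : orderOf yz = 2 := by
  obtain ⟨T, hT, -⟩ := exists_tableOk
  obtain ⟨P, τ, D⟩ := hT.coverData_perm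
  refine orderOf_eq_prime (by rw [pow_two, coverData_A1.sq]) fun h => ?_
  have h1 := D.hom_yz
  rw [h, map_one] at h1
  have h2 := congrArg (fun f => f (Sum.inl ⟨0, by decide⟩)) h1
  simp only [Perm.one_apply, Perm.sumCongrHom_apply, Equiv.sumCongr_apply, Sum.map_inl,
    Sum.inl.injEq, Subtype.ext_iff, TableOk.flip_apply] at h2
  exact absurd h2 (by decide)

lemma index_H1sub : H1sub.index = 2 := by
  have D : CoverData (K := ℤˣ) (fun _ => 1) 1 (-1) := by
    refine ⟨⟨fun _ _ => rfl, fun _ _ _ _ _ => rfl, fun _ _ _ _ _ => rfl⟩, rfl, fun _ _ => rfl,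
      ?_, ?_, ?_, rfl, rfl, fun _ _ => rfl⟩ <;> rfl
  have hker : H1sub ≤ D.hom.ker := H1sub_le (fun s hs => D.hom_yp hs) D.hom_yz
  have hc : ∀ g ∈ H1sub, yt * g * yt ∈ H1sub := by
    have : H1sub ≤ H1sub.comap (MulAut.conj yt).toMonoidHom := by
      have hi : yt⁻¹ = yt := inv_eq_of_mul_eq_one_left coverData_A1.tau_sq
      refine H1sub_le (fun s hs => ?_) ?_ <;>
        simp only [Subgroup.mem_comap, MulEquiv.coe_toMonoidHom, MulAut.conj_apply, hi]
      · rw [coverData_A1.tau_conj s hs]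
        exact H1sub.mul_mem (yp_mem_H1sub (sig_lt hs)) yz_mem_H1sub
      · rw [← coverData_A1.tau_comm, mul_assoc, coverData_A1.tau_sq, mul_one]
        exact yz_mem_H1sub
    intro g hg
    have := this hg
    rwa [Subgroup.mem_comap, MulEquiv.coe_toMonoidHom, MulAut.conj_apply,
      inv_eq_of_mul_eq_one_left coverData_A1.tau_sq] at this
  rw [Subgroup.index_eq_two_iff]
  refine ⟨yt, fun b => ?_⟩
  have hnot : ¬ (b * yt ∈ H1sub ∧ b ∈ H1sub) := by
    rintro ⟨h1, h2⟩
    have h3 : D.hom (b * yt) = 1 := hker h1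
    have h4 : D.hom b = 1 := hker h2
    rw [map_mul, h4, D.hom_yt] at h3
    exact absurd h3 (by decide)
  have hor : b ∈ H1sub ∨ b * yt ∈ H1sub := by
    let S : Subgroup A1 :=
      { carrier := {b | b ∈ H1sub ∨ b * yt ∈ H1sub}
        one_mem' := Or.inl H1sub.one_mem
        mul_mem' := by
          rintro x y (hx | hx) (hy | hy)
          · exact Or.inl (H1sub.mul_mem hx hy)
          · exact Or.inr (by rw [mul_assoc]; exact H1sub.mul_mem hx hy)
          · refine Or.inr ?_
            have := H1sub.mul_mem hx (hc y hy)
            rwa [← mul_assoc, ← mul_assoc, mul_assoc x, coverData_A1.tau_sq, mul_one] at this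
          · refine Or.inl ?_
            have := H1sub.mul_mem hx (hc _ hy)
            rwa [← mul_assoc, ← mul_assoc, mul_assoc x, coverData_A1.tau_sq, mul_one, mul_assoc,
              mul_assoc y, coverData_A1.tau_sq, mul_one] at this
        inv_mem' := by
          have hi : yt⁻¹ = yt := inv_eq_of_mul_eq_one_left coverData_A1.tau_sq
          rintro x (hx | hx)
          · exact Or.inl (H1sub.inv_mem hx)
          · refine Or.inr ?_
            have := hc _ (H1sub.inv_mem hx)
            rwa [mul_inv_rev, hi, ← mul_assoc, coverData_A1.tau_sq, one_mul] at this }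
    exact mem_of_generators (S := S) (fun s hs => Or.inl (yp_mem_H1sub hs)) (Or.inl yz_mem_H1sub)
      (Or.inr (by rw [coverData_A1.tau_sq]; exact H1sub.one_mem)) b
  rw [xor_iff_or_and_not_and]
  exact ⟨hor.symm, hnot⟩

/-! ### The order of the group is at most that of `Fi22` -/

/-- Elements satisfying the relations of `Fi22`. -/
structure SimpleData {Γ : Type*} [Group Γ] (p : ℕ → Γ) : Prop where
  cox : IsCox p
  spider : wd p spider ^ 10 = 1
  one : wd p u₁ ^ 9 = 1
  two : wd p u₂ ^ 9 = 1

namespace SimpleData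

variable {Γ : Type*} [Group Γ] {p : ℕ → Γ}

lemma wd_pw_of_reduces (hp : IsCox p) {v u : List ℕ} (hu : ∀ s ∈ pw u 9, s < 9)
    (h : wd p (pw u 9) = 1) (e : reduces (pw v 9 ++ (pw u 9).reverse) [] = true) :
    wd p (pw v 9) = 1 := by
  rw [wd_eq_wd hp hu e, h]

/-- The relation for the word `abcdehi`. -/
lemma wd_abcdehi (hp : IsCox p) (hR : wd p r48 = 1) (h : wd p (pw u₁ 9) = 1) :
    wd p (pw [0, 1, 2, 3, 4, 7, 8] 9) = 1 := by
  let w : List ℕ := [0, 1, 0, 2, 1, 0, 3, 2, 1, 0, 4, 3, 2, 1, 0, 7, 3, 2, 1, 0, 4, 3, 2, 1, 7, 3, 2,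
    4, 3, 7]
  let g : List ℕ := [8, 5, 4, 3, 2, 1]
  have := wd_eq_one hp (w := (pw [0, 1, 2, 3, 4, 7, 8] 9).reverse ++ w ++ g ++ r48 ++ g.reverse ++
    w.reverse ++ pw u₁ 9 ++ g ++ r48.reverse ++ g.reverse) (by decide +kernel)
  simp only [wd_append, wd_reverse hp (w := w) (by decide), wd_reverse hp (w := g) (by decide),
    wd_reverse hp (w := r48) (by decide),
    wd_reverse hp (w := pw [0, 1, 2, 3, 4, 7, 8] 9) (by decide +kernel), hR, h] at this
  simpa using this

variable (D : SimpleData p)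
include D

lemma wd_r48 : wd p r48 = 1 := CosetTable.wd_r48 D.cox D.spider

lemma wd_gfedchi : wd p (pw [6, 5, 4, 3, 2, 7, 8] 9) = 1 := by
  have h2 : wd p (pw u₂ 9) = 1 := by rw [wd_pw, D.two]
  have h : wd (fun s => p (sig s)) (pw u₁ 9) = 1 := by
    rw [wd_comp, wd_eq_wd D.cox (w := pw u₂ 9) (by decide +kernel) (by decide +kernel), h2]
  have := wd_abcdehi D.cox.comp_sig (by rw [wd_comp, wd_sig_r48 D.cox D.wd_r48]) h
  rw [wd_comp] at this
  exact this

/-- A conjugate of the relation `r48`. -/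
lemma wd_hint243 : wd p [5, 1, 4, 3, 2, 7, 3, 8, 7, 4, 3, 5, 2, 4, 1, 3, 7, 2, 3, 4, 5, 8, 7, 3, 2,
    4, 3, 1, 7, 2, 3, 4, 8, 7, 3, 5, 4, 2, 3, 7, 1, 2, 8, 3, 4, 7, 3, 2] = 1 := by
  let x : List ℕ := [8, 1, 2, 3, 4, 8, 7, 3, 5, 4, 2, 3, 7, 1, 2, 8, 3, 4, 7, 3, 2]
  rw [wd_eq_wd D.cox (w := x.reverse ++ r48 ++ x) (by decide) (by decide +kernel), wd_append,
    wd_append, D.wd_r48, mul_one, wd_reverse D.cox (by decide), inv_mul_cancel]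

/-- Words representing the identity which are used in the coset tables. -/
def relators : List (List ℕ) :=
  [pw [4, 3, 2, 7, 8, 6, 5] 9, pw [2, 1, 4, 5, 7, 3, 0] 9, pw [3, 2, 1, 0, 7, 5, 4] 9,
    pw [2, 1, 0, 7, 4, 5, 3] 9, pw [7, 2, 1, 0, 5, 4, 3] 9, pw [2, 1, 7, 6, 3, 4, 5] 9,
    pw [4, 3, 2, 1, 7, 6, 5] 9, pw [4, 2, 1, 0, 8, 7, 3] 9,
    [5, 1, 4, 3, 2, 7, 3, 8, 7, 4, 3, 5, 2, 4, 1, 3, 7, 2, 3, 4, 5, 8, 7, 3, 2, 4, 3, 1, 7, 2, 3,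
      4, 8, 7, 3, 5, 4, 2, 3, 7, 1, 2, 8, 3, 4, 7, 3, 2]]

lemma wd_relators : ∀ w ∈ relators, wd p w = 1 := by
  have h1 : wd p (pw u₁ 9) = 1 := by rw [wd_pw, D.one]
  have h1' : wd p (pw u₁.reverse 9) = 1 := by
    rw [wd_pw, wd_reverse D.cox (by decide), inv_pow, D.one, inv_one]
  have h2' : wd p (pw u₂.reverse 9) = 1 := by
    rw [wd_pw, wd_reverse D.cox (by decide), inv_pow, D.two, inv_one]
  have h3 : wd p (pw [6, 5, 4, 3, 2, 7, 8].reverse 9) = 1 := by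
    rw [wd_pw, wd_reverse D.cox (by decide), inv_pow, ← wd_pw, D.wd_gfedchi, inv_one]
  have h4 : wd p (pw [0, 1, 2, 3, 4, 7, 8].reverse 9) = 1 := by
    rw [wd_pw, wd_reverse D.cox (by decide), inv_pow, ← wd_pw, wd_abcdehi D.cox D.wd_r48 h1,
        inv_one]
  intro w hw
  simp only [relators, List.mem_cons, List.not_mem_nil, or_false] at hw
  rcases hw with rfl | rfl | rfl | rfl | rfl | rfl | rfl | rfl | rfl
  · exact wd_pw_of_reduces D.cox (by decide +kernel) h3 (by decide +kernel)
  · exact wd_pw_of_reduces D.cox (by decide +kernel) h1' (by decide +kernel)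
  · exact wd_pw_of_reduces D.cox (by decide +kernel) h1' (by decide +kernel)
  · exact wd_pw_of_reduces D.cox (by decide +kernel) h1' (by decide +kernel)
  · exact wd_pw_of_reduces D.cox (by decide +kernel) h1' (by decide +kernel)
  · exact wd_pw_of_reduces D.cox (by decide +kernel) h2' (by decide +kernel)
  · exact wd_pw_of_reduces D.cox (by decide +kernel) h2' (by decide +kernel)
  · exact wd_pw_of_reduces D.cox (by decide +kernel) h4 (by decide +kernel)
  · exact D.wd_hint243

end SimpleData

/-- The subgroup generated by some of the generators. -/
def parabolic {Γ : Type*} [Group Γ] (p : ℕ → Γ) (L : List ℕ) : Subgroup Γ :=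
  Subgroup.closure {g | ∃ s ∈ L, p s = g}

section Parabolic

variable {Γ : Type} [Group Γ] {p : ℕ → Γ}

lemma mem_parabolic {L : List ℕ} {s : ℕ} (hs : s ∈ L) : p s ∈ parabolic p L :=
  Subgroup.subset_closure ⟨s, hs, rfl⟩

lemma parabolic_mono {L L' : List ℕ} (h : ∀ s ∈ L', s ∈ L) : parabolic p L' ≤ parabolic p L := by
  rw [parabolic, Subgroup.closure_le]
  rintro _ ⟨s, hs, rfl⟩
  exact mem_parabolic (h s hs)

lemma smul_mem_of_parabolic {L : List ℕ} {X : Type*} [MulAction Γ X] {I : Set X} (hp : IsCox p)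
    (hL : ∀ s ∈ L, s < 9) (hI : ∀ s ∈ L, ∀ x ∈ I, p s • x ∈ I) {g : Γ} (hg : g ∈ parabolic p L) :
    ∀ x ∈ I, g • x ∈ I := by
  have hinv (s : ℕ) (hs : s ∈ L) : (p s)⁻¹ = p s :=
    inv_eq_of_mul_eq_one_left (hp.invol s (hL s hs))
  induction hg using Subgroup.closure_induction_left with
  | one => intro x hx; rwa [one_smul]
  | mul_left a ha g hg ih =>
    obtain ⟨s, hs, rfl⟩ := ha
    intro x hx
    rw [mul_smul]
    exact hI s hs _ (ih x hx)
  | inv_mul_cancel a ha g hg ih =>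
    obtain ⟨s, hs, rfl⟩ := ha
    intro x hx
    rw [mul_smul, hinv s hs]
    exact hI s hs _ (ih x hx)

lemma appWord_smul {X : Type} [MulAction Γ X] (w : List ℕ) (x : X) :
    appWord (fun s x => p s • x) w x = wd p w.reverse • x := by
  induction w generalizing x with
  | nil => simp [appWord, wd]
  | cons s w ih =>
    rw [wd_reverse_cons, mul_smul, ← ih]
    rfl

variable (D : SimpleData p)
include D

lemma SimpleData.coxAct {X : Type} [MulAction Γ X] {L : List ℕ} (hL : ∀ s ∈ L, s < 9) :
    CoxAct (X := X) L fun s x => p s • x where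
  invol s hs x := by rw [← mul_smul, D.cox.invol s (hL s hs), one_smul]
  comm s hs t ht a x := by rw [← mul_smul, D.cox.comm s (hL s hs) t (hL t ht) a, mul_smul]
  braid s hs t ht a x := by
    simp only [← mul_smul, ← mul_assoc, D.cox.braid s (hL s hs) t (hL t ht) a]

lemma SimpleData.hintOk {X : Type} [MulAction Γ X] {L : List ℕ} {h : Hint} (h1 : h.sgn < 2)
    (h2 : ∀ t ∈ h.word, t ∈ L) (h3 : h.gen < 9) (h4 : ∀ t ∈ h.word, t < 9)
    (h5 : reduces (h.gen :: h.word) [] = true ∨ h.gen :: h.word.reverse ∈ SimpleData.relators) :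
    HintOk (X := X) L (fun s x => p s • x) h := by
  refine ⟨h1, h2, fun x => ?_⟩
  have hi : (p h.gen)⁻¹ = p h.gen := inv_eq_of_mul_eq_one_left (D.cox.invol _ h3)
  change p h.gen • x = _
  rw [appWord_smul]
  congr 1
  rcases h5 with h5 | h5
  · have := wd_eq_one D.cox h5
    rw [wd_cons, mul_eq_one_iff_eq_inv] at this
    rw [wd_reverse D.cox h4, ← this]
  · have := D.wd_relators _ h5
    rw [wd_cons, mul_eq_one_iff_inv_eq, hi] at this
    exact this

/-- A coset table bounds the index of one parabolic subgroup in another one. -/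
lemma SimpleData.card_parabolic {L M L' : List ℕ} {H : List Hint} {d N : ℕ}
    {k : (ℕ → ℕ) → ℕ → Bool} (hb : build L M H d k = true) (hk : ∀ T n, k T n = true →
        n ≤ N) (hN : N ≤ 2 ^ d)
    (hM : M.Nodup ∧ (∀ s ∈ M, s ∈ L) ∧ L.Nodup ∧ (∀ s ∈ L, s < 9) ∧ (∀ s ∈ L', s ∈ L) ∧
      ∀ s ∈ L, s ∉ M → s ∈ L')
    (hH : ∀ h ∈ H, h.sgn < 2 ∧ (∀ t ∈ h.word, t ∈ L) ∧ h.gen < 9 ∧ (∀ t ∈ h.word, t < 9) ∧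
      (reduces (h.gen :: h.word) [] = true ∨ h.gen :: h.word.reverse ∈ SimpleData.relators)) :
    ∃ k, 0 < k ∧ k ≤ N ∧ Nat.card (parabolic p L) = k * Nat.card (parabolic p L') := by
  obtain ⟨hM, hML, hL, hL9, hL', hLM⟩ := hM
  obtain ⟨T, n, φ, hn, h0, hpos, hT⟩ := build_sound (X := Γ ⧸ parabolic p L')
    (x₀ := QuotientGroup.mk 1) (D.coxAct hL9) hM hML hL
    (fun s hs hs' => (QuotientGroup.eq.2 (by
      simpa using mem_parabolic (p := p) (hLM s hs hs'))).symm)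
    (fun h hh => let ⟨a, b, c, d, e⟩ := hH h hh; D.hintOk a b c d e) hb
  replace hn := hk _ _ hn
  set I : Set (Γ ⧸ parabolic p L') := φ '' Set.Iio n with hI
  have hIfin : I.Finite := (Set.finite_Iio n).image φ
  have hstep : ∀ s ∈ L, ∀ x ∈ I, p s • x ∈ I := by
    rintro s hs _ ⟨x, hx, rfl⟩
    obtain ⟨h1, h2⟩ := hT x (lt_of_lt_of_le hx (hn.trans hN)) hx s hs
    exact ⟨_, h1, h2.symm⟩
  let x₀ : Γ ⧸ parabolic p L' := QuotientGroup.mk 1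
  have hx₀ : x₀ ∈ I := ⟨0, hpos, h0⟩
  have horb : MulAction.orbit (parabolic p L) x₀ ⊆ I := by
    rintro _ ⟨g, rfl⟩
    exact smul_mem_of_parabolic D.cox hL9 hstep g.2 x₀ hx₀
  have hstab : MulAction.stabilizer (parabolic p L) x₀ =
      (parabolic p L').subgroupOf (parabolic p L) := by
    ext g
    rw [MulAction.mem_stabilizer_iff, Subgroup.mem_subgroupOf]
    change ((((g : Γ) * 1 : Γ)) : Γ ⧸ parabolic p L') = _ ↔ _
    rw [eq_comm, QuotientGroup.eq]
    simp
  have hidx : (parabolic p L').relIndex (parabolic p L) =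
      (MulAction.orbit (parabolic p L) x₀).ncard := by
    rw [Subgroup.relIndex, ← hstab, MulAction.index_stabilizer]
  refine ⟨(parabolic p L').relIndex (parabolic p L), ?_, ?_, ?_⟩
  · rw [hidx, Set.ncard_pos (hIfin.subset horb)]
    exact MulAction.nonempty_orbit x₀
  · rw [hidx]
    refine (Set.ncard_le_ncard horb hIfin).trans ((Set.ncard_image_le (Set.finite_Iio n)).trans ?_)
    simpa using hn
  · rw [← Subgroup.relIndex_bot_left, ← Subgroup.relIndex_bot_left, mul_comm,
      Subgroup.relIndex_mul_relIndex _ _ _ bot_le (parabolic_mono hL')]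

end Parabolic

section UpperBound

variable {Γ : Type} [Group Γ] {p : ℕ → Γ}

lemma parabolic_nil : parabolic p [] = ⊥ := by
  rw [parabolic, eq_bot_iff, Subgroup.closure_le]
  simp

lemma parabolic_congr {L L' : List ℕ} (h : ∀ s, s ∈ L ↔ s ∈ L') :
    parabolic p L = parabolic p L' :=
  le_antisymm (parabolic_mono fun s hs => (h s).1 hs) (parabolic_mono fun s hs => (h s).2 hs)

lemma build_364 : build [3, 4, 7, 1, 2, 0, 5, 8] [0] hints364 9
    (fun _ n => Nat.ble n 364) = true := by
  decide +kernel

lemma build_243 : build [3, 2, 7, 8, 4, 5, 1] [8] hints243 8 (fun _ n => Nat.ble n 243) = true := by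
  decide +kernel

lemma build_27 : build [2, 1, 3, 7, 4, 5] [5] [] 5 (fun _ n => Nat.ble n 27) = true := by
  decide +kernel

lemma build_16 : build [2, 1, 3, 4, 7] [4] [] 4 (fun _ n => Nat.ble n 16) = true := by
  decide +kernel

lemma build_5 : build [2, 1, 3, 7] [1] [] 3 (fun _ n => Nat.ble n 5) = true := by
  decide +kernel

lemma build_4 : build [3, 2, 7] [2] [] 2 (fun _ n => Nat.ble n 4) = true := by
  decide +kernel

lemma build_3 : build [7, 3] [3] [] 2 (fun _ n => Nat.ble n 3) = true := by
  decide +kernel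

lemma build_2 : build [7] [7] [] 1 (fun _ n => Nat.ble n 2) = true := by
  decide +kernel

variable (D : SimpleData p)
include D

lemma SimpleData.card_parabolic_le :
    0 < Nat.card (parabolic p [0, 1, 2, 3, 4, 5, 6, 7, 8]) ∧
      Nat.card (parabolic p [0, 1, 2, 3, 4, 5, 6, 7, 8]) ≤ 2 ^ 17 * 3 ^ 9 * 5 ^ 2 * 7 * 11 * 13 := by
  have key {N : ℕ} (T : ℕ → ℕ) (n : ℕ) (h : Nat.ble n N = true) : n ≤ N := Nat.le_of_ble_eq_true h
  obtain ⟨k₁, p₁, l₁, e₁⟩ := D.card_parabolic (L' := [3, 4, 7, 1, 2, 0, 5, 8]) (N := 14080)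
    build_tableOk (fun T n h => by
      rw [tableOk, band_iff, beq_eq_decide, decide_eq_true_iff] at h
      exact h.1.le) (by decide) (by decide) (by decide +kernel)
  obtain ⟨k₂, p₂, l₂, e₂⟩ := D.card_parabolic (L' := [3, 2, 7, 8, 4, 5, 1])
    build_364 key (by decide) (by decide) (by decide +kernel)
  obtain ⟨k₃, p₃, l₃, e₃⟩ := D.card_parabolic (L' := [2, 1, 3, 7, 4, 5])
    build_243 key (by decide) (by decide) (by decide +kernel)
  obtain ⟨k₄, p₄, l₄, e₄⟩ := D.card_parabolic (L' := [2, 1, 3, 4, 7])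
    build_27 key (by decide) (by decide) (by decide +kernel)
  obtain ⟨k₅, p₅, l₅, e₅⟩ := D.card_parabolic (L' := [2, 1, 3, 7])
    build_16 key (by decide) (by decide) (by decide +kernel)
  obtain ⟨k₆, p₆, l₆, e₆⟩ := D.card_parabolic (L' := [3, 2, 7])
    build_5 key (by decide) (by decide) (by decide +kernel)
  obtain ⟨k₇, p₇, l₇, e₇⟩ := D.card_parabolic (L' := [7, 3])
    build_4 key (by decide) (by decide) (by decide +kernel)
  obtain ⟨k₈, p₈, l₈, e₈⟩ := D.card_parabolic (L' := [7])
    build_3 key (by decide) (by decide) (by decide +kernel)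
  obtain ⟨k₉, p₉, l₉, e₉⟩ := D.card_parabolic (L' := [])
    build_2 key (by decide) (by decide) (by decide +kernel)
  rw [parabolic_nil, Subgroup.card_bot, mul_one] at e₉
  rw [e₉] at e₈
  rw [e₈] at e₇
  rw [e₇] at e₆
  rw [e₆] at e₅
  rw [e₅] at e₄
  rw [e₄] at e₃
  rw [e₃] at e₂
  rw [parabolic_congr (L' := [0, 2, 3, 5, 7, 1, 4, 8, 6]) (fun s => by simp; tauto), e₁, e₂]
  refine ⟨by positivity, ?_⟩
  calc _ ≤ 14080 * (364 * (243 * (27 * (16 * (5 * (4 * (3 * 2))))))) := by gcongr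
    _ ≤ _ := by norm_num

end UpperBound

/-! ### Groups acting through the table -/

/-- The points `ι x`, `x < n`, are permuted as described by the table. -/
structure TableAct {Γ W : Type} [Group Γ] [MulAction Γ W] (p : ℕ → Γ) (T : ℕ → ℕ) (n : ℕ)
    (ι : ℕ → W) : Prop where
  cox : IsCox p
  range : ∀ x < n, ∀ s < 9, nbr T s x < n
  inj : Set.InjOn ι (Set.Iio n)
  act : ∀ x < n, ∀ s < 9, p s • ι x = ι (nbr T s x)

namespace TableAct

variable {Γ W : Type} [Group Γ] [MulAction Γ W] {p : ℕ → Γ} {T : ℕ → ℕ} {n : ℕ} {ι : ℕ → W}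
variable (A : TableAct p T n ι)
include A

lemma exists_smul_of_reach {L : List ℕ} (hL : ∀ s ∈ L, s < 9) {x y : ℕ} (hx : x < n)
    (h : Reach T L x y) : y < n ∧ ∃ g ∈ parabolic p L, g • ι x = ι y := by
  induction h with
  | refl => exact ⟨hx, 1, one_mem _, one_smul _ _⟩
  | tail _ h ih =>
    obtain ⟨s, hs, rfl⟩ := h
    obtain ⟨hy, g, hg, e⟩ := ih
    refine ⟨A.range _ hy _ (hL s hs), p s * g, mul_mem (mem_parabolic hs) hg, ?_⟩
    rw [mul_smul, e, A.act _ hy _ (hL s hs)]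

lemma exists_smul_of_minsIn {L B : List ℕ} (hL : ∀ s ∈ L, s < 9) (h : minsIn T n L B = true)
    {x : ℕ} (hx : x < n) : ∃ b ∈ B, b < n ∧ ∃ g ∈ parabolic p L, g • ι b = ι x := by
  rw [minsIn, allBelow_iff] at h
  induction x using Nat.strong_induction_on with
  | _ x ih =>
    by_cases hm : isMin T L x = true
    · have := h x hx
      rw [ifz_eq, if_pos hm, memb_eq] at this
      exact ⟨x, this, hx, 1, one_mem _, one_smul _ _⟩
    · rw [isMin_iff] at hm
      push Not at hm
      obtain ⟨s, hs, hm⟩ := hm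
      obtain ⟨b, hb, hbn, g, hg, e⟩ := ih _ hm (hm.trans hx)
      refine ⟨b, hb, hbn, p s * g, mul_mem (mem_parabolic hs) hg, ?_⟩
      rw [mul_smul, e, ← A.act _ hx _ (hL s hs), ← mul_smul, A.cox.invol _ (hL s hs), one_smul]

lemma le_ncard_orbit [Finite Γ] {L : List ℕ} (hL : ∀ s ∈ L, s < 9) {v y : ℕ} (hy : y < n)
    (h : orbitGe T L v y = true) : v ≤ (MulAction.orbit (parabolic p L) (ι y)).ncard := by
  obtain ⟨F, hF, hr⟩ := orbitGe_sound h
  have hi : Set.InjOn ι F := A.inj.mono fun u hu => (A.exists_smul_of_reach hL hy (hr u hu)).1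
  rw [← Set.ncard_coe_finset, ← hi.ncard_image] at hF
  refine hF.trans ?_
  refine Set.ncard_le_ncard ?_ (Set.finite_range _)
  rintro _ ⟨u, hu, rfl⟩
  obtain ⟨-, g, hg, e⟩ := A.exists_smul_of_reach hL hy (hr u hu)
  exact ⟨⟨g, hg⟩, e⟩

omit A in
lemma card_stabilizer_mul [Finite Γ] (S : Subgroup Γ) (w : W) :
    (MulAction.orbit S w).ncard * Nat.card (S ⊓ MulAction.stabilizer Γ w : Subgroup Γ) =
      Nat.card S := by
  have h := Subgroup.relIndex_mul_relIndex ⊥ (MulAction.stabilizer Γ w ⊓ S) S bot_le inf_le_right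
  rw [Subgroup.inf_relIndex_right, Subgroup.relIndex_bot_left, Subgroup.relIndex_bot_left] at h
  rw [← h, ← MulAction.index_stabilizer, mul_comm, inf_comm]
  rfl

lemma parabolic_le_stabilizer {L : List ℕ} {y : ℕ} (hL : ∀ s ∈ L, s < 9) (hy : y < n)
    (h : fixesAll T L [y] = true) : parabolic p L ≤ MulAction.stabilizer Γ (ι y) := by
  rw [parabolic, Subgroup.closure_le]
  rintro _ ⟨s, hs, rfl⟩
  simp only [fixesAll, allOf_iff, beq_eq_decide, decide_eq_true_iff] at h
  rw [SetLike.mem_coe, MulAction.mem_stabilizer_iff, A.act _ hy _ (hL s hs),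
    h s hs y List.mem_cons_self]

/-- One step in the computation of the order by a chain of stabilizers. -/
lemma stabilizer_step [Finite Γ] {L L' : List ℕ} {S : Subgroup Γ} {v y : ℕ}
    (hS : parabolic p L ≤ S) (h : orbitGe T L v y = true) (hf : fixesAll T L' [y] = true)
    (hL : (∀ s ∈ L, s < 9) ∧ ∀ s ∈ L', s ∈ L) (hy : y < n) :
    parabolic p L' ≤ S ⊓ MulAction.stabilizer Γ (ι y) ∧
      v * Nat.card (S ⊓ MulAction.stabilizer Γ (ι y) : Subgroup Γ) ≤ Nat.card S := by
  refine ⟨le_inf ((parabolic_mono hL.2).trans hS)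
    (A.parabolic_le_stabilizer (fun s hs => hL.1 s (hL.2 s hs)) hy hf), ?_⟩
  rw [← card_stabilizer_mul S (ι y)]
  refine Nat.mul_le_mul_right _ ((A.le_ncard_orbit hL.1 hy h).trans ?_)
  refine Set.ncard_le_ncard ?_ (Set.finite_range _)
  rintro _ ⟨g, rfl⟩
  exact ⟨⟨g, hS g.2⟩, rfl⟩

lemma wd_smul {w : List ℕ} (hw : ∀ s ∈ w, s < 9) : ∀ c, pt c < n →
    pt (w.foldl (fun c s => codeAct T s c) c) < n ∧
      wd p w.reverse • ι (pt c) = ι (pt (w.foldl (fun c s => codeAct T s c) c)) := by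
  induction w with
  | nil => intro c hc; exact ⟨hc, one_smul _ _⟩
  | cons s w ih =>
    intro c hc
    have hs : s < 9 := hw s List.mem_cons_self
    obtain ⟨h1, h2⟩ := ih (fun t ht => hw t (List.mem_cons_of_mem _ ht)) (codeAct T s c)
      (by rw [pt_codeAct]; exact A.range _ hc _ hs)
    refine ⟨h1, ?_⟩
    rw [wd_reverse_cons, mul_smul, A.act _ hc _ hs, ← pt_codeAct, h2]
    rfl

lemma trivOn_iff {w B : List ℕ} (hw : ∀ s ∈ w, s < 9) (hB : ∀ x ∈ B, x < n) :
    trivOn T w B = true ↔ ∀ x ∈ B, wd p w.reverse • ι x = ι x := by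
  rw [trivOn, allOf_iff]
  refine forall₂_congr fun x hx => ?_
  have e : pt (2 * x) = x := pt_two_mul x
  obtain ⟨h1, h2⟩ := A.wd_smul hw (2 * x) (by rw [e]; exact hB x hx)
  rw [follow_eq, beq_eq_decide, decide_eq_true_iff, nat_mul]
  rw [e] at h2
  rw [h2]
  exact ⟨congrArg ι, fun h => A.inj h1 (hB x hx) h⟩

end TableAct

open MulAction

/-! ### The order and the simplicity of the group -/

/-- A group with the relations of `Fi22` which acts through the checked table. -/
structure TableGroup {Γ W : Type} [Group Γ] [MulAction Γ W] (p : ℕ → Γ) (T : ℕ → ℕ)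
    (ι : ℕ → W) : Prop extends SimpleData p, TableAct p T 14080 ι where
  ok : tableOk T 14080 = true
  top : parabolic p [0, 1, 2, 3, 4, 5, 6, 7, 8] = ⊤

namespace TableGroup

variable {Γ W : Type} [Group Γ] [MulAction Γ W] {p : ℕ → Γ} {T : ℕ → ℕ} {ι : ℕ → W}
variable (A : TableGroup p T ι)
include A

lemma card_pos_le : 0 < Nat.card Γ ∧ Nat.card Γ ≤ 2 ^ 17 * 3 ^ 9 * 5 ^ 2 * 7 * 11 * 13 := by
  have := A.toSimpleData.card_parabolic_le
  rwa [A.top, Subgroup.card_top] at this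

lemma finite : Finite Γ := Nat.finite_of_card_ne_zero A.card_pos_le.1.ne'

lemma orbit_zero : orbit Γ (ι 0) = ι '' Set.Iio 14080 := by
  have h := A.ok
  simp only [tableOk, stabOk, band_iff] at h
  apply Set.Subset.antisymm
  · rintro _ ⟨g, rfl⟩
    have hg : g ∈ parabolic p [0, 1, 2, 3, 4, 5, 6, 7, 8] := A.top ▸ Subgroup.mem_top g
    refine smul_mem_of_parabolic A.toTableAct.cox (by decide) ?_ hg _ ⟨0, by decide, rfl⟩
    rintro s hs _ ⟨x, hx, rfl⟩
    have hs9 : s < 9 := by revert s; decide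
    exact ⟨_, A.range x hx s hs9, (A.act x hx s hs9).symm⟩
  · rintro _ ⟨x, hx, rfl⟩
    obtain ⟨b, hb, -, g, -, e⟩ := A.exists_smul_of_minsIn (by decide) h.2.2.2.1.1 hx
    rw [List.mem_singleton] at hb
    exact ⟨g, hb ▸ e⟩

lemma index_stabilizer_zero : (stabilizer Γ (ι 0)).index = 14080 := by
  rw [index_stabilizer, A.orbit_zero, A.inj.ncard_image, ← Finset.coe_Iio, Set.ncard_coe_finset,
    Nat.card_Iio]

/-- The order of the group, and the triviality of the stabilizer of the base. -/
lemma card_eq_and_fixed : Nat.card Γ = 2 ^ 17 * 3 ^ 9 * 5 ^ 2 * 7 * 11 * 13 ∧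
    ∀ g : Γ, (∀ x ∈ base, g • ι x = ι x) → g = 1 := by
  have := A.finite
  have h := A.ok
  simp only [tableOk, fixOk, stabOk, band_iff] at h
  obtain ⟨-, ⟨f0, f1, f2, f3, f4, f5, f8⟩, -, ⟨-, -, -, o1, o2, o3, o4, o5, o8, o7⟩, -⟩ := h
  have e0 : 14080 * Nat.card (stabilizer Γ (ι 0)) = Nat.card Γ := by
    rw [← A.index_stabilizer_zero, mul_comm, Subgroup.card_mul_index]
  have i0 := A.parabolic_le_stabilizer (by decide) (by decide) f0
  obtain ⟨i1, e1⟩ := A.stabilizer_step i0 o1 f1 (by decide) (by decide)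
  obtain ⟨i2, e2⟩ := A.stabilizer_step i1 o2 f2 (by decide) (by decide)
  obtain ⟨i3, e3⟩ := A.stabilizer_step i2 o3 f3 (by decide) (by decide)
  obtain ⟨i4, e4⟩ := A.stabilizer_step i3 o4 f4 (by decide) (by decide)
  obtain ⟨i5, e5⟩ := A.stabilizer_step i4 o5 f5 (by decide) (by decide)
  obtain ⟨i8, e8⟩ := A.stabilizer_step i5 o8 f8 (by decide) (by decide)
  obtain ⟨-, e7⟩ := A.stabilizer_step (L' := []) i8 o7 rfl (by decide) (by decide)
  have hpos := Nat.card_pos (α := (stabilizer Γ (ι 0) ⊓ stabilizer Γ (ι 1) ⊓ stabilizer Γ (ι 2) ⊓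
    stabilizer Γ (ι 3) ⊓ stabilizer Γ (ι 4) ⊓ stabilizer Γ (ι 5) ⊓ stabilizer Γ (ι 8) ⊓
    stabilizer Γ (ι 7) : Subgroup Γ))
  have hle := A.card_pos_le.2
  norm_num at hle ⊢
  refine ⟨by omega, fun g hg => ?_⟩
  have hbot := Subgroup.card_eq_one.1 (show Nat.card (stabilizer Γ (ι 0) ⊓ stabilizer Γ (ι 1) ⊓
    stabilizer Γ (ι 2) ⊓ stabilizer Γ (ι 3) ⊓ stabilizer Γ (ι 4) ⊓ stabilizer Γ (ι 5) ⊓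
    stabilizer Γ (ι 8) ⊓ stabilizer Γ (ι 7) : Subgroup Γ) = 1 by omega)
  rw [← Subgroup.mem_bot, ← hbot]
  simp only [Subgroup.mem_inf, mem_stabilizer_iff]
  simp only [base, List.mem_cons, List.not_mem_nil, or_false, forall_eq_or_imp, forall_eq] at hg
  tauto

lemma wd_eq_one_of_trivOn {w : List ℕ} (hw : ∀ s ∈ w, s < 9) (h : trivOn T w base = true) :
    wd p w.reverse = 1 :=
  A.card_eq_and_fixed.2 _ ((A.trivOn_iff hw (by decide)).1 h)

lemma wd_x₁₁_pow : wd p x₁₁ ^ 11 = 1 := by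
  have h := A.ok
  simp only [tableOk, wordOk, band_iff] at h
  have h1 := A.wd_eq_one_of_trivOn (by decide +kernel) h.2.2.1.1
  rwa [wd_reverse A.toTableAct.cox (by decide +kernel), inv_eq_one, wd_pw] at h1

lemma wd_x₁₁_conj : (((wd p x₁₁)⁻¹ * p 0 * wd p x₁₁) * p 3) ^ 3 = 1 := by
  have h := A.ok
  simp only [tableOk, wordOk, band_iff] at h
  have h1 := A.wd_eq_one_of_trivOn (by decide +kernel) h.2.2.1.2.2
  rw [List.reverse_reverse, wd_pw] at h1
  simpa only [wd_append, wd_cons, wd_nil, wd_reverse A.toTableAct.cox (w := x₁₁) (by decide),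
    mul_one, mul_assoc] using h1

omit A in
/-- The generators of a quotient coincide as soon as two commuting ones do. -/
lemma gen_eq_one {Q : Type*} [Group Q] {q : ℕ → Q} (hq : IsCox q) (h03 : q 0 = q 3)
    (h9 : wd q u₁ ^ 9 = 1) : ∀ s ∈ [0, 1, 2, 3, 4, 5, 6, 7, 8], q s = 1 := by
  have key (s t r : ℕ) (hs : s < 9) (ht : t < 9) (hr : r < 9) (a : adjc s t = true)
      (b : adjc r t = false) (hsr : q s = q 0) (hr0 : q r = q 0) : q t = q 0 := by
    have h1 := hq.braid s hs t ht a
    have h2 := hq.comm r hr t ht b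
    rw [hr0] at h2
    rw [hsr, h2, mul_assoc, mul_assoc, mul_right_inj, mul_right_inj] at h1
    rw [← h1]
  have h3 := h03.symm
  have h1 := key 0 1 3 (by decide) (by decide) (by decide) (by decide +kernel) (by decide +kernel) rfl h3
  have h2 := key 1 2 0 (by decide) (by decide) (by decide) (by decide +kernel) (by decide +kernel) h1 rfl
  have h4 := key 3 4 0 (by decide) (by decide) (by decide) (by decide +kernel) (by decide +kernel) h3 rfl
  have h7 := key 3 7 0 (by decide) (by decide) (by decide) (by decide +kernel) (by decide +kernel) h3 rfl
  have h8 := key 7 8 0 (by decide) (by decide) (by decide) (by decide +kernel) (by decide +kernel) h7 rfl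
  have h5 := key 4 5 0 (by decide) (by decide) (by decide) (by decide +kernel) (by decide +kernel) h4 rfl
  have h6 := key 5 6 0 (by decide) (by decide) (by decide) (by decide +kernel) (by decide +kernel) h5 rfl
  have h0 : q 0 = 1 := by
    have hsq : q 0 ^ 2 = 1 := by rw [pow_two, hq.invol 0 (by decide)]
    have : wd q u₁ = q 0 ^ 7 := by
      simp only [u₁, wd_cons, wd_nil, h1, h2, h3, h4, h5, h7]
      simp only [pow_succ, pow_zero, one_mul, mul_one, mul_assoc]
    rw [this, ← pow_mul, show 7 * 9 = 2 * 31 + 1 from rfl, pow_succ, pow_mul, hsq, one_pow,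
      one_mul] at h9
    exact h9
  simp only [List.mem_cons, List.not_mem_nil, or_false, forall_eq_or_imp, forall_eq]
  simp only [h1, h2, h3, h4, h5, h6, h7, h8, h0, and_self]

lemma eq_top_of_x₁₁_mem {N : Subgroup Γ} [N.Normal] (hx : wd p x₁₁ ∈ N) : N = ⊤ := by
  let π := QuotientGroup.mk' N
  have hq : IsCox fun s => π (p s) := A.toTableAct.cox.map π
  have h3 := congrArg π A.wd_x₁₁_conj
  have hx1 : π (wd p x₁₁) = 1 := (QuotientGroup.eq_one_iff _).2 hx
  simp only [map_pow, map_mul, map_inv, hx1, inv_one, one_mul, mul_one, map_one] at h3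
  have h2 : (π (p 0) * π (p 3)) ^ 2 = 1 := by
    have hc := hq.comm 0 (by decide) 3 (by decide) (by decide +kernel)
    rw [pow_two, mul_assoc, ← mul_assoc (π (p 3)), ← hc, mul_assoc, hq.invol 3 (by decide), mul_one,
      hq.invol 0 (by decide)]
  have h03 : π (p 0) = π (p 3) := by
    rw [pow_succ, h2, one_mul, mul_eq_one_iff_eq_inv] at h3
    rw [h3, inv_eq_of_mul_eq_one_left (hq.invol 3 (by decide))]
  have h9 : wd (fun s => π (p s)) u₁ ^ 9 = 1 := by
    rw [← wd_map, ← map_pow, A.one, map_one]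
  rw [eq_top_iff, ← A.top, parabolic, Subgroup.closure_le]
  rintro _ ⟨s, hs, rfl⟩
  exact (QuotientGroup.eq_one_iff _).1 (gen_eq_one hq h03 h9 s hs)

/-- A nontrivial normal subgroup has orbits of length at least 1282. -/
lemma ncard_orbit_normal {N : Subgroup Γ} [hN : N.Normal] (h : N ≠ ⊥) :
    1282 ≤ (orbit N (ι 0)).ncard := by
  have := A.finite
  have hok := A.ok
  simp only [tableOk, fixOk, stabOk, band_iff, allOf_iff] at hok
  obtain ⟨-, ⟨f0, -⟩, -, ⟨-, hmin, ho, o1, -⟩, -⟩ := hok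
  have hfix := A.parabolic_le_stabilizer (by decide) (by decide) f0
  obtain ⟨m, hm, hm0⟩ : ∃ m ∈ N, m • ι 0 ≠ ι 0 := by
    by_contra! hall
    refine h ((Subgroup.eq_bot_iff_forall _).2 fun m hm => A.card_eq_and_fixed.2 m fun x hx => ?_)
    have hx' : ι x ∈ orbit Γ (ι 0) := A.orbit_zero ▸ ⟨x, by revert x; decide, rfl⟩
    obtain ⟨g, hg⟩ := hx'
    change g • ι 0 = ι x at hg
    have := hall _ (hN.conj_mem m hm g⁻¹)
    rw [inv_inv, mul_smul, mul_smul, inv_smul_eq_iff] at this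
    rw [← hg, this]
  have hx : m • ι 0 ∈ orbit Γ (ι 0) := ⟨m, rfl⟩
  rw [A.orbit_zero] at hx
  obtain ⟨x, hx, hxm⟩ := hx
  obtain ⟨b, hb, hbn, g, hg, hgb⟩ := A.exists_smul_of_minsIn (by decide) hmin hx
  rw [hxm] at hgb
  have hb0 : b ≠ 0 := by
    rintro rfl
    exact hm0 (hgb.symm.trans (hfix hg))
  have hsize : 1281 ≤ (orbit (parabolic p [0, 1, 2, 3, 4, 5, 7, 8]) (ι b)).ncard := by
    simp only [List.mem_cons, hb0, false_or] at hb
    rcases hb with rfl | hb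
    · exact le_trans (by decide) (A.le_ncard_orbit (by decide) hbn o1)
    · exact A.le_ncard_orbit (by decide) hbn (ho b (by simpa using hb))
  have hnot : ι 0 ∉ orbit (parabolic p [0, 1, 2, 3, 4, 5, 7, 8]) (ι b) := by
    rintro ⟨k, hk⟩
    change (k : Γ) • ι b = ι 0 at hk
    have h1 : (k : Γ) • ι 0 = ι 0 := hfix k.2
    have h2 := smul_left_cancel _ (hk.trans h1.symm)
    exact hb0 (A.inj hbn (by decide) h2)
  have hsub : insert (ι 0) (orbit (parabolic p [0, 1, 2, 3, 4, 5, 7, 8]) (ι b)) ⊆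
      orbit N (ι 0) := by
    rintro _ (rfl | ⟨k, rfl⟩)
    · exact mem_orbit_self _
    · refine ⟨⟨_, hN.conj_mem m hm ((k : Γ) * g⁻¹)⟩, ?_⟩
      change ((k : Γ) * g⁻¹ * m * ((k : Γ) * g⁻¹)⁻¹) • ι 0 = (k : Γ) • ι b
      have h1 : ((k : Γ) * g⁻¹)⁻¹ • ι 0 = ι 0 :=
        inv_mem (hfix (mul_mem k.2 (inv_mem hg)))
      rw [mul_smul, h1, mul_smul, ← hgb, mul_smul, inv_smul_smul]
  have hle := Set.ncard_le_ncard hsub (Set.finite_range _)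
  rw [Set.ncard_insert_of_notMem hnot (Set.finite_range _)] at hle
  omega

omit A in
lemma relIndex_dvd_index_of_normal_right {G : Type*} [Group G] [Finite G] (S N : Subgroup G)
    [N.Normal] : S.relIndex N ∣ S.index := by
  have h1 := Subgroup.relIndex_mul_relIndex (S ⊓ N) S (S ⊔ N) inf_le_left le_sup_left
  have h2 := Subgroup.relIndex_mul_relIndex (S ⊓ N) N (S ⊔ N) inf_le_right le_sup_right
  rw [Subgroup.inf_relIndex_left] at h1
  rw [Subgroup.inf_relIndex_right, Subgroup.relIndex_sup_right, ← h1, mul_comm] at h2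
  have h0 : N.relIndex S ≠ 0 := Subgroup.index_ne_zero_of_finite
  rw [Nat.eq_of_mul_eq_mul_left (Nat.pos_of_ne_zero h0) h2]
  exact Subgroup.relIndex_dvd_index_of_le le_sup_left

lemma eleven_dvd_card {N : Subgroup Γ} [hN : N.Normal] (h : N ≠ ⊥) : 11 ∣ Nat.card N := by
  have := A.finite
  have hge := A.ncard_orbit_normal h
  have h1 : (orbit N (ι 0)).ncard = (stabilizer Γ (ι 0)).relIndex N :=
    (index_stabilizer N (ι 0)).symm
  have h2 : (orbit N (ι 0)).ncard ∣ 14080 := by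
    rw [h1, ← A.index_stabilizer_zero]
    exact relIndex_dvd_index_of_normal_right _ _
  refine dvd_trans ?_ (h1 ▸ Subgroup.relIndex_dvd_card _ _)
  by_contra h11
  have hc : Nat.Coprime (orbit N (ι 0)).ncard 11 :=
    ((Nat.Prime.coprime_iff_not_dvd (by norm_num)).2 h11).symm
  have := Nat.le_of_dvd (by norm_num) (hc.dvd_of_dvd_mul_right (m := 1280) h2)
  omega

lemma eq_top_of_normal {N : Subgroup Γ} [hN : N.Normal] (h : N ≠ ⊥) : N = ⊤ := by
  have := A.finite
  refine A.eq_top_of_x₁₁_mem ?_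
  obtain ⟨k, hk⟩ := A.eleven_dvd_card h
  have hi := N.card_mul_index
  rw [hk, A.card_eq_and_fixed.1, mul_assoc] at hi
  have hi' : k * N.index = 2 ^ 17 * 3 ^ 9 * 5 ^ 2 * 7 * 13 := by omega
  have h11 : ¬ 11 ∣ N.index := by
    intro hd
    exact absurd (hi' ▸ hd.mul_left k) (by norm_num)
  rw [← QuotientGroup.eq_one_iff, ← orderOf_eq_one_iff]
  have d1 : orderOf ((wd p x₁₁ : Γ) : Γ ⧸ N) ∣ 11 := orderOf_dvd_of_pow_eq_one (by
    rw [← QuotientGroup.mk_pow, A.wd_x₁₁_pow, QuotientGroup.mk_one])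
  have d2 : orderOf ((wd p x₁₁ : Γ) : Γ ⧸ N) ∣ N.index := orderOf_dvd_natCard _
  rcases (Nat.dvd_prime (by norm_num)).1 d1 with e | e
  · exact e
  · exact absurd (e ▸ d2) h11

theorem isSimpleGroup : IsSimpleGroup Γ where
  exists_pair_ne := by
    have := A.finite
    have : 1 < Nat.card Γ := by rw [A.card_eq_and_fixed.1]; norm_num
    exact (Finite.one_lt_card_iff_nontrivial.1 this).exists_pair_ne
  eq_bot_or_eq_top_of_normal N hN := or_iff_not_imp_left.2 fun h => A.eq_top_of_normal h

end TableGroup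

open Equiv

/-! ### The quotient of `H1` -/

/-- The adjusted generators, as elements of `H1`. -/
def hp (s : ℕ) : H1sub :=
  ⟨yp s, if hs : s < 9 then yp_mem_H1sub hs else by
    have : fgen s = 1 := by
      unfold fgen
      split <;> first | omega | rfl
    rw [yp, this, map_one, one_mul]
    exact H1sub.pow_mem yz_mem_H1sub _⟩

lemma coe_wd_hp (w : List ℕ) : ((wd hp w : H1sub) : A1) = wd yp w :=
  wd_map H1sub.subtype hp w

lemma isCox_hp : IsCox hp where
  invol s hs := Subtype.ext (coverData_A1.cox.invol s hs)
  comm s hs t ht a := Subtype.ext (coverData_A1.cox.comm s hs t ht a)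
  braid s hs t ht a := Subtype.ext (coverData_A1.cox.braid s hs t ht a)

lemma simpleData_map {K : Type*} [Group K] (π : H1sub →* K) (hz : π ⟨yz, yz_mem_H1sub⟩ = 1) :
    SimpleData fun s => π (hp s) where
  cox := isCox_hp.map π
  spider := by
    rw [← wd_map, ← map_pow, show wd hp spider ^ 10 = 1 from Subtype.ext (by
      rw [Subgroup.coe_pow, coe_wd_hp, coverData_A1.spider, Subgroup.coe_one]), map_one]
  one := by
    rw [← wd_map, ← map_pow, show wd hp u₁ ^ 9 = 1 from Subtype.ext (by
      rw [Subgroup.coe_pow, coe_wd_hp, coverData_A1.one, Subgroup.coe_one]), map_one]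
  two := by
    rw [← wd_map, ← map_pow, show wd hp u₂ ^ 9 = ⟨yz, yz_mem_H1sub⟩ from Subtype.ext (by
      rw [Subgroup.coe_pow, coe_wd_hp, coverData_A1.two]), hz]

lemma parabolic_map_eq_top {K : Type} [Group K] {π : H1sub →* K} (hπ : Function.Surjective π)
    (hz : π ⟨yz, yz_mem_H1sub⟩ = 1) :
    parabolic (fun s => π (hp s)) [0, 1, 2, 3, 4, 5, 6, 7, 8] = ⊤ := by
  rw [eq_top_iff]
  intro k _
  obtain ⟨g, rfl⟩ := hπ k
  set S := parabolic (fun s => π (hp s)) [0, 1, 2, 3, 4, 5, 6, 7, 8]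
  have hle : H1sub ≤ (S.comap π).map H1sub.subtype := by
    refine H1sub_le (fun s hs => ⟨hp s, ?_, rfl⟩) ⟨⟨yz, yz_mem_H1sub⟩, ?_, rfl⟩
    · exact mem_parabolic (p := fun s => π (hp s)) (by revert s; decide)
    · change π _ ∈ S
      rw [hz]
      exact S.one_mem
  obtain ⟨g', hg', e⟩ := hle g.2
  obtain rfl : g' = g := Subtype.ext e
  exact hg'

variable [hn : ((Subgroup.zpowers yz).subgroupOf H1sub).Normal]

theorem isSimpleGroup_and_card :
    IsSimpleGroup (H1sub ⧸ (Subgroup.zpowers yz).subgroupOf H1sub) ∧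
      Nat.card (H1sub ⧸ (Subgroup.zpowers yz).subgroupOf H1sub) =
        2 ^ 17 * 3 ^ 9 * 5 ^ 2 * 7 * 11 * 13 := by
  obtain ⟨T, hT, hok⟩ := exists_tableOk
  let π := QuotientGroup.mk' ((Subgroup.zpowers yz).subgroupOf H1sub)
  have hz : π ⟨yz, yz_mem_H1sub⟩ = 1 := (QuotientGroup.eq_one_iff _).2
    (Subgroup.mem_subgroupOf.2 (Subgroup.mem_zpowers yz))
  let X := {x // x < 14080}
  let ψ : (H1sub ⧸ (Subgroup.zpowers yz).subgroupOf H1sub) →* Perm (X ⊕ X) :=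
    QuotientGroup.lift _ (hT.coverData_pperm.hom.comp H1sub.subtype) (by
      intro g hg
      obtain ⟨k, hk⟩ := Subgroup.mem_subgroupOf.1 hg
      change hT.coverData_pperm.hom (g : A1) = 1
      rw [← hk]
      change hT.coverData_pperm.hom (yz ^ k) = 1
      rw [map_zpow, hT.coverData_pperm.hom_yz, show ((1, 1) : Perm X × Perm X) = 1 from rfl,
        map_one, one_zpow])
  let _ : MulAction (H1sub ⧸ (Subgroup.zpowers yz).subgroupOf H1sub) (X ⊕ X) :=
    MulAction.compHom _ ψ
  let ι (x : ℕ) : X ⊕ X := Sum.inl (if hx : x < 14080 then ⟨x, hx⟩ else ⟨0, by decide⟩)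
  have A : TableGroup (fun s => π (hp s)) T ι :=
    { simpleData_map π hz with
      cox := isCox_hp.map π
      range := hT.range
      inj := by
        intro x hx y hy e
        rw [Set.mem_Iio] at hx hy
        simp only [ι, hx, hy, dif_pos] at e
        exact congrArg Subtype.val (Sum.inl.inj e)
      act := by
        intro x hx s hs
        change hT.coverData_pperm.hom (yp s) (ι x) = _
        rw [hT.coverData_pperm.hom_yp hs]
        have h1 := hT.range x hx s hs
        simp only [ι, hx, h1, dif_pos, Perm.sumCongrHom_apply, Equiv.sumCongr_apply, Sum.map_inl]
        exact congrArg Sum.inl (Subtype.ext (hT.pperm_apply hs _))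
      ok := hok
      top := parabolic_map_eq_top (QuotientGroup.mk'_surjective _) hz }
  exact ⟨A.isSimpleGroup, A.card_eq_and_fixed.1⟩

end CosetTable

/-- In `A1`: `z` is a central element of order `2`; `H1 = ⟨a, ..., i, z⟩` has index `2` in
`A1`; and the quotient `H1/⟨z⟩` is a simple group of order `2^17 * 3^9 * 5^2 * 7 * 11 * 13`
(the order of `Fi22`). -/
theorem z_central_H1_index_two_and_quotient_simple :
    orderOf yz = 2 ∧ yz ∈ Subgroup.center A1 ∧ H1sub.index = 2 ∧
    ∃ hn : ((Subgroup.zpowers yz).subgroupOf H1sub).Normal,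
      IsSimpleGroup (↥H1sub ⧸ (Subgroup.zpowers yz).subgroupOf H1sub) ∧
      Nat.card (↥H1sub ⧸ (Subgroup.zpowers yz).subgroupOf H1sub) =
        2 ^ 17 * 3 ^ 9 * 5 ^ 2 * 7 * 11 * 13 := by
  have hz : (Subgroup.zpowers yz).Normal := by
    refine ⟨fun x hx g => ?_⟩
    have hc : x ∈ Subgroup.center A1 := Subgroup.zpowers_le.2 CosetTable.yz_mem_center hx
    rwa [Subgroup.mem_center_iff.1 hc g, mul_inv_cancel_right]
  have hn := hz.subgroupOf H1sub
  exact ⟨CosetTable.orderOf_yz, CosetTable.yz_mem_center, CosetTable.index_H1sub, hn,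
    CosetTable.isSimpleGroup_and_card⟩
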